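/- Let Φ ∈ ℝ \ ℤ, 0 < p < 1, and let V ∈ L^∞(ℝ²) satisfy V(x) = |x|^{−2} (ln|x|)^{−1/p} (1 + o(1)) as |x| → ∞, i.e. |x|² (ln|x|)^{1/p} V(x) → 1 as |x| → ∞. For λ > 0 let N_Φ(λV) ∈ ℕ ∪ {∞} be the supremum of dim M over all finite-dimensional complex subspaces M of C_c^∞(ℝ²\{0}; ℂ) that are (λV)-negative for D_Φ. Then lim_{λ→∞} λ^{−1} N_Φ(λV) = (1/(4π)) ∫_{ℝ²} V(x)_+ dx. (Weyl-type strong-coupling asymptotics in the short-range case p < 1; note V_+ is integrable under the stated hypotheses.) -/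

import Mathlib

open MeasureTheory

/-- The square of the Euclidean norm on `ℝ²`. -/
noncomputable def sqnorm (x : ℝ × ℝ) : ℝ := x.1 ^ 2 + x.2 ^ 2

/-- Smooth compactly supported functions on `ℝ²` vanishing in a neighbourhood of `0`. -/
def IsTestFun (u : ℝ × ℝ → ℂ) : Prop :=
  ContDiff ℝ (⊤ : ℕ∞) u ∧ HasCompactSupport u ∧ ∀ᶠ x in nhds (0 : ℝ × ℝ), u x = 0

/-- The magnetic energy `∫ |D_Φ u|²` for the Aharonov–Bohm vector potential
`A(x) = |x|⁻² (x₂, -x₁)`, where `D_Φ u = -i∇u + Φ A u`. -/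
noncomputable def magEnergy (Φ : ℝ) (u : ℝ × ℝ → ℂ) : ℝ :=
  ∫ x : ℝ × ℝ,
    (‖-Complex.I * fderiv ℝ u x (1, 0) + ((Φ * (x.2 / sqnorm x) : ℝ) : ℂ) * u x‖ ^ 2 +
     ‖-Complex.I * fderiv ℝ u x (0, 1) + ((Φ * (-x.1 / sqnorm x) : ℝ) : ℂ) * u x‖ ^ 2)

/-- A subspace `M` of test functions is `V`-negative for `D_Φ` if
every nonzero `u ∈ M` satisfies `∫ |D_Φ u|² < ∫ V |u|²`. -/
def IsVNegative (Φ : ℝ) (V : ℝ × ℝ → ℝ) (M : Submodule ℂ (ℝ × ℝ → ℂ)) : Prop :=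
  (∀ u ∈ M, IsTestFun u) ∧
  ∀ u ∈ M, u ≠ 0 → magEnergy Φ u < ∫ x : ℝ × ℝ, V x * ‖u x‖ ^ 2

open scoped ENNReal

/-- The number `N(D_Φ² - W)` of negative eigenvalues, expressed via the variational
principle as the supremum of `dim M` over finite-dimensional `W`-negative subspaces of
test functions. -/
noncomputable def negEigCount (Φ : ℝ) (W : ℝ × ℝ → ℝ) : ℝ≥0∞ :=
  ⨆ (M : Submodule ℂ (ℝ × ℝ → ℂ)) (_ : FiniteDimensional ℂ M ∧ IsVNegative Φ W M),
    (Module.finrank ℂ M : ℝ≥0∞)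

/-- Parseval's identity on `(-1, 1]` for the extension of `f` from `[0, 1]` by reflection. -/
theorem hasSum_sq_reflect (f : ℝ → ℂ) (hf : Continuous f) (s : ℂ) (hs : ‖s‖ = 1) :
    HasSum (fun k : ℤ => ‖(1 / 2 : ℂ) *
      ((∫ x in (0 : ℝ)..1, Complex.exp (-(Real.pi * k * x * Complex.I)) * f x) +
        s * ∫ x in (0 : ℝ)..1, Complex.exp (Real.pi * k * x * Complex.I) * f x)‖ ^ 2)
      (∫ x in (0 : ℝ)..1, ‖f x‖ ^ 2) := by
  set F : ℝ → ℂ := fun x => (if 0 < x then 1 else s) * f |x| with hF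
  have hFm : Measurable F := by
    refine Measurable.mul ?_ (hf.comp continuous_abs).measurable
    exact Measurable.ite measurableSet_Ioi measurable_const measurable_const
  have hnorm : ∀ x, ‖F x‖ = ‖f |x|‖ := by
    intro x
    simp only [hF, norm_mul]
    split_ifs <;> simp [hs]
  have hL2 : MemLp F 2 (volume.restrict (Set.Ioc (-1 : ℝ) 1)) := by
    obtain ⟨C, hC⟩ := (isCompact_Icc (a := (0 : ℝ)) (b := 1)).exists_bound_of_continuousOn
      hf.continuousOn
    refine MemLp.of_bound hFm.aestronglyMeasurable C ?_
    filter_upwards [ae_restrict_mem measurableSet_Ioc] with x hx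
    rw [hnorm]
    exact hC _ ⟨abs_nonneg _, abs_le.2 ⟨hx.1.le, hx.2⟩⟩
  have hFi : ∀ (g : ℝ → ℂ), Continuous g → ∀ a b : ℝ, -1 ≤ a → a ≤ b → b ≤ 1 →
      IntervalIntegrable (fun x => g x * F x) volume a b := by
    intro g hg a b ha hab hb
    obtain ⟨C, hC⟩ := (isCompact_Icc (a := (0 : ℝ)) (b := 1)).exists_bound_of_continuousOn
      hf.continuousOn
    obtain ⟨D, hD⟩ := (isCompact_Icc (a := (-1 : ℝ)) (b := 1)).exists_bound_of_continuousOn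
      hg.continuousOn
    rw [intervalIntegrable_iff_integrableOn_Ioc_of_le hab]
    refine Measure.integrableOn_of_bounded (M := D * C) (by simp)
      (hg.measurable.mul hFm).aestronglyMeasurable ?_
    filter_upwards [ae_restrict_mem measurableSet_Ioc] with x hx
    rw [norm_mul, hnorm]
    have h1 : -1 ≤ x := by linarith [hx.1]
    have h2 : x ≤ 1 := by linarith [hx.2]
    exact mul_le_mul (hD _ ⟨h1, h2⟩) (hC _ ⟨abs_nonneg _, abs_le.2 ⟨h1, h2⟩⟩)
      (norm_nonneg _) ((norm_nonneg _).trans (hD _ ⟨h1, h2⟩))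
  have key := hasSum_sq_fourierCoeffOn (by norm_num : (-1 : ℝ) < 1) hL2
  have hint : ((1 : ℝ) - -1)⁻¹ • ∫ x in (-1 : ℝ)..1, ‖F x‖ ^ 2 =
      ∫ x in (0 : ℝ)..1, ‖f x‖ ^ 2 := by
    simp only [hnorm]
    have hc : Continuous fun x : ℝ => ‖f |x|‖ ^ 2 := by fun_prop
    rw [← intervalIntegral.integral_add_adjacent_intervals (b := 0)
      (hc.intervalIntegrable _ _) (hc.intervalIntegrable _ _)]
    have h1 : ∫ x in (-1 : ℝ)..0, ‖f |x|‖ ^ 2 = ∫ x in (0 : ℝ)..1, ‖f |x|‖ ^ 2 := by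
      have := intervalIntegral.integral_comp_neg (a := 0) (b := 1) (fun x : ℝ => ‖f |x|‖ ^ 2)
      simpa using this.symm
    have h2 : ∫ x in (0 : ℝ)..1, ‖f |x|‖ ^ 2 = ∫ x in (0 : ℝ)..1, ‖f x‖ ^ 2 := by
      refine intervalIntegral.integral_congr fun x hx => ?_
      rw [Set.uIcc_of_le zero_le_one] at hx
      simp [abs_of_nonneg hx.1]
    rw [h1, h2, smul_eq_mul]
    ring
  rw [hint] at key
  convert key using 4 with k
  rw [fourierCoeffOn_eq_integral]
  have hexp : ∀ x : ℝ, (fourier (-k) (x : AddCircle ((1 : ℝ) - -1)) : ℂ) =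
      Complex.exp (-(Real.pi * k * x * Complex.I)) := by
    intro x
    rw [fourier_coe_apply]
    congr 1
    push_cast
    ring
  simp only [hexp, smul_eq_mul]
  have hg : Continuous fun x : ℝ => Complex.exp (-(Real.pi * k * x * Complex.I)) := by fun_prop
  rw [← intervalIntegral.integral_add_adjacent_intervals (b := 0)
    (hFi _ hg (-1) 0 le_rfl (by norm_num) (by norm_num))
    (hFi _ hg 0 1 (by norm_num) (by norm_num) le_rfl)]
  have h1 : ∫ x in (-1 : ℝ)..0, Complex.exp (-(Real.pi * k * x * Complex.I)) * F x =
      s * ∫ x in (0 : ℝ)..1, Complex.exp (Real.pi * k * x * Complex.I) * f x := by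
    have := intervalIntegral.integral_comp_neg (a := 0) (b := 1)
      (fun x : ℝ => Complex.exp (-(Real.pi * k * x * Complex.I)) * F x)
    rw [neg_zero] at this
    rw [← this, ← intervalIntegral.integral_const_mul]
    refine intervalIntegral.integral_congr_ae (ae_of_all _ fun x hx => ?_)
    rw [Set.uIoc_of_le zero_le_one] at hx
    simp only [hF, abs_neg, abs_of_pos hx.1, if_neg (by linarith [hx.1] : ¬ 0 < -x)]
    push_cast
    rw [show -(Real.pi * k * -(x : ℂ) * Complex.I) = Real.pi * k * x * Complex.I by ring]
    ring
  have h2 : ∫ x in (0 : ℝ)..1, Complex.exp (-(Real.pi * k * x * Complex.I)) * F x =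
      ∫ x in (0 : ℝ)..1, Complex.exp (-(Real.pi * k * x * Complex.I)) * f x := by
    refine intervalIntegral.integral_congr_ae (ae_of_all _ fun x hx => ?_)
    rw [Set.uIoc_of_le zero_le_one] at hx
    simp only [hF, abs_of_pos hx.1, if_pos hx.1, one_mul]
  rw [h1, h2, add_comm]
  norm_num
  ring

/-- The cosine coefficients of `f` on `[0, 1]`. -/
noncomputable def cosCoeff (f : ℝ → ℂ) (k : ℤ) : ℂ :=
  ∫ x in (0 : ℝ)..1, (Real.cos (Real.pi * k * x) : ℂ) * f x

theorem hasSum_sq_cosCoeff {f : ℝ → ℂ} (hf : Continuous f) :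
    HasSum (fun k : ℤ => ‖cosCoeff f k‖ ^ 2) (∫ x in (0 : ℝ)..1, ‖f x‖ ^ 2) := by
  convert hasSum_sq_reflect f hf 1 (by simp) using 4 with k
  rw [one_mul, ← intervalIntegral.integral_add
      (Continuous.intervalIntegrable (by fun_prop) _ _)
      (Continuous.intervalIntegrable (by fun_prop) _ _),
    ← intervalIntegral.integral_const_mul, cosCoeff]
  refine intervalIntegral.integral_congr fun x _ => ?_
  simp only [Complex.ofReal_cos, Complex.cos]
  push_cast
  ring_nf

theorem hasSum_sq_cosCoeff_deriv {f f' : ℝ → ℂ} (hf : ∀ x, HasDerivAt f (f' x) x)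
    (hf' : Continuous f') :
    HasSum (fun k : ℤ => (Real.pi * k) ^ 2 * ‖cosCoeff f k‖ ^ 2)
      (∫ x in (0 : ℝ)..1, ‖f' x‖ ^ 2) := by
  have hfc : Continuous f := continuous_iff_continuousAt.2 fun x => (hf x).continuousAt
  convert hasSum_sq_reflect f' hf' (-1) (by simp) using 2 with k
  have hsin : (1 / 2 : ℂ) *
      ((∫ x in (0 : ℝ)..1, Complex.exp (-(Real.pi * k * x * Complex.I)) * f' x) +
        (-1) * ∫ x in (0 : ℝ)..1, Complex.exp (Real.pi * k * x * Complex.I) * f' x) =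
      -Complex.I * ∫ x in (0 : ℝ)..1, (Real.sin (Real.pi * k * x) : ℂ) * f' x := by
    rw [neg_one_mul, ← sub_eq_add_neg, ← intervalIntegral.integral_sub
      (Continuous.intervalIntegrable (by fun_prop) _ _)
      (Continuous.intervalIntegrable (by fun_prop) _ _),
    ← intervalIntegral.integral_const_mul, ← intervalIntegral.integral_const_mul]
    refine intervalIntegral.integral_congr fun x _ => ?_
    simp only [Complex.ofReal_sin, Complex.sin]
    push_cast
    ring_nf
    simp only [Complex.I_sq]
    ring
  have hparts : ∫ x in (0 : ℝ)..1, (Real.sin (Real.pi * k * x) : ℂ) * f' x =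
      -(Real.pi * k * cosCoeff f k) := by
    have hs : ∀ x : ℝ, HasDerivAt (fun x : ℝ => (Real.sin (Real.pi * k * x) : ℂ))
        ((Real.pi * k * Real.cos (Real.pi * k * x) : ℝ) : ℂ) x := by
      intro x
      have := ((hasDerivAt_id x).const_mul (Real.pi * k)).sin
      simp only [id, mul_one] at this
      convert this.ofReal_comp using 2
      ring
    rw [intervalIntegral.integral_mul_deriv_eq_deriv_mul (fun x _ => hs x) (fun x _ => hf x)
      (Continuous.intervalIntegrable (by fun_prop) _ _)
      (Continuous.intervalIntegrable hf' _ _)]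
    have e1 : Real.sin (Real.pi * k * 1) = 0 := by
      rw [mul_one, mul_comm]; exact Real.sin_int_mul_pi k
    rw [e1, mul_zero, Real.sin_zero, cosCoeff, ← intervalIntegral.integral_const_mul]
    simp only [Complex.ofReal_zero, zero_mul, sub_zero, zero_sub]
    congr 1
    refine intervalIntegral.integral_congr fun x _ => ?_
    push_cast
    ring
  rw [hsin, hparts]
  simp only [norm_mul, norm_neg, Complex.norm_I, Complex.norm_real, Complex.norm_intCast,
    Real.norm_eq_abs]
  rw [one_mul, mul_pow, mul_pow, mul_pow, sq_abs, sq_abs]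

/-- The double cosine coefficients of `u` on the unit square. -/
noncomputable def cosCoeff₂ (u : ℝ × ℝ → ℂ) (k l : ℤ) : ℂ :=
  cosCoeff (fun y => cosCoeff (fun x => u (x, y)) k) l

theorem continuous_cosCoeff {u : ℝ × ℝ → ℂ} (hu : Continuous u) (k : ℤ) :
    Continuous fun y => cosCoeff (fun x => u (x, y)) k := by
  unfold cosCoeff
  refine intervalIntegral.continuous_parametric_intervalIntegral_of_continuous' ?_ 0 1
  simp only [Function.uncurry_def]
  fun_prop

theorem cosCoeff_add {f g : ℝ → ℂ} (hf : Continuous f) (hg : Continuous g) (k : ℤ) :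
    cosCoeff (fun x => f x + g x) k = cosCoeff f k + cosCoeff g k := by
  unfold cosCoeff
  rw [← intervalIntegral.integral_add (Continuous.intervalIntegrable (by fun_prop) _ _)
    (Continuous.intervalIntegrable (by fun_prop) _ _)]
  simp only [mul_add]

theorem cosCoeff_const_mul (c : ℂ) (f : ℝ → ℂ) (k : ℤ) :
    cosCoeff (fun x => c * f x) k = c * cosCoeff f k := by
  unfold cosCoeff
  rw [← intervalIntegral.integral_const_mul]
  simp only [mul_left_comm]

theorem cosCoeff₂_add {u v : ℝ × ℝ → ℂ} (hu : Continuous u) (hv : Continuous v) (k l : ℤ) :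
    cosCoeff₂ (fun x => u x + v x) k l = cosCoeff₂ u k l + cosCoeff₂ v k l := by
  unfold cosCoeff₂
  rw [← cosCoeff_add (continuous_cosCoeff hu k) (continuous_cosCoeff hv k)]
  congr 1
  funext y
  exact cosCoeff_add (by fun_prop) (by fun_prop) k

theorem cosCoeff₂_const_mul (c : ℂ) (u : ℝ × ℝ → ℂ) (k l : ℤ) :
    cosCoeff₂ (fun x => c * u x) k l = c * cosCoeff₂ u k l := by
  unfold cosCoeff₂
  simp only [cosCoeff_const_mul]

theorem cosCoeff₂_swap {u : ℝ × ℝ → ℂ} (hu : Continuous u) (k l : ℤ) :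
    cosCoeff₂ (fun x => u (x.2, x.1)) l k = cosCoeff₂ u k l := by
  unfold cosCoeff₂ cosCoeff
  simp only [← intervalIntegral.integral_const_mul]
  simp only [intervalIntegral.integral_of_le zero_le_one]
  rw [integral_integral_swap]
  · refine integral_congr_ae (ae_of_all _ fun y => integral_congr_ae (ae_of_all _ fun x => ?_))
    simp only
    ring
  · rw [Measure.prod_restrict]
    refine IntegrableOn.mono_set (Continuous.integrableOn_Icc (a := ((0 : ℝ), (0 : ℝ)))
      (b := (1, 1)) ?_) ?_
    · simp only [Function.uncurry_def]
      fun_prop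
    · rintro ⟨x, y⟩ ⟨h1, h2⟩
      exact ⟨⟨h1.1.le, h2.1.le⟩, ⟨h1.2, h2.2⟩⟩

theorem lintegral_sq_eq_tsum_cosCoeff {f : ℝ → ℂ} (hf : Continuous f) :
    ∫⁻ x in Set.Ioc (0 : ℝ) 1, ENNReal.ofReal (‖f x‖ ^ 2) =
      ∑' k : ℤ, ENNReal.ofReal (‖cosCoeff f k‖ ^ 2) := by
  have h := hasSum_sq_cosCoeff hf
  rw [← ENNReal.ofReal_tsum_of_nonneg (fun _ => by positivity) h.summable, h.tsum_eq,
    intervalIntegral.integral_of_le zero_le_one, ofReal_integral_eq_lintegral_ofReal]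
  · exact (Continuous.integrableOn_Icc (by fun_prop)).mono_set Set.Ioc_subset_Icc_self
  · exact ae_of_all _ fun _ => by positivity

theorem lintegral_sq_deriv_eq_tsum_cosCoeff {f f' : ℝ → ℂ} (hf : ∀ x, HasDerivAt f (f' x) x)
    (hf' : Continuous f') :
    ∫⁻ x in Set.Ioc (0 : ℝ) 1, ENNReal.ofReal (‖f' x‖ ^ 2) =
      ∑' k : ℤ, ENNReal.ofReal ((Real.pi * k) ^ 2) * ENNReal.ofReal (‖cosCoeff f k‖ ^ 2) := by
  have h := hasSum_sq_cosCoeff_deriv hf hf'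
  simp only [← ENNReal.ofReal_mul (sq_nonneg _)]
  rw [← ENNReal.ofReal_tsum_of_nonneg (fun _ => by positivity) h.summable, h.tsum_eq,
    intervalIntegral.integral_of_le zero_le_one, ofReal_integral_eq_lintegral_ofReal]
  · exact (Continuous.integrableOn_Icc (by fun_prop)).mono_set Set.Ioc_subset_Icc_self
  · exact ae_of_all _ fun _ => by positivity

theorem lintegral_lintegral_sq_eq_tsum {u : ℝ × ℝ → ℂ} (hu : Continuous u) :
    ∫⁻ y in Set.Ioc (0 : ℝ) 1, ∫⁻ x in Set.Ioc (0 : ℝ) 1, ENNReal.ofReal (‖u (x, y)‖ ^ 2) =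
      ∑' k : ℤ, ∑' l : ℤ, ENNReal.ofReal (‖cosCoeff₂ u k l‖ ^ 2) := by
  have h : ∀ y, ∫⁻ x in Set.Ioc (0 : ℝ) 1, ENNReal.ofReal (‖u (x, y)‖ ^ 2) =
      ∑' k : ℤ, ENNReal.ofReal (‖cosCoeff (fun x => u (x, y)) k‖ ^ 2) := fun y =>
    lintegral_sq_eq_tsum_cosCoeff (by fun_prop)
  simp only [h]
  rw [lintegral_tsum]
  · refine tsum_congr fun k => ?_
    exact lintegral_sq_eq_tsum_cosCoeff (continuous_cosCoeff hu k)
  · intro k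
    have := continuous_cosCoeff hu k
    exact (ENNReal.continuous_ofReal.comp (by fun_prop)).measurable.aemeasurable

theorem lintegral_lintegral_sq_deriv_eq_tsum {u u' : ℝ × ℝ → ℂ} (hu : Continuous u)
    (hd : ∀ x y, HasDerivAt (fun x => u (x, y)) (u' (x, y)) x) (hu' : Continuous u') :
    ∫⁻ y in Set.Ioc (0 : ℝ) 1, ∫⁻ x in Set.Ioc (0 : ℝ) 1, ENNReal.ofReal (‖u' (x, y)‖ ^ 2) =
      ∑' k : ℤ, ∑' l : ℤ, ENNReal.ofReal ((Real.pi * k) ^ 2) *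
        ENNReal.ofReal (‖cosCoeff₂ u k l‖ ^ 2) := by
  have h : ∀ y, ∫⁻ x in Set.Ioc (0 : ℝ) 1, ENNReal.ofReal (‖u' (x, y)‖ ^ 2) =
      ∑' k : ℤ, ENNReal.ofReal ((Real.pi * k) ^ 2) *
        ENNReal.ofReal (‖cosCoeff (fun x => u (x, y)) k‖ ^ 2) := fun y =>
    lintegral_sq_deriv_eq_tsum_cosCoeff (f := fun x => u (x, y)) (f' := fun x => u' (x, y))
      (fun x => hd x y) (by fun_prop)
  simp only [h]
  rw [lintegral_tsum]
  · refine tsum_congr fun k => ?_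
    have := continuous_cosCoeff hu k
    have hm : Measurable fun y => ENNReal.ofReal (‖cosCoeff (fun x => u (x, y)) k‖ ^ 2) :=
      (ENNReal.continuous_ofReal.comp (by fun_prop)).measurable
    rw [lintegral_const_mul _ hm, ENNReal.tsum_mul_left]
    congr 1
    exact lintegral_sq_eq_tsum_cosCoeff (continuous_cosCoeff hu k)
  · intro k
    have := continuous_cosCoeff hu k
    exact (Measurable.const_mul
      (ENNReal.continuous_ofReal.comp (by fun_prop)).measurable _).aemeasurable

/-- The unit square `(0, 1]²`. -/
def unitSq : Set (ℝ × ℝ) := Set.Ioc 0 1 ×ˢ Set.Ioc 0 1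

theorem integrableOn_unitSq {f : ℝ × ℝ → ℝ} (hf : Continuous f) : IntegrableOn f unitSq := by
  refine IntegrableOn.mono_set (hf.integrableOn_Icc (a := ((0 : ℝ), (0 : ℝ))) (b := (1, 1))) ?_
  rintro ⟨x, y⟩ ⟨h1, h2⟩
  exact ⟨⟨h1.1.le, h2.1.le⟩, ⟨h1.2, h2.2⟩⟩

theorem ofReal_integral_unitSq {f : ℝ × ℝ → ℝ} (hf : Continuous f) (h0 : ∀ x, 0 ≤ f x) :
    ENNReal.ofReal (∫ x in unitSq, f x) =
      ∫⁻ y in Set.Ioc (0 : ℝ) 1, ∫⁻ x in Set.Ioc (0 : ℝ) 1, ENNReal.ofReal (f (x, y)) := by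
  rw [ofReal_integral_eq_lintegral_ofReal (integrableOn_unitSq hf) (ae_of_all _ h0), unitSq,
    Measure.volume_eq_prod, ← Measure.prod_restrict, lintegral_prod_symm]
  exact (ENNReal.continuous_ofReal.comp (by fun_prop)).measurable.aemeasurable

/-- Neumann spectral gap on the unit square: if all cosine coefficients with eigenvalue below `μ`
vanish, the Dirichlet energy dominates `μ` times the mass. -/
theorem unitSq_gap {u u₁ u₂ : ℝ × ℝ → ℂ} (hu : Continuous u)
    (h₁ : ∀ x y, HasDerivAt (fun x => u (x, y)) (u₁ (x, y)) x) (hc₁ : Continuous u₁)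
    (h₂ : ∀ x y, HasDerivAt (fun y => u (x, y)) (u₂ (x, y)) y) (hc₂ : Continuous u₂)
    {μ : ℝ} (hμ : 0 ≤ μ)
    (hz : ∀ k l : ℤ, (Real.pi * k) ^ 2 + (Real.pi * l) ^ 2 < μ → cosCoeff₂ u k l = 0) :
    μ * ∫ x in unitSq, ‖u x‖ ^ 2 ≤ ∫ x in unitSq, (‖u₁ x‖ ^ 2 + ‖u₂ x‖ ^ 2) := by
  rw [integral_add (integrableOn_unitSq (by fun_prop)) (integrableOn_unitSq (by fun_prop))]
  have p1 : 0 ≤ ∫ x in unitSq, ‖u₁ x‖ ^ 2 := integral_nonneg fun _ => by positivity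
  have p2 : 0 ≤ ∫ x in unitSq, ‖u₂ x‖ ^ 2 := integral_nonneg fun _ => by positivity
  have hm : AEMeasurable (Function.uncurry fun y x : ℝ => ENNReal.ofReal (‖u₂ (x, y)‖ ^ 2))
      ((volume.restrict (Set.Ioc 0 1)).prod (volume.restrict (Set.Ioc 0 1))) :=
    (ENNReal.continuous_ofReal.comp (f := fun p : ℝ × ℝ => ‖u₂ (p.2, p.1)‖ ^ 2)
      (by fun_prop)).measurable.aemeasurable
  rw [← ENNReal.ofReal_le_ofReal_iff (by positivity), ENNReal.ofReal_mul hμ,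
    ENNReal.ofReal_add p1 p2, ofReal_integral_unitSq (by fun_prop) (fun _ => by positivity),
    ofReal_integral_unitSq (by fun_prop) (fun _ => by positivity),
    ofReal_integral_unitSq (f := fun x => ‖u₂ x‖ ^ 2) (by fun_prop) (fun _ => by positivity),
    lintegral_lintegral_sq_eq_tsum hu, lintegral_lintegral_sq_deriv_eq_tsum hu h₁ hc₁,
    lintegral_lintegral_swap hm,
    lintegral_lintegral_sq_deriv_eq_tsum (u := fun x => u (x.2, x.1))
      (u' := fun x => u₂ (x.2, x.1)) (by fun_prop) (fun x y => h₂ y x) (by fun_prop)]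
  simp only [cosCoeff₂_swap hu]
  rw [ENNReal.tsum_comm (f := fun k l : ℤ => ENNReal.ofReal ((Real.pi * k) ^ 2) *
    ENNReal.ofReal (‖cosCoeff₂ u l k‖ ^ 2)), ← ENNReal.tsum_add, ← ENNReal.tsum_mul_left]
  refine ENNReal.tsum_le_tsum fun k => ?_
  rw [← ENNReal.tsum_add, ← ENNReal.tsum_mul_left]
  refine ENNReal.tsum_le_tsum fun l => ?_
  rw [← add_mul, ← ENNReal.ofReal_add (by positivity) (by positivity)]
  by_cases h : (Real.pi * k) ^ 2 + (Real.pi * l) ^ 2 < μ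
  · simp [hz k l h]
  · gcongr
    exact not_lt.1 h

/-- The Neumann modes of the unit square with eigenvalue below `ν`. -/
noncomputable def modeSet (ν : ℝ) : Finset (ℕ × ℕ) :=
  (Finset.range (⌈ν⌉₊ + 1) ×ˢ Finset.range (⌈ν⌉₊ + 1)).filter
    fun k => (Real.pi * k.1) ^ 2 + (Real.pi * k.2) ^ 2 < ν

theorem le_pi_mul_sq (k : ℕ) : (k : ℝ) ≤ (Real.pi * k) ^ 2 := by
  have h1 : (1 : ℝ) ≤ Real.pi := by linarith [Real.pi_gt_three]
  rcases Nat.eq_zero_or_pos k with rfl | hk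
  · simp
  · have : (1 : ℝ) ≤ k := by exact_mod_cast hk
    nlinarith [mul_le_mul h1 this zero_le_one (by positivity : (0 : ℝ) ≤ Real.pi)]

theorem mem_modeSet {ν : ℝ} {k : ℕ × ℕ} :
    k ∈ modeSet ν ↔ (Real.pi * k.1) ^ 2 + (Real.pi * k.2) ^ 2 < ν := by
  refine ⟨fun h => (Finset.mem_filter.1 h).2, fun h => Finset.mem_filter.2 ⟨?_, h⟩⟩
  have h1 := le_pi_mul_sq k.1
  have h2 := le_pi_mul_sq k.2
  have h3 := Nat.le_ceil ν
  rw [Finset.mem_product, Finset.mem_range, Finset.mem_range]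
  constructor
  · have : (k.1 : ℝ) < (⌈ν⌉₊ + 1 : ℕ) := by
      push_cast
      nlinarith [sq_nonneg (Real.pi * k.2)]
    exact_mod_cast this
  · have : (k.2 : ℝ) < (⌈ν⌉₊ + 1 : ℕ) := by
      push_cast
      nlinarith [sq_nonneg (Real.pi * k.1)]
    exact_mod_cast this

theorem antitoneOn_sqrt_sq_sub (r : ℝ) (s : Set ℝ) (hs : s ⊆ Set.Ici 0) :
    AntitoneOn (fun x : ℝ => √(r ^ 2 - x ^ 2)) s := by
  intro x hx y hy hxy
  have := hs hx
  have h0 : (0 : ℝ) ≤ x := this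
  exact Real.sqrt_le_sqrt (by nlinarith)

theorem integral_sqrt_sq_sub {r a : ℝ} (hr : 0 < r) (ha : r ≤ a) :
    ∫ x in (0 : ℝ)..a, √(r ^ 2 - x ^ 2) = Real.pi * r ^ 2 / 4 := by
  have hc : Continuous fun x : ℝ => √(r ^ 2 - x ^ 2) := by fun_prop
  rw [← intervalIntegral.integral_add_adjacent_intervals (b := r) (hc.intervalIntegrable _ _)
    (hc.intervalIntegrable _ _)]
  have h1 : ∫ x in r..a, √(r ^ 2 - x ^ 2) = 0 := by
    rw [intervalIntegral.integral_congr (g := fun _ => (0 : ℝ))]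
    · simp
    · intro x hx
      rw [Set.uIcc_of_le ha] at hx
      exact Real.sqrt_eq_zero_of_nonpos (by nlinarith [hx.1])
  have h2 : ∫ x in (0 : ℝ)..1, √(1 - x ^ 2) = Real.pi / 4 := by
    have h := integral_sqrt_one_sub_sq
    have hc' : Continuous fun x : ℝ => √(1 - x ^ 2) := by fun_prop
    rw [← intervalIntegral.integral_add_adjacent_intervals (b := 0) (hc'.intervalIntegrable _ _)
      (hc'.intervalIntegrable _ _)] at h
    have h3 := intervalIntegral.integral_comp_neg (a := 0) (b := 1) (fun x : ℝ => √(1 - x ^ 2))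
    simp only [neg_sq, neg_zero] at h3
    linarith
  have h4 := intervalIntegral.integral_comp_mul_left (a := 0) (b := 1)
    (fun x : ℝ => √(r ^ 2 - x ^ 2)) hr.ne'
  have h5 : ∀ x : ℝ, √(r ^ 2 - (r * x) ^ 2) = r * √(1 - x ^ 2) := by
    intro x
    rw [show r ^ 2 - (r * x) ^ 2 = r ^ 2 * (1 - x ^ 2) by ring, Real.sqrt_mul (sq_nonneg r),
      Real.sqrt_sq hr.le]
  simp only [h5, intervalIntegral.integral_const_mul, h2, mul_zero, mul_one, smul_eq_mul] at h4
  rw [h1, add_zero]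
  field_simp at h4
  linarith

theorem lt_sqrt_of_mode {r : ℝ} {k l : ℕ} :
    (Real.pi * k) ^ 2 + (Real.pi * l) ^ 2 < (Real.pi * r) ^ 2 ↔
      (l : ℝ) < √(r ^ 2 - (k : ℝ) ^ 2) := by
  rw [Real.lt_sqrt (by positivity)]
  have := Real.pi_pos
  constructor
  · intro h
    have : Real.pi ^ 2 * ((k : ℝ) ^ 2 + (l : ℝ) ^ 2) < Real.pi ^ 2 * r ^ 2 := by nlinarith
    have := lt_of_mul_lt_mul_left this (by positivity)
    linarith
  · intro h
    have : Real.pi ^ 2 * ((k : ℝ) ^ 2 + (l : ℝ) ^ 2) < Real.pi ^ 2 * r ^ 2 :=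
      mul_lt_mul_of_pos_left (by linarith) (by positivity)
    nlinarith

theorem card_modeSet_le' {r : ℝ} (hr : 0 < r) :
    ((modeSet ((Real.pi * r) ^ 2)).card : ℝ) ≤ Real.pi * r ^ 2 / 4 + 2 * r + 1 := by
  obtain ⟨n, hn, h4'⟩ : ∃ n : ℕ, r ≤ n ∧ (n : ℝ) ≤ r + 1 :=
    ⟨⌈r⌉₊, Nat.le_ceil r, (Nat.ceil_lt_add_one hr.le).le⟩
  set f : ℝ → ℝ := fun x => √(r ^ 2 - x ^ 2) with hf
  have hsub : modeSet ((Real.pi * r) ^ 2) ⊆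
      ((Finset.range n).sigma (fun k => Finset.range ⌈f k⌉₊)).map
        (Equiv.sigmaEquivProd ℕ ℕ).toEmbedding := by
    rintro ⟨k, l⟩ h
    rw [mem_modeSet] at h
    simp only [Finset.mem_map_equiv, Finset.mem_sigma, Finset.mem_range]
    have h' := lt_sqrt_of_mode.1 h
    refine ⟨?_, Nat.lt_ceil.2 h'⟩
    refine (Nat.cast_lt (α := ℝ)).1 (lt_of_lt_of_le ?_ hn)
    change (k : ℝ) < r
    by_contra hk
    push Not at hk
    have : √(r ^ 2 - (k : ℝ) ^ 2) = 0 := Real.sqrt_eq_zero_of_nonpos (by nlinarith)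
    simp only [this] at h'
    exact absurd h' (by simp)
  have hcard := Finset.card_le_card hsub
  rw [Finset.card_map, Finset.card_sigma] at hcard
  simp only [Finset.card_range] at hcard
  have h1 : ((modeSet ((Real.pi * r) ^ 2)).card : ℝ) ≤ ∑ k ∈ Finset.range n, (f k + 1) := by
    refine (Nat.cast_le.2 hcard).trans ?_
    push_cast
    refine Finset.sum_le_sum fun k _ => (Nat.ceil_lt_add_one (Real.sqrt_nonneg _)).le
  have h2 := AntitoneOn.sum_le_integral (x₀ := 0) (a := n) (f := f)
    (antitoneOn_sqrt_sq_sub r _ fun x hx => hx.1)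
  simp only [zero_add] at h2
  rw [integral_sqrt_sq_sub hr hn] at h2
  have h3 : ∑ k ∈ Finset.range n, f k ≤ r + Real.pi * r ^ 2 / 4 := by
    have : ∑ k ∈ Finset.range n, f k ≤ ∑ k ∈ Finset.range (n + 1), f k :=
      Finset.sum_le_sum_of_subset_of_nonneg (by simp) fun _ _ _ => Real.sqrt_nonneg _
    rw [Finset.sum_range_succ'] at this
    have h0 : f ((0 : ℕ) : ℝ) = r := by simp [hf, Real.sqrt_sq hr.le]
    rw [h0] at this
    linarith
  rw [Finset.sum_add_distrib] at h1
  simp only [Finset.sum_const, Finset.card_range, nsmul_eq_mul, mul_one] at h1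
  linarith

theorem le_card_posModes {r : ℝ} (hr : 0 < r) :
    Real.pi * r ^ 2 / 4 - 2 * r - 1 ≤
      (((modeSet ((Real.pi * r) ^ 2)).filter fun k => 0 < k.1 ∧ 0 < k.2).card : ℝ) := by
  obtain ⟨n, hn, h4'⟩ : ∃ n : ℕ, r ≤ n ∧ (n : ℝ) ≤ r + 1 :=
    ⟨⌈r⌉₊, Nat.le_ceil r, (Nat.ceil_lt_add_one hr.le).le⟩
  set f : ℝ → ℝ := fun x => √(r ^ 2 - x ^ 2) with hf
  have hsub : ((Finset.range n).sigma (fun k => Finset.range (⌈f (1 + k)⌉₊ - 1))).map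
        ⟨fun p => (p.1 + 1, p.2 + 1), by
          rintro ⟨a, b⟩ ⟨c, d⟩ h
          simp only [Prod.mk.injEq, add_left_inj] at h
          obtain ⟨rfl, rfl⟩ := h
          rfl⟩ ⊆
      (modeSet ((Real.pi * r) ^ 2)).filter fun k => 0 < k.1 ∧ 0 < k.2 := by
    intro p hp
    simp only [Finset.mem_map, Finset.mem_sigma, Finset.mem_range] at hp
    obtain ⟨⟨a, b⟩, ⟨_, hb⟩, rfl⟩ := hp
    change b < ⌈f (1 + a)⌉₊ - 1 at hb
    rw [Finset.mem_filter, mem_modeSet]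
    refine ⟨lt_sqrt_of_mode.2 ?_, Nat.succ_pos _, Nat.succ_pos _⟩
    have h1 : b + 1 < ⌈f (1 + a)⌉₊ := by omega
    have h2 := Nat.lt_ceil.1 h1
    change ((b + 1 : ℕ) : ℝ) < √(r ^ 2 - ((a + 1 : ℕ) : ℝ) ^ 2)
    simpa [hf, add_comm] using h2
  have hcard := Finset.card_le_card hsub
  rw [Finset.card_map, Finset.card_sigma] at hcard
  simp only [Finset.card_range] at hcard
  have h1 : ∑ k ∈ Finset.range n, (f (1 + k) - 1) ≤
      (((modeSet ((Real.pi * r) ^ 2)).filter fun k => 0 < k.1 ∧ 0 < k.2).card : ℝ) := by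
    refine le_trans ?_ (Nat.cast_le.2 hcard)
    push_cast
    refine Finset.sum_le_sum fun k _ => ?_
    have a1 := Nat.le_ceil (f (1 + k))
    have a2 : (⌈f (1 + k)⌉₊ : ℝ) ≤ ((⌈f (1 + k)⌉₊ - 1 : ℕ) : ℝ) + 1 := by
      have : ⌈f (1 + k)⌉₊ ≤ (⌈f (1 + k)⌉₊ - 1) + 1 := by omega
      exact_mod_cast this
    linarith
  have h2 := AntitoneOn.integral_le_sum (x₀ := 1) (a := n) (f := f)
    (antitoneOn_sqrt_sq_sub r _ fun x hx => (by linarith [hx.1] : (0 : ℝ) ≤ x))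
  have hc : Continuous f := by fun_prop
  have h3 := intervalIntegral.integral_add_adjacent_intervals (a := 0) (b := 1) (c := 1 + (n : ℝ))
    (μ := volume) (hc.intervalIntegrable _ _) (hc.intervalIntegrable _ _)
  rw [integral_sqrt_sq_sub (a := 1 + (n : ℝ)) hr (by linarith)] at h3
  have h4 : ∫ x in (0 : ℝ)..1, f x ≤ r := by
    have := intervalIntegral.integral_mono_on (zero_le_one' ℝ) (hc.intervalIntegrable _ _)
      (intervalIntegrable_const (c := r) (μ := volume)) (fun x _ => ?_)
    · simpa using this
    · refine Real.sqrt_le_iff.2 ⟨hr.le, by nlinarith [sq_nonneg x]⟩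
  rw [Finset.sum_sub_distrib] at h1
  simp only [Finset.sum_const, Finset.card_range, nsmul_eq_mul, mul_one] at h1
  linarith

theorem card_modeSet_eq_zero {ν : ℝ} (hν : ν ≤ 0) : (modeSet ν).card = 0 := by
  rw [Finset.card_eq_zero, Finset.eq_empty_iff_forall_notMem]
  intro k hk
  rw [mem_modeSet] at hk
  nlinarith [sq_nonneg (Real.pi * k.1), sq_nonneg (Real.pi * k.2)]

theorem card_modeSet_le {δ : ℝ} (hδ : 0 < δ) :
    ∃ C : ℝ, 0 ≤ C ∧ ∀ ν : ℝ,
      ((modeSet ν).card : ℝ) ≤ (1 + δ) * max ν 0 / (4 * Real.pi) + C := by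
  have hπ := Real.pi_pos
  refine ⟨4 / (Real.pi * δ) + 1, by positivity, fun ν => ?_⟩
  rcases le_or_gt ν 0 with h | h
  · rw [card_modeSet_eq_zero h, Nat.cast_zero]
    positivity
  · have h1 := card_modeSet_le' (r := √ν / Real.pi) (by positivity)
    have e1 : (Real.pi * (√ν / Real.pi)) ^ 2 = ν := by
      rw [mul_div_cancel₀ _ hπ.ne', Real.sq_sqrt h.le]
    rw [e1] at h1
    rw [max_eq_left h.le]
    have e2 : Real.pi * (√ν / Real.pi) ^ 2 / 4 = ν / (4 * Real.pi) := by
      rw [div_pow, Real.sq_sqrt h.le]; field_simp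
    rw [e2] at h1
    have h3 : 2 * (√ν / Real.pi) ≤ δ * ν / (4 * Real.pi) + 4 / (Real.pi * δ) := by
      have : 2 * √ν ≤ δ * ν / 4 + 4 / δ := by
        have hs := Real.sq_sqrt h.le
        rw [div_add_div _ _ (by norm_num) hδ.ne', le_div_iff₀ (by positivity)]
        have e : δ * ν * δ = (δ * √ν) ^ 2 := by rw [mul_pow, hs]; ring
        nlinarith [sq_nonneg (δ * √ν - 4)]
      calc 2 * (√ν / Real.pi) = (2 * √ν) / Real.pi := by ring
        _ ≤ (δ * ν / 4 + 4 / δ) / Real.pi := by gcongr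
        _ = _ := by field_simp
    calc _ ≤ _ := h1
      _ ≤ ν / (4 * Real.pi) + (δ * ν / (4 * Real.pi) + 4 / (Real.pi * δ)) + 1 := by linarith
      _ = _ := by ring

theorem exists_card_posModes {δ : ℝ} (hδ : 0 < δ) :
    ∃ ν : ℝ, 0 < ν ∧ (1 - δ) * ν / (4 * Real.pi) ≤
      (((modeSet ν).filter fun k => 0 < k.1 ∧ 0 < k.2).card : ℝ) := by
  have hπ := Real.pi_pos
  have hπ3 := Real.pi_gt_three
  set r : ℝ := max 1 (4 / δ) with hr
  have h1 : 1 ≤ r := le_max_left _ _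
  have h2 : 4 ≤ δ * r := by
    have : 4 / δ ≤ r := le_max_right _ _
    rw [div_le_iff₀ hδ] at this
    linarith
  refine ⟨(Real.pi * r) ^ 2, by positivity, le_trans ?_ (le_card_posModes (by positivity))⟩
  have e : (1 - δ) * (Real.pi * r) ^ 2 / (4 * Real.pi) = (1 - δ) * (Real.pi * r ^ 2 / 4) := by
    field_simp
  rw [e]
  have : 4 * r ≤ δ * r * r := by nlinarith
  nlinarith [mul_le_mul_of_nonneg_left this hπ.le]

/-- The squared length of the gradient. -/
noncomputable def gradSq (u : ℝ × ℝ → ℂ) (x : ℝ × ℝ) : ℝ :=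
  ‖fderiv ℝ u x (1, 0)‖ ^ 2 + ‖fderiv ℝ u x (0, 1)‖ ^ 2

theorem gradSq_nonneg (u : ℝ × ℝ → ℂ) (x : ℝ × ℝ) : 0 ≤ gradSq u x := by
  unfold gradSq; positivity

theorem continuous_gradSq {u : ℝ × ℝ → ℂ} (hu : ContDiff ℝ 1 u) : Continuous (gradSq u) := by
  have := hu.continuous_fderiv one_ne_zero
  unfold gradSq
  fun_prop

/-- The half-open square of side `h` with lower left corner `p`. -/
def square (p : ℝ × ℝ) (h : ℝ) : Set (ℝ × ℝ) :=
  Set.Ioc p.1 (p.1 + h) ×ˢ Set.Ioc p.2 (p.2 + h)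

theorem measurableSet_square (p : ℝ × ℝ) (h : ℝ) : MeasurableSet (square p h) :=
  measurableSet_Ioc.prod measurableSet_Ioc

theorem volume_real_square (p : ℝ × ℝ) {h : ℝ} (hh : 0 ≤ h) :
    (volume (square p h)).toReal = h ^ 2 := by
  rw [square, Measure.volume_eq_prod, Measure.prod_prod, Real.volume_Ioc, Real.volume_Ioc,
    add_sub_cancel_left, add_sub_cancel_left, ENNReal.toReal_mul, ENNReal.toReal_ofReal hh, sq]

theorem volume_square_lt_top (p : ℝ × ℝ) (h : ℝ) : volume (square p h) < ⊤ := by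
  rw [square, Measure.volume_eq_prod, Measure.prod_prod]
  exact ENNReal.mul_lt_top measure_Ioc_lt_top measure_Ioc_lt_top

theorem square_subset_Icc (p : ℝ × ℝ) (h : ℝ) :
    square p h ⊆ Set.Icc p (p.1 + h, p.2 + h) := by
  rintro ⟨x, y⟩ ⟨h1, h2⟩
  exact ⟨⟨h1.1.le, h2.1.le⟩, ⟨h1.2, h2.2⟩⟩

theorem Continuous.integrableOn_square {f : ℝ × ℝ → ℝ} (hf : Continuous f) (p : ℝ × ℝ) (h : ℝ) :
    IntegrableOn f (square p h) :=
  (hf.integrableOn_Icc (a := p) (b := (p.1 + h, p.2 + h))).mono_set (square_subset_Icc p h)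

theorem integral_comp_add_smul (f : ℝ × ℝ → ℝ) (p : ℝ × ℝ) (h : ℝ) :
    ∫ z, f (p + h • z) = (h ^ 2)⁻¹ * ∫ x, f x := by
  rw [Measure.integral_comp_smul volume (fun x => f (p + x)) h, integral_add_left_eq_self f p]
  simp

theorem setIntegral_square (f : ℝ × ℝ → ℝ) (p : ℝ × ℝ) {h : ℝ} (hh : 0 < h) :
    ∫ x in square p h, f x = h ^ 2 * ∫ z in unitSq, f (p + h • z) := by
  have hm : MeasurableSet unitSq := measurableSet_Ioc.prod measurableSet_Ioc
  rw [← integral_indicator (measurableSet_square p h), ← integral_indicator hm]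
  have h1 : ∀ z, unitSq.indicator (fun z => f (p + h • z)) z =
      (square p h).indicator f (p + h • z) := by
    intro z
    have : z ∈ unitSq ↔ p + h • z ∈ square p h := by
      simp only [unitSq, square, Set.mem_prod, Set.mem_Ioc, Prod.fst_add, Prod.smul_fst,
        Prod.snd_add, Prod.smul_snd, smul_eq_mul, lt_add_iff_pos_right, add_le_add_iff_left,
        mul_pos_iff_of_pos_left hh, mul_le_iff_le_one_right hh]
    by_cases hz : z ∈ unitSq
    · rw [Set.indicator_of_mem hz, Set.indicator_of_mem (this.1 hz)]
    · rw [Set.indicator_of_notMem hz, Set.indicator_of_notMem (mt this.2 hz)]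
  simp only [h1]
  rw [integral_comp_add_smul, mul_inv_cancel_left₀ (by positivity)]

theorem contDiff_comp_add_smul {u : ℝ × ℝ → ℂ} {n : WithTop ℕ∞} (hu : ContDiff ℝ n u)
    (p : ℝ × ℝ) (h : ℝ) : ContDiff ℝ n fun z => u (p + h • z) :=
  hu.comp (contDiff_const.add (contDiff_id.const_smul h))

theorem gradSq_comp_add_smul {u : ℝ × ℝ → ℂ} (hu : ContDiff ℝ 1 u) (p : ℝ × ℝ) (h : ℝ)
    (z : ℝ × ℝ) : gradSq (fun z => u (p + h • z)) z = h ^ 2 * gradSq u (p + h • z) := by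
  have h1 : HasFDerivAt (fun z : ℝ × ℝ => p + h • z)
      (h • ContinuousLinearMap.id ℝ (ℝ × ℝ)) z :=
    ((hasFDerivAt_id z).const_smul h).const_add p
  have h2 := ((hu.differentiable one_ne_zero) (p + h • z)).hasFDerivAt.comp z h1
  have h3 : fderiv ℝ (fun z => u (p + h • z)) z = _ := h2.fderiv
  unfold gradSq
  rw [h3]
  simp only [ContinuousLinearMap.comp_smulₛₗ, ContinuousLinearMap.comp_id, RingHom.id_apply,
    smul_apply, norm_smul, mul_pow, Real.norm_eq_abs, sq_abs]
  ring

theorem cosCoeff_neg (f : ℝ → ℂ) (k : ℤ) : cosCoeff f (-k) = cosCoeff f k := by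
  unfold cosCoeff
  simp

theorem cosCoeff_natAbs (f : ℝ → ℂ) (k : ℤ) : cosCoeff f (k.natAbs : ℤ) = cosCoeff f k := by
  rcases Int.natAbs_eq k with h | h
  · rw [← h]
  · conv_rhs => rw [h]
    rw [cosCoeff_neg]

theorem cosCoeff₂_natAbs (u : ℝ × ℝ → ℂ) (k l : ℤ) :
    cosCoeff₂ u (k.natAbs : ℤ) (l.natAbs : ℤ) = cosCoeff₂ u k l := by
  unfold cosCoeff₂
  rw [cosCoeff_natAbs]
  congr 1
  funext y
  rw [cosCoeff_natAbs]

theorem unitSq_gap_gradSq {v : ℝ × ℝ → ℂ} (hv : ContDiff ℝ 1 v) {μ : ℝ} (hμ : 0 ≤ μ)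
    (hz : ∀ k ∈ modeSet μ, cosCoeff₂ v (k.1 : ℤ) (k.2 : ℤ) = 0) :
    μ * ∫ x in unitSq, ‖v x‖ ^ 2 ≤ ∫ x in unitSq, gradSq v x := by
  have hd := hv.differentiable one_ne_zero
  have hc := hv.continuous_fderiv one_ne_zero
  refine unitSq_gap (u₁ := fun x => fderiv ℝ v x (1, 0)) (u₂ := fun x => fderiv ℝ v x (0, 1))
    hv.continuous (fun x y => ?_) (by fun_prop) (fun x y => ?_) (by fun_prop) hμ fun k l hkl => ?_
  · exact (hd (x, y)).hasFDerivAt.comp_hasDerivAt x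
      ((hasDerivAt_id x).prodMk (hasDerivAt_const x y))
  · exact (hd (x, y)).hasFDerivAt.comp_hasDerivAt y
      ((hasDerivAt_const y x).prodMk (hasDerivAt_id y))
  · rw [← cosCoeff₂_natAbs]
    refine hz (k.natAbs, l.natAbs) (mem_modeSet.2 ?_)
    simpa [Nat.cast_natAbs, mul_pow] using hkl

theorem square_gap {u : ℝ × ℝ → ℂ} (hu : ContDiff ℝ 1 u) (p : ℝ × ℝ) {h μ : ℝ} (hh : 0 < h)
    (hμ : 0 ≤ μ)
    (hz : ∀ k ∈ modeSet (μ * h ^ 2),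
      cosCoeff₂ (fun z => u (p + h • z)) (k.1 : ℤ) (k.2 : ℤ) = 0) :
    μ * ∫ x in square p h, ‖u x‖ ^ 2 ≤ ∫ x in square p h, gradSq u x := by
  have h1 := unitSq_gap_gradSq (contDiff_comp_add_smul hu p h) (by positivity) hz
  simp only [gradSq_comp_add_smul hu, integral_const_mul] at h1
  rw [setIntegral_square _ _ hh, setIntegral_square _ _ hh]
  linarith

/-- The space of test functions. -/
def testSub : Submodule ℂ (ℝ × ℝ → ℂ) where
  carrier := {u | IsTestFun u}
  add_mem' := fun ⟨a1, a2, a3⟩ ⟨b1, b2, b3⟩ =>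
    ⟨a1.add b1, a2.add b2, by
      filter_upwards [a3, b3] with x h1 h2
      simp [h1, h2]⟩
  zero_mem' := ⟨contDiff_const, HasCompactSupport.zero, by simp⟩
  smul_mem' := fun c u ⟨a1, a2, a3⟩ =>
    ⟨contDiff_const.smul a1, a2.smul_left (f := fun _ => c), by
      filter_upwards [a3] with x h1
      simp [h1]⟩

theorem IsTestFun.contDiff_one {u : ℝ × ℝ → ℂ} (hu : IsTestFun u) : ContDiff ℝ 1 u :=
  hu.1.of_le (by exact_mod_cast le_top)

/-- The property `P` holds for all test functions annihilated by `K` suitable functionals. -/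
def CodimLE (P : (ℝ × ℝ → ℂ) → Prop) (K : ℕ) : Prop :=
  ∃ S : Finset (testSub →ₗ[ℂ] ℂ), S.card ≤ K ∧
    ∀ u : testSub, (∀ φ ∈ S, φ u = 0) → P (u : ℝ × ℝ → ℂ)

theorem CodimLE.mono {P Q : (ℝ × ℝ → ℂ) → Prop} {K L : ℕ} (h : CodimLE P K)
    (hPQ : ∀ u, IsTestFun u → P u → Q u) (hKL : K ≤ L) : CodimLE Q L := by
  obtain ⟨S, h1, h2⟩ := h
  exact ⟨S, h1.trans hKL, fun u hu => hPQ u u.2 (h2 u hu)⟩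

theorem CodimLE.of_forall {P : (ℝ × ℝ → ℂ) → Prop} (h : ∀ u, IsTestFun u → P u) (K : ℕ) :
    CodimLE P K :=
  ⟨∅, by simp, fun u _ => h u u.2⟩

theorem CodimLE.forall {P : (ℝ × ℝ → ℂ) → Prop} (h : CodimLE P 0) {u : ℝ × ℝ → ℂ}
    (hu : IsTestFun u) : P u := by
  obtain ⟨S, h1, h2⟩ := h
  refine h2 ⟨u, hu⟩ fun φ hφ => ?_
  rw [Nat.le_zero, Finset.card_eq_zero] at h1
  simp [h1] at hφ

theorem CodimLE.finset {ι : Type*} {P : ι → (ℝ × ℝ → ℂ) → Prop} {K : ι → ℕ} (s : Finset ι)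
    (h : ∀ i ∈ s, CodimLE (P i) (K i)) : CodimLE (fun u => ∀ i ∈ s, P i u) (∑ i ∈ s, K i) := by
  classical
  choose! S h1 h2 using h
  refine ⟨s.biUnion S, Finset.card_biUnion_le.trans (Finset.sum_le_sum h1), fun u hu i hi => ?_⟩
  exact h2 i hi u fun φ hφ => hu φ (Finset.mem_biUnion.2 ⟨i, hi, hφ⟩)

theorem CodimLE.and {P Q : (ℝ × ℝ → ℂ) → Prop} {K L : ℕ} (hP : CodimLE P K) (hQ : CodimLE Q L) :
    CodimLE (fun u => P u ∧ Q u) (K + L) := by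
  classical
  obtain ⟨S, h1, h2⟩ := hP
  obtain ⟨T, h3, h4⟩ := hQ
  refine ⟨S ∪ T, (Finset.card_union_le _ _).trans (add_le_add h1 h3), fun u hu => ⟨?_, ?_⟩⟩
  · exact h2 u fun φ hφ => hu φ (Finset.mem_union_left _ hφ)
  · exact h4 u fun φ hφ => hu φ (Finset.mem_union_right _ hφ)

theorem CodimLE.countable {ι : Type*} {P : ι → (ℝ × ℝ → ℂ) → Prop} {κ : ι → ℝ}
    (hκ : Summable κ) (hκ0 : ∀ i, 0 ≤ κ i)
    (h : ∀ i, ∃ K : ℕ, (K : ℝ) ≤ κ i ∧ CodimLE (P i) K) :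
    ∃ K : ℕ, (K : ℝ) ≤ ∑' i, κ i ∧ CodimLE (fun u => ∀ i, P i u) K := by
  choose K hK hP using h
  have hfin : {i | 1 ≤ κ i}.Finite := by
    have := hκ.tendsto_cofinite_zero.eventually (gt_mem_nhds one_pos)
    rw [Filter.eventually_cofinite] at this
    simpa only [not_lt] using this
  refine ⟨∑ i ∈ hfin.toFinset, K i, ?_, (CodimLE.finset _ fun i _ => hP i).mono ?_ le_rfl⟩
  · push_cast
    exact (Finset.sum_le_sum fun i _ => hK i).trans (hκ.sum_le_tsum _ fun i _ => hκ0 i)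
  · intro u hu h i
    by_cases hi : 1 ≤ κ i
    · exact h i (by simpa using hi)
    · have : K i = 0 := by
        have : (K i : ℝ) < 1 := lt_of_le_of_lt (hK i) (not_le.1 hi)
        exact Nat.lt_one_iff.1 (by exact_mod_cast this)
      exact (this ▸ hP i).forall hu

/-- The Fourier mode functional on a square. -/
noncomputable def modeFun (p : ℝ × ℝ) (h : ℝ) (k : ℕ × ℕ) : testSub →ₗ[ℂ] ℂ where
  toFun u := cosCoeff₂ (fun z => (u : ℝ × ℝ → ℂ) (p + h • z)) (k.1 : ℤ) (k.2 : ℤ)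
  map_add' u v := by
    have hu : Continuous (u : ℝ × ℝ → ℂ) := u.2.1.continuous
    have hv : Continuous (v : ℝ × ℝ → ℂ) := v.2.1.continuous
    exact cosCoeff₂_add (by fun_prop) (by fun_prop) _ _
  map_smul' c u := cosCoeff₂_const_mul c _ _ _

theorem codimLE_square_gap (p : ℝ × ℝ) {h μ : ℝ} (hh : 0 < h) (hμ : 0 ≤ μ) :
    CodimLE (fun u => μ * ∫ x in square p h, ‖u x‖ ^ 2 ≤ ∫ x in square p h, gradSq u x)
      (modeSet (μ * h ^ 2)).card := by
  classical
  refine ⟨(modeSet (μ * h ^ 2)).image (modeFun p h), Finset.card_image_le, fun u hu => ?_⟩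
  refine square_gap (IsTestFun.contDiff_one u.2) p hh hμ fun k hk => ?_
  exact hu _ (Finset.mem_image_of_mem _ hk)

theorem negEigCount_le {Φ : ℝ} {W : ℝ × ℝ → ℝ} {K : ℕ}
    (h : CodimLE (fun u => ∫ x, W x * ‖u x‖ ^ 2 ≤ magEnergy Φ u) K) :
    negEigCount Φ W ≤ K := by
  obtain ⟨S, h1, h2⟩ := h
  refine iSup₂_le fun M ⟨hfd, hM, hneg⟩ => ?_
  by_contra hlt
  have hle : M ≤ testSub := fun u hu => hM u hu
  have hlt' : K < Module.finrank ℂ M := by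
    by_contra hge
    exact hlt (by exact_mod_cast not_lt.1 hge)
  let f : M →ₗ[ℂ] (S → ℂ) := LinearMap.pi fun φ => (φ : testSub →ₗ[ℂ] ℂ) ∘ₗ Submodule.inclusion hle
  have hker : f.ker ≠ ⊥ := by
    refine LinearMap.ker_ne_bot_of_finrank_lt ?_
    simp only [Module.finrank_fintype_fun_eq_card, Fintype.card_coe]
    omega
  obtain ⟨u, hu, hu0⟩ := (Submodule.ne_bot_iff _).1 hker
  have h3 := h2 (Submodule.inclusion hle u) fun φ hφ => congrFun (LinearMap.mem_ker.1 hu) ⟨φ, hφ⟩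
  exact absurd (hneg u u.2 (by simpa using hu0)) (not_lt.2 h3)

theorem exists_dist_int_pos {Φ : ℝ} (hΦ : ∀ k : ℤ, Φ ≠ k) :
    ∃ δ : ℝ, 0 < δ ∧ ∀ k : ℤ, δ ≤ |Φ - k| :=
  ⟨|Φ - round Φ|, abs_pos.2 (sub_ne_zero.2 (hΦ _)), fun k => round_le Φ k⟩

theorem fourierCoeffOn_deriv_of_periodic {g g' : ℝ → ℂ} {a b : ℝ} (hab : a < b)
    (hg : ∀ x, HasDerivAt g (g' x) x) (hg' : Continuous g') (hper : g b = g a) (k : ℤ) :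
    (b - a : ℂ) * fourierCoeffOn hab g' k =
      2 * Real.pi * Complex.I * k * fourierCoeffOn hab g k := by
  rcases eq_or_ne k 0 with rfl | hk
  · rw [fourierCoeffOn_eq_integral]
    have : ∫ x in a..b, g' x = 0 := by
      rw [intervalIntegral.integral_eq_sub_of_hasDerivAt (fun x _ => hg x)
        (hg'.intervalIntegrable _ _), hper, sub_self]
    simp [this]
  · rw [fourierCoeffOn_of_hasDerivAt hab hk (fun x _ => hg x) (hg'.intervalIntegrable _ _), hper]
    have hk' : (k : ℂ) ≠ 0 := by exact_mod_cast hk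
    have hπ : (Real.pi : ℂ) ≠ 0 := by exact_mod_cast Real.pi_ne_zero
    field_simp
    simp

theorem fourierCoeffOn_add' {f g : ℝ → ℂ} {a b : ℝ} (hab : a < b) (hf : Continuous f)
    (hg : Continuous g) (k : ℤ) :
    fourierCoeffOn hab (fun x => f x + g x) k =
      fourierCoeffOn hab f k + fourierCoeffOn hab g k := by
  simp only [fourierCoeffOn_eq_integral, ← smul_add]
  have hc : Continuous fun x : ℝ => fourier (-k) (x : AddCircle (b - a)) :=
    (map_continuous _).comp (AddCircle.continuous_mk' _)
  rw [← intervalIntegral.integral_add (Continuous.intervalIntegrable (by fun_prop) _ _)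
    (Continuous.intervalIntegrable (by fun_prop) _ _)]
  simp only [smul_eq_mul, mul_add]

theorem circle_hardy {Φ δ : ℝ} (hδ0 : 0 ≤ δ) (hδ : ∀ k : ℤ, δ ≤ |Φ - k|) {g g' : ℝ → ℂ}
    (hg : ∀ x, HasDerivAt g (g' x) x) (hg' : Continuous g') (hper : g Real.pi = g (-Real.pi)) :
    δ ^ 2 * ∫ x in -Real.pi..Real.pi, ‖g x‖ ^ 2 ≤
      ∫ x in -Real.pi..Real.pi, ‖-Complex.I * g' x - Φ * g x‖ ^ 2 := by
  have hπ := Real.pi_pos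
  have hab : -Real.pi < Real.pi := by linarith
  have hgc : Continuous g := continuous_iff_continuousAt.2 fun x => (hg x).continuousAt
  have hL : ∀ {f : ℝ → ℂ}, Continuous f →
      MemLp f 2 (volume.restrict (Set.Ioc (-Real.pi) Real.pi)) := fun {f} hf =>
    (memLp_two_iff_integrable_sq_norm hf.aestronglyMeasurable).2
      ((hf.norm.pow 2).integrableOn_Icc.mono_set Set.Ioc_subset_Icc_self)
  have h1 := hasSum_sq_fourierCoeffOn hab (hL hgc)
  have hFc : Continuous fun x => -Complex.I * g' x - Φ * g x := by fun_prop
  have h2 := hasSum_sq_fourierCoeffOn hab (hL hFc)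
  have h3 : ∀ k : ℤ, fourierCoeffOn hab (fun x => -Complex.I * g' x - Φ * g x) k =
      ((k - Φ : ℝ) : ℂ) * fourierCoeffOn hab g k := by
    intro k
    have e1 := fourierCoeffOn_add' hab (f := fun x => -Complex.I * g' x)
      (g := fun x => (-Φ : ℂ) * g x) (by fun_prop) (by fun_prop) k
    have e2 := fourierCoeffOn_deriv_of_periodic hab hg hg' hper k
    rw [fourierCoeffOn.const_mul, fourierCoeffOn.const_mul] at e1
    have e3 : (fun x => -Complex.I * g' x - Φ * g x) =
      fun x => -Complex.I * g' x + (-Φ : ℂ) * g x := by funext x; ring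
    rw [e3, e1]
    have e4 : fourierCoeffOn hab g' k = Complex.I * k * fourierCoeffOn hab g k := by
      have hπ' : (2 * Real.pi : ℂ) ≠ 0 := by
        simp
      refine mul_left_cancel₀ hπ' ?_
      have : ((Real.pi : ℝ) - ((-Real.pi : ℝ) : ℂ) : ℂ) = 2 * Real.pi := by push_cast; ring
      rw [this] at e2
      rw [e2]
      ring
    rw [e4]
    push_cast
    linear_combination (-(k : ℂ) * fourierCoeffOn hab g k) * Complex.I_sq
  simp only [h3, norm_mul, mul_pow, Complex.norm_real, Real.norm_eq_abs, sq_abs] at h2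
  have h4 := hasSum_le (fun k => ?_) (h1.mul_left (δ ^ 2)) h2
  · simp only [smul_eq_mul] at h4
    rw [mul_left_comm] at h4
    exact le_of_mul_le_mul_left h4 (by rw [inv_pos]; linarith)
  · refine mul_le_mul_of_nonneg_right ?_ (sq_nonneg _)
    rw [← sq_abs ((k : ℝ) - Φ), abs_sub_comm]
    exact pow_le_pow_left₀ hδ0 (hδ k) 2

theorem sqnorm_nonneg (x : ℝ × ℝ) : 0 ≤ sqnorm x := by unfold sqnorm; positivity

theorem continuous_sqnorm : Continuous sqnorm := by unfold sqnorm; fun_prop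

theorem sqnorm_pos {x : ℝ × ℝ} (hx : x ≠ 0) : 0 < sqnorm x := by
  unfold sqnorm
  rcases eq_or_ne x.1 0 with h | h
  · have : x.2 ≠ 0 := fun h2 => hx (Prod.ext h h2)
    positivity
  · positivity

theorem IsTestFun.continuous_smul {u : ℝ × ℝ → ℂ} (hu : IsTestFun u) {g : ℝ × ℝ → ℝ}
    (hg : ∀ x ≠ 0, ContinuousAt g x) : Continuous fun x => ((g x : ℝ) : ℂ) * u x := by
  refine continuous_iff_continuousAt.2 fun x => ?_
  rcases eq_or_ne x 0 with rfl | hx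
  · have h : (fun x => ((g x : ℝ) : ℂ) * u x) =ᶠ[nhds 0] fun _ => 0 := by
      filter_upwards [hu.2.2] with x hx
      rw [hx, mul_zero]
    exact continuousAt_const.congr h.symm
  · exact (Complex.continuous_ofReal.continuousAt.comp (hg x hx)).mul hu.1.continuous.continuousAt

/-- The energy density `|D_Φ u|²`. -/
noncomputable def magDensity (Φ : ℝ) (u : ℝ × ℝ → ℂ) (x : ℝ × ℝ) : ℝ :=
  ‖-Complex.I * fderiv ℝ u x (1, 0) + ((Φ * (x.2 / sqnorm x) : ℝ) : ℂ) * u x‖ ^ 2 +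
    ‖-Complex.I * fderiv ℝ u x (0, 1) + ((Φ * (-x.1 / sqnorm x) : ℝ) : ℂ) * u x‖ ^ 2

theorem magDensity_nonneg (Φ : ℝ) (u : ℝ × ℝ → ℂ) (x : ℝ × ℝ) : 0 ≤ magDensity Φ u x := by
  unfold magDensity; positivity

theorem IsTestFun.continuous_magDensity {u : ℝ × ℝ → ℂ} (hu : IsTestFun u) (Φ : ℝ) :
    Continuous (magDensity Φ u) := by
  have h0 := hu.contDiff_one.continuous_fderiv one_ne_zero
  have h1 : Continuous fun x : ℝ × ℝ => ((Φ * (x.2 / sqnorm x) : ℝ) : ℂ) * u x :=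
    hu.continuous_smul fun x hx => continuousAt_const.mul
      (continuous_snd.continuousAt.div continuous_sqnorm.continuousAt (sqnorm_pos hx).ne')
  have h2 : Continuous fun x : ℝ × ℝ => ((Φ * (-x.1 / sqnorm x) : ℝ) : ℂ) * u x :=
    hu.continuous_smul fun x hx => continuousAt_const.mul
      (continuous_fst.neg.continuousAt.div continuous_sqnorm.continuousAt (sqnorm_pos hx).ne')
  unfold magDensity
  fun_prop

theorem IsTestFun.integrable_magDensity {u : ℝ × ℝ → ℂ} (hu : IsTestFun u) (Φ : ℝ) :
    Integrable (magDensity Φ u) := by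
  refine (hu.continuous_magDensity Φ).integrable_of_hasCompactSupport ?_
  refine HasCompactSupport.intro hu.2.1 fun x hx => ?_
  have h1 : u x = 0 := image_eq_zero_of_notMem_tsupport hx
  have h2 : fderiv ℝ u x = 0 := by
    by_contra h
    exact hx (support_fderiv_subset ℝ h)
  simp [magDensity, h1, h2]

theorem IsTestFun.integrable_gradSq {u : ℝ × ℝ → ℂ} (hu : IsTestFun u) :
    Integrable (gradSq u) := by
  refine (continuous_gradSq hu.contDiff_one).integrable_of_hasCompactSupport ?_
  refine HasCompactSupport.intro hu.2.1 fun x hx => ?_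
  have h2 : fderiv ℝ u x = 0 := by
    by_contra h
    exact hx (support_fderiv_subset ℝ h)
  simp [gradSq, h2]

theorem IsTestFun.continuous_sq_div {u : ℝ × ℝ → ℂ} (hu : IsTestFun u) :
    Continuous fun x => ‖u x‖ ^ 2 / sqnorm x := by
  have h := (hu.continuous_smul (g := fun x => (sqnorm x)⁻¹) fun x hx =>
    continuous_sqnorm.continuousAt.inv₀ (sqnorm_pos hx).ne').norm.mul hu.1.continuous.norm
  refine h.congr fun x => ?_
  rw [Pi.mul_apply, norm_mul, Complex.norm_real,
    Real.norm_of_nonneg (inv_nonneg.2 (sqnorm_nonneg x))]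
  ring

theorem IsTestFun.integrable_sq_div {u : ℝ × ℝ → ℂ} (hu : IsTestFun u) :
    Integrable fun x => ‖u x‖ ^ 2 / sqnorm x := by
  refine hu.continuous_sq_div.integrable_of_hasCompactSupport ?_
  refine HasCompactSupport.intro hu.2.1 fun x hx => ?_
  simp [image_eq_zero_of_notMem_tsupport hx]

theorem norm_sq_sub_le (a b : ℝ) (z w : ℂ) :
    ‖(a : ℂ) * z - (b : ℂ) * w‖ ^ 2 ≤ (a ^ 2 + b ^ 2) * (‖w‖ ^ 2 + ‖z‖ ^ 2) := by
  have h : ‖(a : ℂ) * z - (b : ℂ) * w‖ ≤ |a| * ‖z‖ + |b| * ‖w‖ := by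
    refine (norm_sub_le _ _).trans ?_
    rw [norm_mul, norm_mul, Complex.norm_real, Complex.norm_real, Real.norm_eq_abs,
      Real.norm_eq_abs]
  have h2 := pow_le_pow_left₀ (norm_nonneg _) h 2
  rw [← sq_abs a, ← sq_abs b]
  nlinarith [sq_nonneg (|a| * ‖w‖ - |b| * ‖z‖)]

theorem hardy {Φ δ : ℝ} (hδ0 : 0 ≤ δ) (hδ : ∀ k : ℤ, δ ≤ |Φ - k|) {u : ℝ × ℝ → ℂ}
    (hu : IsTestFun u) : δ ^ 2 * ∫ x, ‖u x‖ ^ 2 / sqnorm x ≤ magEnergy Φ u := by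
  have hle : ∫⁻ x, ENNReal.ofReal (δ ^ 2 * (‖u x‖ ^ 2 / sqnorm x)) ≤
      ∫⁻ x, ENNReal.ofReal (magDensity Φ u x) := by
    rw [← lintegral_comp_polarCoord_symm, ← lintegral_comp_polarCoord_symm]
    simp only [polarCoord_target, Measure.volume_eq_prod, polarCoord_symm_apply, smul_eq_mul]
    have hc1 := hu.continuous_sq_div
    have hc2 := hu.continuous_magDensity Φ
    rw [← Measure.prod_restrict, lintegral_prod, lintegral_prod]
    · refine setLIntegral_mono' measurableSet_Ioi fun r (hr : 0 < r) => ?_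
      simp only
      rw [lintegral_const_mul' _ _ ENNReal.ofReal_ne_top,
        lintegral_const_mul' _ _ ENNReal.ofReal_ne_top]
      refine mul_le_mul_right ?_ _
      rw [restrict_Ioo_eq_restrict_Ioc]
      have hc1' : Continuous fun θ : ℝ => δ ^ 2 * (‖u (r * Real.cos θ, r * Real.sin θ)‖ ^ 2 /
          sqnorm (r * Real.cos θ, r * Real.sin θ)) :=
        continuous_const.mul (hc1.comp (by fun_prop : Continuous fun θ : ℝ =>
          (r * Real.cos θ, r * Real.sin θ)))
      have hc2' : Continuous fun θ : ℝ => magDensity Φ u (r * Real.cos θ, r * Real.sin θ) := by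
        fun_prop
      rw [← ofReal_integral_eq_lintegral_ofReal
          (hc1'.integrableOn_Icc.mono_set Set.Ioc_subset_Icc_self)
          (ae_of_all _ fun θ => mul_nonneg (sq_nonneg _)
            (div_nonneg (sq_nonneg _) (sqnorm_nonneg _))),
        ← ofReal_integral_eq_lintegral_ofReal
          (hc2'.integrableOn_Icc.mono_set Set.Ioc_subset_Icc_self)
          (ae_of_all _ fun θ => magDensity_nonneg _ _ _)]
      refine ENNReal.ofReal_le_ofReal ?_
      have hπ : -Real.pi ≤ Real.pi := by linarith [Real.pi_pos]
      rw [← intervalIntegral.integral_of_le hπ, ← intervalIntegral.integral_of_le hπ,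
        intervalIntegral.integral_const_mul]
      have hs : ∀ θ : ℝ, sqnorm (r * Real.cos θ, r * Real.sin θ) = r ^ 2 := by
        intro θ
        simp only [sqnorm]
        nlinarith [Real.sin_sq_add_cos_sq θ]
      have hd := hu.contDiff_one.differentiable one_ne_zero
      have hdc := hu.contDiff_one.continuous_fderiv one_ne_zero
      set g : ℝ → ℂ := fun θ => u (r * Real.cos θ, r * Real.sin θ) with hg
      set g' : ℝ → ℂ := fun θ =>
        ((r * Real.cos θ : ℝ) : ℂ) * fderiv ℝ u (r * Real.cos θ, r * Real.sin θ) (0, 1) -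
        ((r * Real.sin θ : ℝ) : ℂ) * fderiv ℝ u (r * Real.cos θ, r * Real.sin θ) (1, 0) with hg'
      have hder : ∀ θ, HasDerivAt g (g' θ) θ := by
        intro θ
        have h := (hd (r * Real.cos θ, r * Real.sin θ)).hasFDerivAt.comp_hasDerivAt θ
          (((Real.hasDerivAt_cos θ).const_mul r).prodMk ((Real.hasDerivAt_sin θ).const_mul r))
        have e : ((r * -Real.sin θ, r * Real.cos θ) : ℝ × ℝ) =
            (r * Real.cos θ) • ((0 : ℝ), (1 : ℝ)) - (r * Real.sin θ) • ((1 : ℝ), (0 : ℝ)) := by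
          ext <;> simp
        rw [e, map_sub, map_smul, map_smul, Complex.real_smul, Complex.real_smul] at h
        exact h
      have hcirc := circle_hardy hδ0 hδ hder (by rw [hg']; fun_prop) (by simp [hg])
      have hgc : Continuous g := continuous_iff_continuousAt.2 fun θ => (hder θ).continuousAt
      have hg'c : Continuous g' := by rw [hg']; fun_prop
      calc δ ^ 2 * ∫ θ in -Real.pi..Real.pi, ‖g θ‖ ^ 2 / sqnorm (r * Real.cos θ, r * Real.sin θ)
          = (r ^ 2)⁻¹ * (δ ^ 2 * ∫ θ in -Real.pi..Real.pi, ‖g θ‖ ^ 2) := by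
            simp only [hs, div_eq_inv_mul, intervalIntegral.integral_const_mul]
            ring
        _ ≤ (r ^ 2)⁻¹ * ∫ θ in -Real.pi..Real.pi, ‖-Complex.I * g' θ - Φ * g θ‖ ^ 2 := by gcongr
        _ = ∫ θ in -Real.pi..Real.pi, (r ^ 2)⁻¹ * ‖-Complex.I * g' θ - Φ * g θ‖ ^ 2 := by
            rw [intervalIntegral.integral_const_mul]
        _ ≤ _ := by
            refine intervalIntegral.integral_mono_on hπ
              (Continuous.intervalIntegrable (by fun_prop) _ _)
              (hc2'.intervalIntegrable _ _) fun θ _ => ?_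
            rw [inv_mul_le_iff₀ (by positivity)]
            have hcs := norm_sq_sub_le (r * Real.cos θ) (r * Real.sin θ)
              (-Complex.I * fderiv ℝ u (r * Real.cos θ, r * Real.sin θ) (0, 1) +
                ((Φ * (-(r * Real.cos θ) / r ^ 2) : ℝ) : ℂ) * g θ)
              (-Complex.I * fderiv ℝ u (r * Real.cos θ, r * Real.sin θ) (1, 0) +
                ((Φ * (r * Real.sin θ / r ^ 2) : ℝ) : ℂ) * g θ)
            have hs' := hs θ
            simp only [sqnorm] at hs'
            rw [hs'] at hcs
            simp only [magDensity, hs]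
            refine le_trans (le_of_eq ?_) hcs
            congr 2
            have hr' : (r : ℂ) ≠ 0 := by exact_mod_cast hr.ne'
            have hcs2 : (Complex.cos θ) ^ 2 + (Complex.sin θ) ^ 2 = 1 := by
              rw [add_comm]; exact Complex.sin_sq_add_cos_sq _
            simp only [hg']
            push_cast
            field_simp
            linear_combination ((Φ : ℂ) * g θ) * hcs2
    · refine Measurable.aemeasurable ?_
      have : Measurable (magDensity Φ u) := hc2.measurable
      fun_prop
    · refine Measurable.aemeasurable ?_
      have : Measurable fun x => ‖u x‖ ^ 2 / sqnorm x := hc1.measurable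
      have h2 := this.comp (by fun_prop : Measurable fun p : ℝ × ℝ =>
        (p.1 * Real.cos p.2, p.1 * Real.sin p.2))
      simp only [Function.comp_def] at h2
      fun_prop
  rw [← integral_const_mul]
  have e1 := ofReal_integral_eq_lintegral_ofReal (hu.integrable_sq_div.const_mul (δ ^ 2))
    (ae_of_all _ fun θ => mul_nonneg (sq_nonneg _) (div_nonneg (sq_nonneg _) (sqnorm_nonneg _)))
  have e2 := ofReal_integral_eq_lintegral_ofReal (hu.integrable_magDensity Φ)
    (ae_of_all _ fun θ => magDensity_nonneg _ _ _)
  rw [← e1, ← e2] at hle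
  exact (ENNReal.ofReal_le_ofReal_iff (integral_nonneg fun x => magDensity_nonneg _ _ _)).1 hle

theorem sq_vectorPotential (Φ : ℝ) (z : ℂ) (x : ℝ × ℝ) :
    ‖((Φ * (x.2 / sqnorm x) : ℝ) : ℂ) * z‖ ^ 2 + ‖((Φ * (-x.1 / sqnorm x) : ℝ) : ℂ) * z‖ ^ 2 =
      Φ ^ 2 * (‖z‖ ^ 2 / sqnorm x) := by
  simp only [norm_mul, Complex.norm_real, mul_pow, Real.norm_eq_abs, sq_abs]
  have h : (x.2 / sqnorm x) ^ 2 + (-x.1 / sqnorm x) ^ 2 = 1 / sqnorm x := by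
    rcases eq_or_ne (sqnorm x) 0 with h0 | h0
    · simp [h0]
    · field_simp
      unfold sqnorm
      ring
  rw [div_eq_mul_one_div (‖z‖ ^ 2), ← h]
  ring

theorem gradSq_le (Φ : ℝ) (u : ℝ × ℝ → ℂ) {θ : ℝ} (hθ : 0 < θ) (hθ1 : θ < 1) (x : ℝ × ℝ) :
    (1 - θ) * gradSq u x ≤ magDensity Φ u x + Φ ^ 2 / θ * (‖u x‖ ^ 2 / sqnorm x) := by
  have key : ∀ a w : ℂ, (1 - θ) * ‖a‖ ^ 2 ≤ ‖-Complex.I * a + w‖ ^ 2 + ‖w‖ ^ 2 / θ := by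
    intro a w
    have h1 : ‖a‖ ≤ ‖-Complex.I * a + w‖ + ‖w‖ := by
      have := norm_sub_le (-Complex.I * a + w) w
      simpa using this
    have h2 := pow_le_pow_left₀ (norm_nonneg _) h1 2
    have h4 : ‖w‖ ^ 2 / θ * θ = ‖w‖ ^ 2 := div_mul_cancel₀ _ hθ.ne'
    refine le_of_mul_le_mul_right ?_ hθ
    rw [add_mul, h4]
    set X := ‖-Complex.I * a + w‖
    have h5 : 0 < θ * (1 - θ) := mul_pos hθ (by linarith)
    nlinarith [sq_nonneg (θ * X - (1 - θ) * ‖w‖), mul_le_mul_of_nonneg_left h2 h5.le]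
  have h1 := key (fderiv ℝ u x (1, 0)) (((Φ * (x.2 / sqnorm x) : ℝ) : ℂ) * u x)
  have h2 := key (fderiv ℝ u x (0, 1)) (((Φ * (-x.1 / sqnorm x) : ℝ) : ℂ) * u x)
  rw [div_mul_eq_mul_div, ← sq_vectorPotential, add_div]
  unfold gradSq magDensity
  linarith

theorem magDensity_le (Φ : ℝ) (u : ℝ × ℝ → ℂ) {θ : ℝ} (hθ : 0 < θ) (x : ℝ × ℝ) :
    magDensity Φ u x ≤ (1 + θ) * gradSq u x + (1 + 1 / θ) * Φ ^ 2 * (‖u x‖ ^ 2 / sqnorm x) := by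
  have key : ∀ a w : ℂ, ‖-Complex.I * a + w‖ ^ 2 ≤ (1 + θ) * ‖a‖ ^ 2 + (1 + 1 / θ) * ‖w‖ ^ 2 := by
    intro a w
    have h1 : ‖-Complex.I * a + w‖ ≤ ‖a‖ + ‖w‖ := by
      have := norm_add_le (-Complex.I * a) w
      simpa using this
    have h2 := pow_le_pow_left₀ (norm_nonneg _) h1 2
    have h3 : 2 * ‖a‖ * ‖w‖ ≤ θ * ‖a‖ ^ 2 + 1 / θ * ‖w‖ ^ 2 := by
      have h4 : 0 ≤ (θ * ‖a‖ - ‖w‖) ^ 2 / θ := by positivity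
      have h5 : (θ * ‖a‖ - ‖w‖) ^ 2 / θ = θ * ‖a‖ ^ 2 + 1 / θ * ‖w‖ ^ 2 - 2 * ‖a‖ * ‖w‖ := by
        field_simp
        ring
      linarith
    linarith
  have h1 := key (fderiv ℝ u x (1, 0)) (((Φ * (x.2 / sqnorm x) : ℝ) : ℂ) * u x)
  have h2 := key (fderiv ℝ u x (0, 1)) (((Φ * (-x.1 / sqnorm x) : ℝ) : ℂ) * u x)
  rw [mul_assoc (1 + 1 / θ), ← sq_vectorPotential]
  unfold gradSq magDensity
  linarith

/-- The squares of the square grid of mesh `s` with origin `p`. -/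
def gridSquare (p : ℝ × ℝ) (s : ℝ) (k : ℕ × ℕ) : Set (ℝ × ℝ) :=
  square (p.1 + s * k.1, p.2 + s * k.2) s

theorem measurableSet_gridSquare (p : ℝ × ℝ) (s : ℝ) (k : ℕ × ℕ) :
    MeasurableSet (gridSquare p s k) := measurableSet_square _ _

theorem natCast_eq_of_mem_Ioc {s t a : ℝ} (hs : 0 < s) {k l : ℕ}
    (h1 : t ∈ Set.Ioc (a + s * k) (a + s * k + s)) (h2 : t ∈ Set.Ioc (a + s * l) (a + s * l + s)) :
    k = l := by
  have h3 : s * k < s * (l + 1) := by linarith [h1.1, h2.2]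
  have h4 : s * l < s * (k + 1) := by linarith [h1.2, h2.1]
  have h5 := lt_of_mul_lt_mul_left h3 hs.le
  have h6 := lt_of_mul_lt_mul_left h4 hs.le
  have h5' : k < l + 1 := by exact_mod_cast h5
  have h6' : l < k + 1 := by exact_mod_cast h6
  omega

theorem gridSquare_disjoint (p : ℝ × ℝ) {s : ℝ} (hs : 0 < s) :
    Pairwise (Function.onFun Disjoint (gridSquare p s)) := by
  intro k l hkl
  refine Set.disjoint_left.2 fun x h1 h2 => hkl ?_
  exact Prod.ext (natCast_eq_of_mem_Ioc hs h1.1 h2.1) (natCast_eq_of_mem_Ioc hs h1.2 h2.2)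

theorem exists_nat_mem_Ioc {s t a : ℝ} (hs : 0 < s) {M : ℕ} (h : t ∈ Set.Ioc a (a + s * M)) :
    ∃ k < M, t ∈ Set.Ioc (a + s * k) (a + s * k + s) := by
  have h0 : 0 < (t - a) / s := div_pos (by linarith [h.1]) hs
  have h1 := Nat.ceil_lt_add_one h0.le
  have h2 := Nat.le_ceil ((t - a) / s)
  have h3 : 0 < ⌈(t - a) / s⌉₊ := Nat.ceil_pos.2 h0
  have h4 : ⌈(t - a) / s⌉₊ ≤ M := by
    refine Nat.ceil_le.2 ?_
    rw [div_le_iff₀ hs]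
    linarith [h.2]
  obtain ⟨k, hk⟩ : ∃ k, ⌈(t - a) / s⌉₊ = k + 1 := ⟨_, (Nat.succ_pred_eq_of_pos h3).symm⟩
  rw [hk] at h1 h2 h4
  push_cast at h1 h2
  rw [div_le_iff₀ hs] at h2
  have h5 : (k : ℝ) * s < t - a := by
    rw [← lt_div_iff₀ hs]
    linarith
  exact ⟨k, h4, by linarith, by linarith⟩

theorem gridSquare_subset (p : ℝ × ℝ) {s h : ℝ} (hs : 0 ≤ s) {M : ℕ} (hM : s * M ≤ h) {k : ℕ × ℕ}
    (hk : k ∈ Finset.range M ×ˢ Finset.range M) : gridSquare p s k ⊆ square p h := by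
  rw [Finset.mem_product, Finset.mem_range, Finset.mem_range] at hk
  have e : ∀ j < M, s * (j : ℝ) + s ≤ h := fun j hj => by
    have : (j : ℝ) + 1 ≤ M := by exact_mod_cast hj
    nlinarith [mul_le_mul_of_nonneg_left this hs]
  have e1 := e _ hk.1
  have e2 := e _ hk.2
  have e3 : 0 ≤ s * (k.1 : ℝ) := by positivity
  have e4 : 0 ≤ s * (k.2 : ℝ) := by positivity
  rintro x ⟨⟨h1, h2⟩, h3, h4⟩
  simp only at h1 h2 h3 h4
  exact ⟨⟨by linarith, by linarith⟩, ⟨by linarith, by linarith⟩⟩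

theorem iUnion_gridSquare (p : ℝ × ℝ) {s : ℝ} (hs : 0 < s) (M : ℕ) :
    ⋃ k ∈ Finset.range M ×ˢ Finset.range M, gridSquare p s k = square p (s * M) := by
  refine Set.Subset.antisymm
    (Set.iUnion₂_subset fun k hk => gridSquare_subset p hs.le le_rfl hk) fun x hx => ?_
  obtain ⟨a, ha, ha'⟩ := exists_nat_mem_Ioc hs hx.1
  obtain ⟨b, hb, hb'⟩ := exists_nat_mem_Ioc hs hx.2
  refine Set.mem_biUnion (x := (a, b)) ?_ ⟨ha', hb'⟩
  simp [ha, hb]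

theorem setIntegral_gridSquare (p : ℝ × ℝ) {s : ℝ} (hs : 0 < s) (M : ℕ) {f : ℝ × ℝ → ℝ}
    (hf : IntegrableOn f (square p (s * M))) :
    ∫ x in square p (s * M), f x =
      ∑ k ∈ Finset.range M ×ˢ Finset.range M, ∫ x in gridSquare p s k, f x := by
  rw [← iUnion_gridSquare p hs M]
  refine integral_biUnion_finset _ (fun k _ => measurableSet_gridSquare p s k)
    (fun k _ l _ hkl => gridSquare_disjoint p hs hkl) fun k hk => ?_
  exact hf.mono_set (gridSquare_subset p hs.le le_rfl hk)

/-- Positions of the twelve outer squares in a `4 × 4` grid. -/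
def annIdx : Finset (ℕ × ℕ) :=
  (Finset.range 4 ×ˢ Finset.range 4).filter fun k => ¬((k.1 = 1 ∨ k.1 = 2) ∧ (k.2 = 1 ∨ k.2 = 2))

/-- The dyadic square of generation `n` at position `k`; these squares partition the punctured
plane. -/
noncomputable def dyadicSquare (i : ℤ × annIdx) : Set (ℝ × ℝ) :=
  gridSquare (-2 ^ (i.1 + 1), -2 ^ (i.1 + 1)) (2 ^ i.1) i.2

/-- The lower left corner of a dyadic square. -/
noncomputable def dyadicCorner (i : ℤ × annIdx) : ℝ × ℝ :=
  (-2 ^ (i.1 + 1) + 2 ^ i.1 * (i.2 : ℕ × ℕ).1, -2 ^ (i.1 + 1) + 2 ^ i.1 * (i.2 : ℕ × ℕ).2)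

theorem dyadicSquare_eq (i : ℤ × annIdx) : dyadicSquare i = square (dyadicCorner i) (2 ^ i.1) := rfl

theorem two_zpow_pos (n : ℤ) : (0 : ℝ) < 2 ^ n := zpow_pos two_pos n

/-- The centered square of half side `2 ^ n`. -/
def centeredSquare (n : ℤ) : Set (ℝ × ℝ) :=
  Set.Ioc (-2 ^ n) (2 ^ n) ×ˢ Set.Ioc (-2 ^ n) (2 ^ n)

theorem centeredSquare_mono : Monotone centeredSquare := by
  intro m n hmn
  have : (2 : ℝ) ^ m ≤ 2 ^ n := zpow_le_zpow_right₀ one_le_two hmn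
  exact Set.prod_mono (Set.Ioc_subset_Ioc (by linarith) this)
    (Set.Ioc_subset_Ioc (by linarith) this)

theorem two_zpow_succ (n : ℤ) : (2 : ℝ) ^ (n + 1) = 2 * 2 ^ n := by
  rw [zpow_add_one₀ two_ne_zero, mul_comm]

theorem centeredSquare_succ (n : ℤ) :
    centeredSquare (n + 1) = square (-2 ^ (n + 1), -2 ^ (n + 1)) (2 ^ n * (4 : ℕ)) := by
  unfold centeredSquare square
  have : -(2 : ℝ) ^ (n + 1) + 2 ^ n * (4 : ℕ) = 2 ^ (n + 1) := by
    rw [two_zpow_succ]; push_cast; ring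
  simp only [this]

theorem mem_centeredSquare_of_mem {x : ℝ × ℝ} {i : ℤ × annIdx} (hx : x ∈ dyadicSquare i) :
    x ∈ centeredSquare (i.1 + 1) := by
  rw [centeredSquare_succ]
  exact gridSquare_subset _ (two_zpow_pos _).le le_rfl (Finset.mem_filter.1 i.2.2).1 hx

theorem notMem_centeredSquare_of_mem {x : ℝ × ℝ} {i : ℤ × annIdx} (hx : x ∈ dyadicSquare i) :
    x ∉ centeredSquare i.1 := by
  obtain ⟨n, ⟨⟨a, b⟩, hk⟩⟩ := i
  rintro ⟨h1, h2⟩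
  obtain ⟨h3, h4⟩ := hx
  refine (Finset.mem_filter.1 hk).2 ?_
  have key : ∀ (t : ℝ) (a : ℕ), t ∈ Set.Ioc (-(2 : ℝ) ^ n) (2 ^ n) →
      t ∈ Set.Ioc (-(2 : ℝ) ^ (n + 1) + 2 ^ n * a) (-(2 : ℝ) ^ (n + 1) + 2 ^ n * a + 2 ^ n) →
      a = 1 ∨ a = 2 := by
    intro t a h1 h2
    have hp := two_zpow_pos n
    rw [two_zpow_succ] at h2
    have e1 : (2 : ℝ) ^ n * (a : ℝ) < 2 ^ n * 3 := by linarith [h1.2, h2.1]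
    have e2 : (2 : ℝ) ^ n * 0 < 2 ^ n * (a : ℝ) := by linarith [h1.1, h2.2]
    have e3 := lt_of_mul_lt_mul_left e1 hp.le
    have e4 := lt_of_mul_lt_mul_left e2 hp.le
    have e3' : a < 3 := by exact_mod_cast e3
    have e4' : 0 < a := by exact_mod_cast e4
    omega
  exact ⟨key _ _ h1 h3, key _ _ h2 h4⟩

theorem dyadicSquare_disjoint : Pairwise (Function.onFun Disjoint dyadicSquare) := by
  have key : ∀ i j : ℤ × annIdx, i.1 < j.1 → Disjoint (dyadicSquare i) (dyadicSquare j) := by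
    intro i j hij
    refine Set.disjoint_left.2 fun x h1 h2 => notMem_centeredSquare_of_mem h2 ?_
    exact centeredSquare_mono (by omega : i.1 + 1 ≤ j.1) (mem_centeredSquare_of_mem h1)
  rintro ⟨m, k⟩ ⟨n, l⟩ h
  rcases lt_trichotomy m n with h1 | rfl | h1
  · exact key _ _ h1
  · exact gridSquare_disjoint _ (two_zpow_pos m) fun h' =>
      h (by rw [Subtype.ext (a1 := k) (a2 := l) h'])
  · exact (key _ _ h1).symm

theorem exists_mem_dyadicSquare {x : ℝ × ℝ} (hx : x ≠ 0) : ∃ i, x ∈ dyadicSquare i := by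
  have habs : ∀ t ∈ ({x.1, x.2} : Set ℝ), |t| ≤ |x.1| + |x.2| := by
    rintro t (rfl | rfl)
    · linarith [abs_nonneg x.2]
    · linarith [abs_nonneg x.1]
  have hex : ∃ n : ℤ, x ∈ centeredSquare n := by
    obtain ⟨m, hm⟩ := pow_unbounded_of_one_lt (|x.1| + |x.2|) one_lt_two
    refine ⟨m, ?_⟩
    have h1 := abs_lt.1 (lt_of_le_of_lt (habs x.1 (by simp)) hm)
    have h2 := abs_lt.1 (lt_of_le_of_lt (habs x.2 (by simp)) hm)
    simp only [centeredSquare, zpow_natCast]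
    exact ⟨⟨h1.1, h1.2.le⟩, h2.1, h2.2.le⟩
  have hbdd : ∃ b : ℤ, ∀ n : ℤ, x ∈ centeredSquare n → b ≤ n := by
    have hpos : 0 < |x.1| + |x.2| := by
      by_contra h
      push Not at h
      refine hx (Prod.ext ?_ ?_)
      · exact abs_nonpos_iff.1 ((habs _ (by simp)).trans h)
      · exact abs_nonpos_iff.1 ((habs _ (by simp)).trans h)
    obtain ⟨m, hm⟩ := exists_pow_lt_of_lt_one (half_pos hpos) (by norm_num : (2⁻¹ : ℝ) < 1)
    refine ⟨-m, fun n hn => ?_⟩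
    by_contra hlt
    have h3 : x ∈ centeredSquare (-m) := centeredSquare_mono (not_le.1 hlt).le hn
    simp only [centeredSquare, zpow_neg, zpow_natCast, ← inv_pow] at h3
    have h4 : |x.1| ≤ 2⁻¹ ^ m := abs_le.2 ⟨h3.1.1.le, h3.1.2⟩
    have h5 : |x.2| ≤ 2⁻¹ ^ m := abs_le.2 ⟨h3.2.1.le, h3.2.2⟩
    linarith
  obtain ⟨n, hn, hmin⟩ := Int.exists_least_of_bdd hbdd hex
  have hn' : x ∈ centeredSquare (n - 1 + 1) := by rwa [sub_add_cancel]
  rw [centeredSquare_succ, ← iUnion_gridSquare _ (two_zpow_pos _), Set.mem_iUnion₂] at hn'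
  obtain ⟨⟨a, b⟩, hk, hxk⟩ := hn'
  refine ⟨⟨n - 1, ⟨(a, b), Finset.mem_filter.2 ⟨hk, ?_⟩⟩⟩, hxk⟩
  rintro ⟨h1, h2⟩
  have hle : x ∈ centeredSquare (n - 1) := by
    have key : ∀ (t : ℝ) (a : ℕ), a = 1 ∨ a = 2 →
        t ∈ Set.Ioc (-(2 : ℝ) ^ (n - 1 + 1) + 2 ^ (n - 1) * a)
          (-(2 : ℝ) ^ (n - 1 + 1) + 2 ^ (n - 1) * a + 2 ^ (n - 1)) →
        t ∈ Set.Ioc (-(2 : ℝ) ^ (n - 1)) (2 ^ (n - 1)) := by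
      intro t a ha h
      have hp := two_zpow_pos (n - 1)
      rw [two_zpow_succ] at h
      rcases ha with rfl | rfl <;> push_cast at h
      · exact ⟨by linarith [h.1], by linarith [h.2]⟩
      · exact ⟨by linarith [h.1], by linarith [h.2]⟩
    exact ⟨key _ _ h1 hxk.1, key _ _ h2 hxk.2⟩
  have := hmin _ hle
  omega

theorem le_sqnorm_of_mem {x : ℝ × ℝ} {i : ℤ × annIdx} (hx : x ∈ dyadicSquare i) :
    (2 ^ i.1 : ℝ) ^ 2 ≤ sqnorm x := by
  have hp := two_zpow_pos i.1
  by_contra h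
  push Not at h
  refine notMem_centeredSquare_of_mem hx ?_
  unfold sqnorm at h
  have h1 := abs_lt_of_sq_lt_sq' (by nlinarith [sq_nonneg x.2] : x.1 ^ 2 < (2 ^ i.1) ^ 2) hp.le
  have h2 := abs_lt_of_sq_lt_sq' (by nlinarith [sq_nonneg x.1] : x.2 ^ 2 < (2 ^ i.1) ^ 2) hp.le
  exact ⟨⟨h1.1, h1.2.le⟩, h2.1, h2.2.le⟩

theorem sqnorm_le_of_mem {x : ℝ × ℝ} {i : ℤ × annIdx} (hx : x ∈ dyadicSquare i) :
    sqnorm x ≤ 8 * (2 ^ i.1 : ℝ) ^ 2 := by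
  obtain ⟨h1, h2⟩ := mem_centeredSquare_of_mem hx
  have h3 := sq_le_sq' h1.1.le h1.2
  have h4 := sq_le_sq' h2.1.le h2.2
  rw [two_zpow_succ] at h3 h4
  unfold sqnorm
  linarith

theorem iUnion_dyadicSquare_ae : (⋃ i, dyadicSquare i) =ᵐ[volume] (Set.univ : Set (ℝ × ℝ)) := by
  refine ae_eq_univ.2 (measure_mono_null (t := {0}) ?_ (by simp))
  intro x hx
  by_contra h
  obtain ⟨i, hi⟩ := exists_mem_dyadicSquare h
  exact hx (Set.mem_iUnion.2 ⟨i, hi⟩)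

theorem measurableSet_dyadicSquare (i : ℤ × annIdx) : MeasurableSet (dyadicSquare i) :=
  measurableSet_gridSquare _ _ _

theorem hasSum_integral_dyadicSquare {f : ℝ × ℝ → ℝ} (hf : Integrable f) :
    HasSum (fun i => ∫ x in dyadicSquare i, f x) (∫ x, f x) := by
  have h := hasSum_integral_iUnion measurableSet_dyadicSquare
    dyadicSquare_disjoint (hf.integrableOn (s := ⋃ i, dyadicSquare i))
  rwa [setIntegral_congr_set iUnion_dyadicSquare_ae, setIntegral_univ] at h

theorem eventually_dyadic_decay {p : ℝ} (hp0 : 0 < p) {V : ℝ × ℝ → ℝ}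
    (hV : Filter.Tendsto
      (fun x : ℝ × ℝ => sqnorm x * Real.log (Real.sqrt (sqnorm x)) ^ (1 / p) * V x)
      (Filter.cocompact (ℝ × ℝ)) (nhds 1)) :
    ∃ n₀ : ℕ, 1 ≤ n₀ ∧ ∀ n : ℤ, (n₀ : ℤ) ≤ n → ∀ x, (2 ^ n : ℝ) ^ 2 ≤ sqnorm x →
      V x ≤ 2 * ((2 ^ n : ℝ) ^ 2)⁻¹ * ((n : ℝ) * Real.log 2) ^ (-(1 / p)) := by
  have h1 := hV.eventually (gt_mem_nhds (by norm_num : (1 : ℝ) < 2))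
  rw [(Filter.hasBasis_cocompact (X := ℝ × ℝ)).eventually_iff] at h1
  obtain ⟨K, hK, hKV⟩ := h1
  obtain ⟨R, hR⟩ := hK.exists_bound_of_continuousOn continuous_sqnorm.continuousOn
  obtain ⟨m, hm⟩ := pow_unbounded_of_one_lt R (one_lt_two : (1 : ℝ) < 2)
  refine ⟨m + 1, by omega, fun n hn x hx => ?_⟩
  have hn1 : (1 : ℝ) ≤ n := by
    have : (1 : ℤ) ≤ n := by omega
    exact_mod_cast this
  have h2n : (2 : ℝ) ^ m ≤ 2 ^ n := by
    rw [← zpow_natCast]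
    exact zpow_le_zpow_right₀ one_le_two (by omega)
  have h2n1 : (1 : ℝ) ≤ 2 ^ m := one_le_pow₀ one_le_two
  have hxK : x ∈ Kᶜ := by
    intro hxK
    have := (le_abs_self _).trans (hR x hxK)
    nlinarith
  have hlt : sqnorm x * Real.log (√(sqnorm x)) ^ (1 / p) * V x < 2 := hKV hxK
  have hs0 : (0 : ℝ) < (2 ^ n) ^ 2 := by positivity
  have hlog : (n : ℝ) * Real.log 2 ≤ Real.log (√(sqnorm x)) := by
    have e : (n : ℝ) * Real.log 2 = Real.log (2 ^ n) := by rw [Real.log_zpow]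
    rw [e]
    exact Real.log_le_log (by positivity) (Real.le_sqrt_of_sq_le hx)
  have hl0 : 0 < (n : ℝ) * Real.log 2 := mul_pos (by linarith) (Real.log_pos one_lt_two)
  have hL := Real.rpow_le_rpow hl0.le hlog (by positivity : 0 ≤ 1 / p)
  have hL0 := Real.rpow_pos_of_pos hl0 (1 / p)
  rw [Real.rpow_neg hl0.le, mul_assoc, ← mul_inv, ← div_eq_mul_inv]
  have hprod := mul_le_mul hx hL hL0.le (hs0.le.trans hx)
  have hprod0 := mul_pos hs0 hL0
  rw [le_div_iff₀ hprod0]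
  rcases le_or_gt (V x) 0 with h | h
  · nlinarith
  · nlinarith [mul_le_mul_of_nonneg_left hprod h.le]

theorem exists_dyadic_bound {p : ℝ} (hp0 : 0 < p) (hp1 : p < 1) {V : ℝ × ℝ → ℝ}
    (hVbdd : ∃ B : ℝ, ∀ᵐ x : ℝ × ℝ, |V x| ≤ B)
    (hV : Filter.Tendsto
      (fun x : ℝ × ℝ => sqnorm x * Real.log (Real.sqrt (sqnorm x)) ^ (1 / p) * V x)
      (Filter.cocompact (ℝ × ℝ)) (nhds 1)) :
    ∃ W : ℤ → ℝ, (∀ n, 0 ≤ W n) ∧ Summable (fun n => (2 ^ n : ℝ) ^ 2 * W n) ∧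
      ∀ᵐ x, ∀ i, x ∈ dyadicSquare i → V x ≤ W i.1 := by
  obtain ⟨B, hB⟩ := hVbdd
  obtain ⟨n₀, hn₀, hdec⟩ := eventually_dyadic_decay hp0 hV
  set T : ℤ → ℝ := fun n => 2 * ((2 ^ n : ℝ) ^ 2)⁻¹ * ((n : ℝ) * Real.log 2) ^ (-(1 / p)) with hT
  have hl2 := Real.log_pos (one_lt_two : (1 : ℝ) < 2)
  refine ⟨fun n => if (n₀ : ℤ) ≤ n then T n else |B|, fun n => ?_, ?_, ?_⟩
  · beta_reduce
    split_ifs with h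
    · have : (0 : ℝ) ≤ n := by
        have : (0 : ℤ) ≤ n := by omega
        exact_mod_cast this
      simp only [hT]
      positivity
    · positivity
  · refine Summable.of_nat_of_neg ?_ ?_
    · rw [← summable_nat_add_iff n₀]
      have h1 : Summable fun n : ℕ => 2 * Real.log 2 ^ (-(1 / p)) * (n : ℝ) ^ (-(1 / p)) :=
        (Real.summable_nat_rpow.2 (by
          rw [neg_lt_neg_iff, lt_div_iff₀ hp0]; linarith)).mul_left _
      refine ((summable_nat_add_iff n₀).2 h1).congr fun n => ?_
      beta_reduce
      rw [if_pos (by push_cast; omega)]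
      simp only [hT]
      rw [Int.cast_natCast, Real.mul_rpow (by positivity) hl2.le]
      field_simp
    · have h1 : Summable fun n : ℕ => |B| * (1 / 4 : ℝ) ^ n :=
        (summable_geometric_of_lt_one (by norm_num) (by norm_num)).mul_left _
      refine h1.congr fun n => ?_
      beta_reduce
      rw [if_neg (by omega), mul_comm, zpow_neg, zpow_natCast, ← inv_pow, ← pow_mul, mul_comm n,
        pow_mul]
      norm_num
  · filter_upwards [hB] with x hx i hi
    by_cases h : (n₀ : ℤ) ≤ i.1
    · simp only [if_pos h]
      exact hdec _ h x (le_sqnorm_of_mem hi)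
    · simp only [if_neg h]
      exact (le_abs_self _).trans (hx.trans (le_abs_self B))

theorem summable_dyadic {f : ℤ → ℝ} (hf : Summable f) :
    Summable fun i : ℤ × annIdx => f i.1 := by
  have h : Summable fun i : ℤ × annIdx => |f i.1| := by
    refine (summable_prod_of_nonneg fun _ => abs_nonneg _).2 ⟨fun n => ?_, ?_⟩
    · exact (hasSum_fintype _).summable
    · simp only [tsum_fintype, Finset.sum_const, nsmul_eq_mul]
      exact hf.abs.mul_left _
  exact h.of_abs

theorem setIntegral_posPart_dyadic_le {V : ℝ × ℝ → ℝ} (hVm : Measurable V) {W : ℤ → ℝ}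
    (hW : ∀ n, 0 ≤ W n) (hVW : ∀ᵐ x, ∀ i, x ∈ dyadicSquare i → V x ≤ W i.1) (i : ℤ × annIdx) :
    IntegrableOn (fun x => max (V x) 0) (dyadicSquare i) ∧
      ∫ x in dyadicSquare i, max (V x) 0 ≤ (2 ^ i.1 : ℝ) ^ 2 * W i.1 := by
  have hfin : volume (dyadicSquare i) < ⊤ := volume_square_lt_top _ _
  have hae : ∀ᵐ x ∂volume.restrict (dyadicSquare i), max (V x) 0 ≤ W i.1 := by
    refine (ae_restrict_iff' (measurableSet_dyadicSquare i)).2 ?_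
    filter_upwards [hVW] with x hx hxi using max_le (hx i hxi) (hW _)
  have hint : IntegrableOn (fun x => max (V x) 0) (dyadicSquare i) := by
    refine Measure.integrableOn_of_bounded hfin.ne (by fun_prop) (M := W i.1) ?_
    filter_upwards [hae] with x hx
    rwa [Real.norm_of_nonneg (le_max_right _ _)]
  refine ⟨hint, ?_⟩
  have h1 := integral_mono_ae hint (integrableOn_const hfin.ne (C := W i.1)) hae
  rw [setIntegral_const, smul_eq_mul, Measure.real, dyadicSquare_eq,
    volume_real_square _ (two_zpow_pos _).le] at h1
  exact h1

theorem integrable_posPart {V : ℝ × ℝ → ℝ} (hVm : Measurable V) {W : ℤ → ℝ}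
    (hW : ∀ n, 0 ≤ W n) (hWs : Summable (fun n => (2 ^ n : ℝ) ^ 2 * W n))
    (hVW : ∀ᵐ x, ∀ i, x ∈ dyadicSquare i → V x ≤ W i.1) :
    Integrable fun x => max (V x) 0 := by
  rw [← integrableOn_univ, ← integrableOn_congr_set_ae iUnion_dyadicSquare_ae]
  refine integrableOn_iUnion_of_summable_integral_norm
    (fun i => (setIntegral_posPart_dyadic_le hVm hW hVW i).1) ?_
  refine Summable.of_nonneg_of_le (fun i => integral_nonneg fun x => norm_nonneg _) (fun i => ?_)
    (summable_dyadic hWs)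
  refine le_trans (le_of_eq ?_) (setIntegral_posPart_dyadic_le hVm hW hVW i).2
  refine integral_congr_ae (ae_of_all _ fun x => ?_)
  exact Real.norm_of_nonneg (le_max_right _ _)

theorem integrableOn_square_of_bounded {V : ℝ × ℝ → ℝ} (hVm : Measurable V) {B : ℝ}
    (hB : ∀ᵐ x, |V x| ≤ B) (p : ℝ × ℝ) (h : ℝ) : IntegrableOn V (square p h) :=
  Measure.integrableOn_of_bounded (volume_square_lt_top p h).ne hVm.aestronglyMeasurable
    (ae_restrict_of_ae hB)

theorem abs_sub_clamp_le {B v : ℝ} (hv : |v| ≤ B) (t : ℝ) :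
    |v - max (-B) (min B t)| ≤ |v - t| := by
  obtain ⟨h1, h2⟩ := abs_le.1 hv
  rcases le_total B t with h | h
  · rw [min_eq_left h, max_eq_right (by linarith), abs_of_nonpos (by linarith),
      abs_of_nonpos (by linarith)]
    linarith
  · rw [min_eq_right h]
    rcases le_total (-B) t with h' | h'
    · rw [max_eq_right h']
    · rw [max_eq_left h', abs_of_nonneg (by linarith), abs_of_nonneg (by linarith)]
      linarith

theorem dist_corner_le {p : ℝ × ℝ} {s : ℝ} {k : ℕ × ℕ} {x : ℝ × ℝ} (hx : x ∈ gridSquare p s k) :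
    dist x (p.1 + s * k.1, p.2 + s * k.2) ≤ s := by
  obtain ⟨h1, h2⟩ := hx
  rw [Prod.dist_eq, Real.dist_eq, Real.dist_eq]
  refine max_le ?_ ?_
  · rw [abs_of_nonneg (by linarith [h1.1])]
    linarith [h1.2]
  · rw [abs_of_nonneg (by linarith [h2.1])]
    linarith [h2.2]

theorem exists_step_approx {V : ℝ × ℝ → ℝ} (hVm : Measurable V) {B : ℝ} (hB0 : 0 ≤ B)
    (hB : ∀ᵐ x, |V x| ≤ B) (p : ℝ × ℝ) {H ε : ℝ} (hH : 0 < H) (hε : 0 < ε) :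
    ∃ M : ℕ, 0 < M ∧ ∃ c : ℕ × ℕ → ℝ, (∀ k, |c k| ≤ B) ∧
      ∑ k ∈ Finset.range M ×ˢ Finset.range M, ∫ x in gridSquare p (H / M) k, |V x - c k| ≤ ε := by
  have hVQ := integrableOn_square_of_bounded hVm hB p H
  obtain ⟨g, hgc, hgV, hg, hgi⟩ := ((integrable_indicator_iff
    (measurableSet_square p H)).2 hVQ).exists_hasCompactSupport_integral_sub_le (half_pos hε)
  have hη : 0 < ε / 2 / H ^ 2 := by positivity
  obtain ⟨d, hd, hgd⟩ := Metric.uniformContinuous_iff.1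
    (hgc.uniformContinuous_of_continuous hg) _ hη
  obtain ⟨M, hM⟩ := exists_nat_gt (H / d)
  have hM0 : (0 : ℝ) < M := lt_trans (by positivity) hM
  have hs : 0 < H / M := by positivity
  have hsM : H / M * M = H := by field_simp
  have hsd : H / M < d := by
    rw [div_lt_iff₀ hd] at hM
    rw [div_lt_iff₀ hM0]
    linarith
  refine ⟨M, by exact_mod_cast hM0,
    fun k => max (-B) (min B (g (p.1 + H / M * k.1, p.2 + H / M * k.2))), fun k => ?_, ?_⟩
  · rw [abs_le]
    exact ⟨le_max_left _ _, max_le (by linarith) (min_le_left _ _)⟩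
  · have hsub : ∀ k ∈ Finset.range M ×ˢ Finset.range M, gridSquare p (H / M) k ⊆ square p H :=
      fun k hk => gridSquare_subset p hs.le hsM.le hk
    have hD : IntegrableOn (fun x => |V x - g x|) (square p H) := (hVQ.sub hgi.integrableOn).abs
    have hF : IntegrableOn (fun x => |V x - g x| + ε / 2 / H ^ 2) (square p H) :=
      hD.add
        (integrableOn_const (volume_square_lt_top p H).ne)
    calc ∑ k ∈ Finset.range M ×ˢ Finset.range M, ∫ x in gridSquare p (H / M) k,
          |V x - max (-B) (min B (g (p.1 + H / M * k.1, p.2 + H / M * k.2)))|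
        ≤ ∑ k ∈ Finset.range M ×ˢ Finset.range M, ∫ x in gridSquare p (H / M) k,
          (|V x - g x| + ε / 2 / H ^ 2) := by
          refine Finset.sum_le_sum fun k hk => ?_
          refine integral_mono_ae (((hVQ.mono_set (hsub k hk)).sub
            (integrableOn_const (volume_square_lt_top _ _).ne)).abs) (hF.mono_set (hsub k hk)) ?_
          refine (ae_restrict_iff' (measurableSet_gridSquare _ _ _)).2 ?_
          filter_upwards [hB] with x hx hxk
          refine (abs_sub_clamp_le hx _).trans ((abs_sub_le _ (g x) _).trans ?_)
          gcongr
          have := hgd ((dist_corner_le hxk).trans_lt hsd)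
          rw [Real.dist_eq] at this
          exact this.le
      _ = ∫ x in square p H, (|V x - g x| + ε / 2 / H ^ 2) := by
          have h1 := setIntegral_gridSquare p hs M (f := fun x => |V x - g x| + ε / 2 / H ^ 2)
            (by rwa [hsM])
          rw [hsM] at h1
          exact h1.symm
      _ = (∫ x in square p H, |V x - g x|) + ε / 2 := by
          rw [integral_add hD
            (integrableOn_const (volume_square_lt_top p H).ne), setIntegral_const, Measure.real,
            volume_real_square p hH.le, smul_eq_mul]
          congr 1
          field_simp
      _ ≤ ε / 2 + ε / 2 := by
          gcongr
          refine le_trans ?_ hgV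
          rw [← integral_indicator (measurableSet_square p H)]
          refine integral_mono (hD.integrable_indicator
            (measurableSet_square p H)) ?_ fun x => ?_
          · exact (((integrable_indicator_iff
              (measurableSet_square p H)).2 hVQ).sub hgi).norm
          · by_cases hx : x ∈ square p H
            · simp [hx]
            · simp [hx]
      _ = ε := add_halves ε

theorem eq_zero_of_mem_modeSet_one {k : ℕ × ℕ} (hk : k ∈ modeSet 1) : k = (0, 0) := by
  rw [mem_modeSet] at hk
  have hpi := Real.pi_gt_three
  have key : ∀ j : ℕ, (Real.pi * j) ^ 2 < 1 → j = 0 := by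
    intro j hj
    by_contra h
    have h1 : (1 : ℝ) ≤ j := by exact_mod_cast Nat.one_le_iff_ne_zero.2 h
    have h2 : (3 : ℝ) ≤ Real.pi * j := by nlinarith
    nlinarith
  exact Prod.ext (key _ (by nlinarith [sq_nonneg (Real.pi * k.2)]))
    (key _ (by nlinarith [sq_nonneg (Real.pi * k.1)]))

theorem square_poincare {u : ℝ × ℝ → ℂ} (hu : ContDiff ℝ 1 u) (p : ℝ × ℝ) {h : ℝ} (hh : 0 < h)
    (hz : cosCoeff₂ (fun z => u (p + h • z)) 0 0 = 0) :
    ∫ x in square p h, ‖u x‖ ^ 2 ≤ h ^ 2 * ∫ x in square p h, gradSq u x := by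
  have h1 := square_gap hu p hh (μ := (h ^ 2)⁻¹) (by positivity) fun k hk => by
    rw [inv_mul_cancel₀ (by positivity)] at hk
    rw [eq_zero_of_mem_modeSet_one hk]
    simpa using hz
  rwa [inv_mul_le_iff₀ (by positivity)] at h1

theorem integrableOn_weight_mul {w : ℝ × ℝ → ℝ} (hw : Measurable w) {b : ℝ} {q : Set (ℝ × ℝ)}
    (hwb : ∀ᵐ x ∂volume.restrict q, |w x| ≤ b) {f : ℝ × ℝ → ℝ} (hf : IntegrableOn f q) :
    IntegrableOn (fun x => w x * f x) q :=
  hf.bdd_mul hw.aestronglyMeasurable hwb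

theorem setIntegral_weight_le {w : ℝ × ℝ → ℝ} (hw : Measurable w) {b : ℝ} {q : Set (ℝ × ℝ)}
    (hwb : ∀ᵐ x ∂volume.restrict q, 0 ≤ w x ∧ w x ≤ b) {f : ℝ × ℝ → ℝ} (hf : IntegrableOn f q)
    (hf0 : ∀ x, 0 ≤ f x) : ∫ x in q, w x * f x ≤ b * ∫ x in q, f x := by
  rw [← integral_const_mul]
  refine integral_mono_ae (integrableOn_weight_mul hw (b := b) ?_ hf) (hf.const_mul b) ?_
  · filter_upwards [hwb] with x hx
    rw [abs_of_nonneg hx.1]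
    exact hx.2
  · filter_upwards [hwb] with x hx
    exact mul_le_mul_of_nonneg_right hx.2 (hf0 x)

theorem cosCoeff₂_const (c : ℂ) : cosCoeff₂ (fun _ => c) 0 0 = c := by
  simp [cosCoeff₂, cosCoeff]

theorem norm_sq_le_two_mul (a b : ℂ) : ‖a‖ ^ 2 ≤ 2 * ‖b‖ ^ 2 + 2 * ‖a - b‖ ^ 2 := by
  have h := norm_add_le b (a - b)
  rw [add_sub_cancel] at h
  nlinarith [norm_nonneg a, sq_nonneg (‖b‖ - ‖a - b‖)]

theorem square_weighted_le {u : ℝ × ℝ → ℂ} (hu : ContDiff ℝ 1 u) (p : ℝ × ℝ) {h : ℝ} (hh : 0 < h)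
    {w : ℝ × ℝ → ℝ} (hw : Measurable w) {b : ℝ} (hb : 0 ≤ b)
    (hwb : ∀ᵐ x ∂volume.restrict (square p h), 0 ≤ w x ∧ w x ≤ b) :
    ∫ x in square p h, w x * ‖u x‖ ^ 2 ≤
      4 * (∫ x in square p h, w x) / h ^ 2 * (∫ x in square p h, ‖u x‖ ^ 2) +
      6 * b * h ^ 2 * ∫ x in square p h, gradSq u x := by
  set m := cosCoeff₂ (fun z => u (p + h • z)) 0 0 with hm
  have huc := hu.continuous
  have hwb' : ∀ᵐ x ∂volume.restrict (square p h), |w x| ≤ b := by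
    filter_upwards [hwb] with x hx
    rw [abs_of_nonneg hx.1]
    exact hx.2
  have hI : IntegrableOn (fun x => ‖u x‖ ^ 2) (square p h) :=
    Continuous.integrableOn_square (by fun_prop) p h
  have hI' : IntegrableOn (fun x => ‖u x - m‖ ^ 2) (square p h) :=
    Continuous.integrableOn_square (by fun_prop) p h
  have hIw : IntegrableOn w (square p h) :=
    Measure.integrableOn_of_bounded (volume_square_lt_top p h).ne hw.aestronglyMeasurable hwb'
  have hP : ∫ x in square p h, ‖u x - m‖ ^ 2 ≤ h ^ 2 * ∫ x in square p h, gradSq u x := by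
    have h1 := square_poincare (u := fun x => u x + -m) (hu.add contDiff_const) p hh (by
      rw [cosCoeff₂_add (u := fun z => u (p + h • z)) (v := fun _ => -m) (by fun_prop)
        (by fun_prop), cosCoeff₂_const, ← hm, add_neg_cancel])
    have h2 : gradSq (fun x => u x + -m) = gradSq u := by
      funext x
      simp only [gradSq, fderiv_add_const]
    rw [h2] at h1
    simpa only [← sub_eq_add_neg] using h1
  have hm2 : h ^ 2 * ‖m‖ ^ 2 ≤
      2 * (∫ x in square p h, ‖u x‖ ^ 2) + 2 * ∫ x in square p h, ‖u x - m‖ ^ 2 := by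
    rw [← integral_const_mul, ← integral_const_mul,
      ← integral_add (hI.const_mul 2) (hI'.const_mul 2)]
    have h1 : ∫ x in square p h, ‖m‖ ^ 2 = h ^ 2 * ‖m‖ ^ 2 := by
      rw [setIntegral_const, Measure.real, volume_real_square p hh.le, smul_eq_mul]
    rw [← h1]
    refine integral_mono (integrableOn_const (volume_square_lt_top p h).ne)
      ((hI.const_mul 2).add (hI'.const_mul 2)) fun x => ?_
    have := norm_sq_le_two_mul m (u x)
    rwa [norm_sub_rev] at this
  have h3 : ∫ x in square p h, w x * ‖u x‖ ^ 2 ≤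
      2 * ‖m‖ ^ 2 * (∫ x in square p h, w x) +
        2 * ∫ x in square p h, w x * ‖u x - m‖ ^ 2 := by
    rw [← integral_const_mul, ← integral_const_mul,
      ← integral_add (hIw.const_mul _) ((integrableOn_weight_mul hw hwb' hI').const_mul 2)]
    refine integral_mono_ae (integrableOn_weight_mul hw hwb' hI)
      ((hIw.const_mul _).add ((integrableOn_weight_mul hw hwb' hI').const_mul 2)) ?_
    filter_upwards [hwb] with x hx
    have := mul_le_mul_of_nonneg_left (norm_sq_le_two_mul (u x) m) hx.1
    linarith
  have h4 := setIntegral_weight_le hw hwb hI' (fun x => by positivity)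
  have h5 : ∫ x in square p h, w x ≤ b * h ^ 2 := by
    have := setIntegral_weight_le hw hwb
      (integrableOn_const (volume_square_lt_top p h).ne (C := (1 : ℝ))) (fun _ => zero_le_one)
    rw [setIntegral_const, Measure.real, volume_real_square p hh.le] at this
    simpa using this
  have h6 : 0 ≤ ∫ x in square p h, w x := integral_nonneg_of_ae (by
    filter_upwards [hwb] with x hx using hx.1)
  set ω := ∫ x in square p h, w x
  set G := ∫ x in square p h, gradSq u x
  set J := ∫ x in square p h, ‖u x - m‖ ^ 2
  set I := ∫ x in square p h, ‖u x‖ ^ 2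
  have h7 : ‖m‖ ^ 2 ≤ 2 * (I + J) / h ^ 2 := by
    rw [le_div_iff₀ (by positivity)]; linarith
  have hG : 0 ≤ G := integral_nonneg fun x => gradSq_nonneg u x
  have h8 : J / h ^ 2 ≤ G := by rw [div_le_iff₀ (by positivity)]; linarith
  have h9 : 2 * ‖m‖ ^ 2 * ω ≤ 4 * ω / h ^ 2 * I + 4 * ω * (J / h ^ 2) := by
    have := mul_le_mul_of_nonneg_right h7 h6
    calc 2 * ‖m‖ ^ 2 * ω ≤ 2 * (2 * (I + J) / h ^ 2 * ω) := by linarith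
      _ = _ := by field_simp; ring
  have h10 : 4 * ω * (J / h ^ 2) ≤ 4 * (b * h ^ 2) * G := by gcongr
  have h11 : b * J ≤ b * (h ^ 2 * G) := by gcongr
  linarith

theorem codimLE_weighted_square (p : ℝ × ℝ) {h : ℝ} (hh : 0 < h)
    {w : ℝ × ℝ → ℝ} (hw : Measurable w) {b : ℝ} (hb : 0 ≤ b)
    (hwb : ∀ᵐ x ∂volume.restrict (square p h), 0 ≤ w x ∧ w x ≤ b) {t : ℝ} (ht : 0 < t) :
    ∃ K : ℕ, (K : ℝ) ≤ 4 * (∫ x in square p h, w x) / h ^ 2 / t ∧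
      CodimLE (fun u => ∫ x in square p h, w x * ‖u x‖ ^ 2 ≤
        t * (∫ x in square p h, ‖u x‖ ^ 2) + 6 * b * h ^ 2 * ∫ x in square p h, gradSq u x) K := by
  have h6 : 0 ≤ ∫ x in square p h, w x := integral_nonneg_of_ae (by
    filter_upwards [hwb] with x hx using hx.1)
  rcases le_or_gt (4 * (∫ x in square p h, w x) / h ^ 2) t with hle | hgt
  · refine ⟨0, by push_cast; positivity, CodimLE.of_forall (fun u hu => ?_) 0⟩
    refine (square_weighted_le hu.contDiff_one p hh hw hb hwb).trans ?_
    gcongr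
  · refine ⟨1, ?_, {modeFun p h (0, 0)}, by simp, fun u hu => ?_⟩
    · rw [Nat.cast_one, le_div_iff₀ ht, one_mul]
      exact hgt.le
    · have hu1 := IsTestFun.contDiff_one u.2
      have hI : IntegrableOn (fun x => ‖(u : ℝ × ℝ → ℂ) x‖ ^ 2) (square p h) :=
        Continuous.integrableOn_square (by have := hu1.continuous; fun_prop) p h
      have h1 := square_poincare hu1 p hh (hu _ (Finset.mem_singleton_self _))
      have h2 := setIntegral_weight_le hw hwb hI fun x => by positivity
      have h3 : 0 ≤ ∫ x in square p h, ‖(u : ℝ × ℝ → ℂ) x‖ ^ 2 :=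
        integral_nonneg fun x => by positivity
      have h4 : 0 ≤ ∫ x in square p h, gradSq u x := integral_nonneg fun x => gradSq_nonneg _ x
      have h5 := mul_le_mul_of_nonneg_left h1 hb
      have h7 : 0 ≤ b * (h ^ 2 * ∫ x in square p h, gradSq u x) := by positivity
      nlinarith [mul_nonneg ht.le h3]

theorem codimLE_weighted_grid (p : ℝ × ℝ) {H : ℝ} (hH : 0 < H)
    {w : ℝ × ℝ → ℝ} (hw : Measurable w) {b : ℝ} (hb : 0 ≤ b)
    (hwb : ∀ᵐ x, 0 ≤ w x ∧ w x ≤ b) {t : ℝ} (ht : 0 < t) {M : ℕ} (hM : 0 < M) :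
    ∃ K : ℕ, (K : ℝ) ≤ 4 * (∫ x in square p H, w x) / (H / M) ^ 2 / t ∧
      CodimLE (fun u => ∫ x in square p H, w x * ‖u x‖ ^ 2 ≤
        t * (∫ x in square p H, ‖u x‖ ^ 2) +
          6 * b * (H / M) ^ 2 * ∫ x in square p H, gradSq u x) K := by
  have hM0 : (0 : ℝ) < M := by exact_mod_cast hM
  have hs : 0 < H / M := by positivity
  have hsM : H / M * M = H := by field_simp
  have hgrid : ∀ {f : ℝ × ℝ → ℝ}, IntegrableOn f (square p H) → ∫ x in square p H, f x =
      ∑ k ∈ Finset.range M ×ˢ Finset.range M, ∫ x in gridSquare p (H / M) k, f x := by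
    intro f hf
    have h1 := setIntegral_gridSquare p hs M (f := f) (by rwa [hsM])
    rwa [hsM] at h1
  have hwb' : ∀ q : Set (ℝ × ℝ), ∀ᵐ x ∂volume.restrict q, |w x| ≤ b := fun q => by
    filter_upwards [ae_restrict_of_ae hwb] with x hx
    rw [abs_of_nonneg hx.1]
    exact hx.2
  have hcell := fun k : ℕ × ℕ => codimLE_weighted_square (p.1 + H / M * k.1, p.2 + H / M * k.2) hs
    hw hb (ae_restrict_of_ae hwb) ht
  choose K hK hKc using hcell
  refine ⟨_, ?_, (CodimLE.finset (Finset.range M ×ˢ Finset.range M) fun k _ => hKc k).mono ?_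
    le_rfl⟩
  · push_cast
    refine (Finset.sum_le_sum fun k _ => hK k).trans (le_of_eq ?_)
    rw [← Finset.sum_div, ← Finset.sum_div, ← Finset.mul_sum, hgrid
      (Measure.integrableOn_of_bounded (volume_square_lt_top p H).ne hw.aestronglyMeasurable
        (hwb' _))]
    rfl
  · intro u hu h
    have huc := hu.contDiff_one.continuous
    have hI : IntegrableOn (fun x => ‖u x‖ ^ 2) (square p H) :=
      Continuous.integrableOn_square (by fun_prop) p H
    rw [hgrid hI, hgrid ((continuous_gradSq hu.contDiff_one).integrableOn_square p H),
      hgrid (integrableOn_weight_mul hw (hwb' _) hI), Finset.mul_sum, Finset.mul_sum,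
      ← Finset.sum_add_distrib]
    exact Finset.sum_le_sum h

theorem codimLE_square_of_near_const {V : ℝ × ℝ → ℝ} (hVm : Measurable V) {B : ℝ} (hB0 : 0 ≤ B)
    (hB : ∀ᵐ x, |V x| ≤ B) (p : ℝ × ℝ) {H c θ τ : ℝ} (hH : 0 < H) (hc : |c| ≤ B) (hθ : 0 < θ)
    (hθ1 : θ < 1) (hτ : 0 < τ) :
    ∃ D : ℝ, ∀ lam : ℝ, 0 < lam → ∃ K : ℕ,
      (K : ℝ) ≤ lam * ((1 + θ) / (1 - θ) / (4 * Real.pi) * (max (c + 2 * τ) 0 * H ^ 2) +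
        96 * B / (θ * τ) * ∫ x in square p H, |V x - c|) + D ∧
      CodimLE (fun u => lam * ∫ x in square p H, (V x + τ) * ‖u x‖ ^ 2 ≤
        ∫ x in square p H, gradSq u x) K := by
  obtain ⟨C, -, hC⟩ := card_modeSet_le hθ
  set ω := ∫ x in square p H, |V x - c| with hω
  have hω0 : 0 ≤ ω := integral_nonneg fun x => abs_nonneg _
  have hθ1' : 0 < 1 - θ := by linarith
  refine ⟨C + 32 * ω / (H ^ 2 * τ), fun lam hlam => ?_⟩
  set w : ℝ × ℝ → ℝ := fun x => |V x - c| with hwdef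
  have hw : Measurable w := by fun_prop
  have hwb : ∀ᵐ x, 0 ≤ w x ∧ w x ≤ 2 * B := by
    filter_upwards [hB] with x hx
    refine ⟨abs_nonneg _, (abs_sub _ _).trans ?_⟩
    linarith
  set S := √(12 * B * lam / θ) * H with hS
  have hS0 : 0 ≤ S := by positivity
  have hS2 : S ^ 2 = 12 * B * lam / θ * H ^ 2 := by
    rw [hS, mul_pow, Real.sq_sqrt (by positivity)]
  set M := ⌈S⌉₊ + 1 with hM
  have hM1 : S ≤ M := by
    rw [hM]; push_cast; linarith [Nat.le_ceil S]
  have hM2 : (M : ℝ) ≤ S + 2 := by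
    rw [hM]; push_cast; linarith [Nat.ceil_lt_add_one hS0]
  have hM0 : 0 < M := Nat.succ_pos _
  have hM0' : (0 : ℝ) < M := by exact_mod_cast hM0
  have hMS : (M : ℝ) ^ 2 ≤ 2 * S ^ 2 + 8 := by nlinarith [sq_nonneg (S - 2)]
  obtain ⟨K₁, hK₁, hc₁⟩ := codimLE_weighted_grid p hH hw (by positivity) hwb hτ hM0
  set μ := lam * max (c + 2 * τ) 0 / (1 - θ) with hμ
  have hμ0 : 0 ≤ μ := by positivity
  have hc₂ := codimLE_square_gap p hH hμ0
  refine ⟨(modeSet (μ * H ^ 2)).card + K₁, ?_, (hc₂.and hc₁).mono ?_ le_rfl⟩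
  · push_cast
    have h1 := hC (μ * H ^ 2)
    rw [max_eq_left (by positivity)] at h1
    have h2 : 4 * ω / (H / M) ^ 2 / τ = 4 * ω / (H ^ 2 * τ) * M ^ 2 := by field_simp
    have h3 : 4 * ω / (H ^ 2 * τ) * (M : ℝ) ^ 2 ≤ 4 * ω / (H ^ 2 * τ) * (2 * S ^ 2 + 8) := by
      gcongr
    have h4 : 4 * ω / (H ^ 2 * τ) * (2 * S ^ 2 + 8) =
        lam * (96 * B / (θ * τ) * ω) + 32 * ω / (H ^ 2 * τ) := by
      rw [hS2]; field_simp; ring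
    have h5 : (1 + θ) * (μ * H ^ 2) / (4 * Real.pi) =
        lam * ((1 + θ) / (1 - θ) / (4 * Real.pi) * (max (c + 2 * τ) 0 * H ^ 2)) := by
      rw [hμ]; field_simp
    rw [h2] at hK₁
    linarith
  · rintro u hu ⟨h1, h2⟩
    have huc := hu.contDiff_one.continuous
    have hI : IntegrableOn (fun x => ‖u x‖ ^ 2) (square p H) :=
      Continuous.integrableOn_square (by fun_prop) p H
    have hwb' : ∀ᵐ x ∂volume.restrict (square p H), |w x| ≤ 2 * B := by
      filter_upwards [ae_restrict_of_ae hwb] with x hx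
      rw [abs_of_nonneg hx.1]
      exact hx.2
    have hVb' : ∀ᵐ x ∂volume.restrict (square p H), |V x + τ| ≤ B + τ := by
      filter_upwards [ae_restrict_of_ae hB] with x hx
      exact (abs_add_le _ _).trans (by rw [abs_of_pos hτ]; linarith)
    have hwI := integrableOn_weight_mul hw hwb' hI
    set I := ∫ x in square p H, ‖u x‖ ^ 2
    set G := ∫ x in square p H, gradSq u x
    have hI0 : 0 ≤ I := integral_nonneg fun x => by positivity
    have hG0 : 0 ≤ G := integral_nonneg fun x => gradSq_nonneg u x
    have h3 : ∫ x in square p H, (V x + τ) * ‖u x‖ ^ 2 ≤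
        (c + τ) * I + ∫ x in square p H, w x * ‖u x‖ ^ 2 := by
      rw [← integral_const_mul, ← integral_add (hI.const_mul _) hwI]
      refine integral_mono (integrableOn_weight_mul (by fun_prop) hVb' hI)
        ((hI.const_mul _).add hwI) fun x => ?_
      have : V x - c ≤ w x := le_abs_self _
      nlinarith [sq_nonneg ‖u x‖]
    have h4 : 6 * (2 * B) * (H / M) ^ 2 * lam ≤ θ := by
      rw [div_pow, mul_div_assoc', div_mul_eq_mul_div, div_le_iff₀ (by positivity)]
      have : S ^ 2 ≤ (M : ℝ) ^ 2 := by gcongr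
      have h5 : θ * S ^ 2 = 12 * B * lam * H ^ 2 := by rw [hS2]; field_simp
      nlinarith
    have h6 : lam * (c + 2 * τ) * I ≤ (1 - θ) * G := by
      have : (1 - θ) * (μ * I) = lam * max (c + 2 * τ) 0 * I := by rw [hμ]; field_simp
      have h7 : lam * (c + 2 * τ) * I ≤ lam * max (c + 2 * τ) 0 * I := by
        gcongr
        exact le_max_left _ _
      nlinarith [mul_le_mul_of_nonneg_left h1 hθ1'.le]
    have h8 := mul_le_mul_of_nonneg_left h3 hlam.le
    have h9 := mul_le_mul_of_nonneg_left h2 hlam.le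
    have h10 := mul_le_mul_of_nonneg_right h4 hG0
    linarith

theorem exists_upper_parameter {I H B ε : ℝ} (hB : 0 ≤ B) (hε : 0 < ε) :
    ∃ θ : ℝ, 0 < θ ∧ θ < 1 ∧ ∃ ε' : ℝ, 0 < ε' ∧
      (1 + θ) / (1 - θ) / (4 * Real.pi) * (I + ε' + 2 * θ * H ^ 2) + 96 * B / (θ * θ) * ε' ≤
        I / (4 * Real.pi) + ε := by
  have hcont : ContinuousAt (fun θ : ℝ => (1 + θ) / (1 - θ) / (4 * Real.pi) *
      (I + θ + 2 * θ * H ^ 2) + θ) 0 := by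
    refine ContinuousAt.add (ContinuousAt.mul (ContinuousAt.div_const (ContinuousAt.div
      (by fun_prop) (by fun_prop) (by norm_num)) _) (by fun_prop)) (by fun_prop)
  have h1 := hcont.eventually_lt (g := fun _ => I / (4 * Real.pi) + ε) continuousAt_const (by
    simp only [add_zero, sub_zero, div_one, mul_zero, zero_mul]
    rw [one_div_mul_eq_div]
    linarith)
  obtain ⟨θ, hθ, hθ0, hθ1⟩ := ((h1.filter_mono nhdsWithin_le_nhds).and
    (Ioo_mem_nhdsGT (one_pos : (0 : ℝ) < 1))).exists
  refine ⟨θ, hθ0, hθ1, min θ (θ ^ 3 / (96 * B + 1)), by positivity, ?_⟩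
  have hθ1' : 0 < 1 - θ := by linarith
  have h2 : 96 * B / (θ * θ) * min θ (θ ^ 3 / (96 * B + 1)) ≤ θ := by
    calc 96 * B / (θ * θ) * min θ (θ ^ 3 / (96 * B + 1))
        ≤ 96 * B / (θ * θ) * (θ ^ 3 / (96 * B + 1)) := by gcongr; exact min_le_right _ _
      _ = θ * (96 * B / (96 * B + 1)) := by field_simp
      _ ≤ θ * 1 := by
          gcongr
          rw [div_le_one (by positivity)]; linarith
      _ = θ := mul_one θ
  have h3 : (1 + θ) / (1 - θ) / (4 * Real.pi) *
      (I + min θ (θ ^ 3 / (96 * B + 1)) + 2 * θ * H ^ 2) ≤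
      (1 + θ) / (1 - θ) / (4 * Real.pi) * (I + θ + 2 * θ * H ^ 2) := by
    gcongr
    exact min_le_left _ _
  linarith

theorem codimLE_square_upper {V : ℝ × ℝ → ℝ} (hVm : Measurable V) {B : ℝ} (hB0 : 0 ≤ B)
    (hB : ∀ᵐ x, |V x| ≤ B) (p : ℝ × ℝ) {H ε : ℝ} (hH : 0 < H) (hε : 0 < ε) :
    ∃ τ : ℝ, 0 < τ ∧ ∃ L : ℝ, ∀ lam : ℝ, L ≤ lam → ∃ K : ℕ,
      (K : ℝ) ≤ lam * ((∫ x in square p H, max (V x) 0) / (4 * Real.pi) + ε) ∧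
      CodimLE (fun u => lam * ∫ x in square p H, (V x + τ) * ‖u x‖ ^ 2 ≤
        ∫ x in square p H, gradSq u x) K := by
  set I := ∫ x in square p H, max (V x) 0 with hI
  obtain ⟨θ, hθ, hθ1, ε', hε', hpar⟩ :=
    exists_upper_parameter (I := I) (H := H) hB0 (half_pos hε)
  obtain ⟨M, hM, c, hc, hω⟩ := exists_step_approx hVm hB0 hB p hH hε'
  have hM0 : (0 : ℝ) < M := by exact_mod_cast hM
  have hs : 0 < H / M := by positivity
  have hsM : H / M * M = H := by field_simp
  have hgrid : ∀ {f : ℝ × ℝ → ℝ}, IntegrableOn f (square p H) → ∫ x in square p H, f x =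
      ∑ k ∈ Finset.range M ×ˢ Finset.range M, ∫ x in gridSquare p (H / M) k, f x := by
    intro f hf
    have h1 := setIntegral_gridSquare p hs M (f := f) (by rwa [hsM])
    rwa [hsM] at h1
  have hcell := fun k : ℕ × ℕ => codimLE_square_of_near_const hVm hB0 hB
    (p.1 + H / M * k.1, p.2 + H / M * k.2) hs (hc k) hθ hθ1 hθ
  choose D hD using hcell
  set s := Finset.range M ×ˢ Finset.range M with hsdef
  refine ⟨θ, hθ, max 1 ((∑ k ∈ s, D k) / (ε / 2)), fun lam hlam => ?_⟩
  have hlam0 : 0 < lam := one_pos.trans_le ((le_max_left _ _).trans hlam)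
  choose K hK hKc using fun k => hD k lam hlam0
  have hVI := integrableOn_square_of_bounded hVm hB
  have hVp : ∀ q h, IntegrableOn (fun x => max (V x) 0) (square q h) := fun q h =>
    (hVI q h).pos_part
  refine ⟨_, ?_, (CodimLE.finset s fun k _ => hKc k).mono ?_ le_rfl⟩
  · push_cast
    have hDlam : ∑ k ∈ s, D k ≤ lam * (ε / 2) := by
      rw [← div_le_iff₀ (half_pos hε)]
      exact (le_max_right _ _).trans hlam
    have hθ1' : 0 < 1 - θ := by linarith
    have h1 : ∀ k ∈ s, max (c k + 2 * θ) 0 * (H / M) ^ 2 ≤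
        (∫ x in gridSquare p (H / M) k, max (V x) 0) +
          (∫ x in gridSquare p (H / M) k, |V x - c k|) + 2 * θ * (H / M) ^ 2 := by
      intro k hk
      have hvol : ∀ a : ℝ, ∫ x in gridSquare p (H / M) k, a = a * (H / M) ^ 2 := fun a => by
        rw [setIntegral_const, Measure.real, gridSquare, volume_real_square _ hs.le, smul_eq_mul,
          mul_comm]
      have hci : ∀ a : ℝ, IntegrableOn (fun _ => a) (gridSquare p (H / M) k) := fun a =>
        integrableOn_const (volume_square_lt_top _ _).ne
      have hdi : IntegrableOn (fun x => |V x - c k|) (gridSquare p (H / M) k) :=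
        ((hVI _ _).sub (hci _)).abs
      have hpi : IntegrableOn (fun x => max (V x) 0) (gridSquare p (H / M) k) := hVp _ _
      have hpd : IntegrableOn (fun x => max (V x) 0 + |V x - c k|) (gridSquare p (H / M) k) :=
        hpi.add hdi
      rw [← hvol, ← hvol, ← integral_add hpi hdi, ← integral_add hpd (hci _)]
      refine integral_mono (hci _) (hpd.add (hci _)) fun x => ?_
      have h2 := neg_abs_le (V x - c k)
      have h3 := le_max_left (V x) 0
      have h4 := le_max_right (V x) 0
      refine max_le ?_ ?_
      · beta_reduce; linarith
      · beta_reduce; linarith [abs_nonneg (V x - c k)]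
    have hcard : ∑ _k ∈ s, 2 * θ * (H / M) ^ 2 = 2 * θ * H ^ 2 := by
      rw [Finset.sum_const, hsdef, Finset.card_product, Finset.card_range, nsmul_eq_mul]
      push_cast
      field_simp
    have h2 := Finset.sum_le_sum h1
    rw [Finset.sum_add_distrib, Finset.sum_add_distrib, hcard, ← hgrid (hVp _ _)] at h2
    refine (Finset.sum_le_sum fun k _ => hK k).trans ?_
    rw [Finset.sum_add_distrib, ← Finset.mul_sum, Finset.sum_add_distrib, ← Finset.mul_sum,
      ← Finset.mul_sum]
    have h3 : (1 + θ) / (1 - θ) / (4 * Real.pi) * ∑ k ∈ s, max (c k + 2 * θ) 0 * (H / M) ^ 2 ≤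
        (1 + θ) / (1 - θ) / (4 * Real.pi) * (I + ε' + 2 * θ * H ^ 2) := by
      gcongr
      linarith
    have h4 : 96 * B / (θ * θ) * ∑ k ∈ s, (∫ x in gridSquare p (H / M) k, |V x - c k|) ≤
        96 * B / (θ * θ) * ε' := by gcongr
    have h5 := mul_le_mul_of_nonneg_left ((add_le_add h3 h4).trans hpar) hlam0.le
    refine (add_le_add h5 hDlam).trans (le_of_eq ?_)
    ring
  · intro u hu h
    have huc := hu.contDiff_one.continuous
    have hI : IntegrableOn (fun x => ‖u x‖ ^ 2) (square p H) :=
      Continuous.integrableOn_square (by fun_prop) p H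
    have hVb' : ∀ᵐ x ∂volume.restrict (square p H), |V x + θ| ≤ B + θ := by
      filter_upwards [ae_restrict_of_ae hB] with x hx
      exact (abs_add_le _ _).trans (by rw [abs_of_pos hθ]; linarith)
    rw [hgrid ((continuous_gradSq hu.contDiff_one).integrableOn_square p H),
      hgrid (integrableOn_weight_mul (by fun_prop) hVb' hI), Finset.mul_sum]
    exact Finset.sum_le_sum h

theorem codimLE_square_mag {V : ℝ × ℝ → ℝ} (hVm : Measurable V) {B : ℝ} (hB0 : 0 ≤ B)
    (hB : ∀ᵐ x, |V x| ≤ B) (Φ : ℝ) (p : ℝ × ℝ) {H r θ ε : ℝ} (hH : 0 < H) (hr : 0 < r)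
    (hrQ : ∀ x ∈ square p H, r ^ 2 ≤ sqnorm x) (hθ : 0 < θ) (hθ1 : θ < 1) (hε : 0 < ε) :
    ∃ L : ℝ, ∀ lam : ℝ, L ≤ lam → ∃ K : ℕ,
      (K : ℝ) ≤ lam * (((1 - θ) ^ 2)⁻¹ * (∫ x in square p H, max (V x) 0) / (4 * Real.pi) + ε) ∧
      CodimLE (fun u => lam * ∫ x in square p H, V x * ‖u x‖ ^ 2 ≤
        (1 - θ) * ∫ x in square p H, magDensity Φ u x) K := by
  have hθ1' : 0 < 1 - θ := by linarith
  set a := ((1 - θ) ^ 2)⁻¹ with ha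
  have ha0 : 0 < a := by positivity
  obtain ⟨τ, hτ, L, hL⟩ := codimLE_square_upper (V := fun x => a * V x) (by fun_prop)
    (B := a * B) (by positivity) (by
      filter_upwards [hB] with x hx
      rw [abs_mul, abs_of_pos ha0]
      gcongr) p hH hε
  refine ⟨max L (Φ ^ 2 / θ / r ^ 2 / ((1 - θ) * τ)), fun lam hlam => ?_⟩
  obtain ⟨K, hK, hKc⟩ := hL lam ((le_max_left _ _).trans hlam)
  have hlam2 : Φ ^ 2 / θ / r ^ 2 ≤ lam * ((1 - θ) * τ) := by
    rw [← div_le_iff₀ (by positivity)]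
    exact (le_max_right _ _).trans hlam
  refine ⟨K, ?_, hKc.mono (fun u hu h => ?_) le_rfl⟩
  · have h1 : ∀ x, max (a * V x) 0 = a * max (V x) 0 := fun x => by
      rw [mul_max_of_nonneg _ _ ha0.le, mul_zero]
    simpa only [h1, integral_const_mul] using hK
  · have huc := hu.contDiff_one.continuous
    have hI : IntegrableOn (fun x => ‖u x‖ ^ 2) (square p H) :=
      Continuous.integrableOn_square (by fun_prop) p H
    have hVI : IntegrableOn (fun x => V x * ‖u x‖ ^ 2) (square p H) :=
      integrableOn_weight_mul hVm (ae_restrict_of_ae hB) hI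
    have hMI : IntegrableOn (magDensity Φ u) (square p H) :=
      (hu.continuous_magDensity Φ).integrableOn_square p H
    have hGI : IntegrableOn (gradSq u) (square p H) :=
      (continuous_gradSq hu.contDiff_one).integrableOn_square p H
    have h1 : ∫ x in square p H, (a * V x + τ) * ‖u x‖ ^ 2 =
        a * (∫ x in square p H, V x * ‖u x‖ ^ 2) + τ * ∫ x in square p H, ‖u x‖ ^ 2 := by
      rw [← integral_const_mul, ← integral_const_mul,
        ← integral_add (hVI.const_mul a) (hI.const_mul τ)]
      congr 1
      funext x
      ring
    have h2 : (1 - θ) * (∫ x in square p H, gradSq u x) ≤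
        (∫ x in square p H, magDensity Φ u x) +
          Φ ^ 2 / θ / r ^ 2 * ∫ x in square p H, ‖u x‖ ^ 2 := by
      rw [← integral_const_mul, ← integral_const_mul, ← integral_add hMI (hI.const_mul _)]
      refine integral_mono_ae (hGI.const_mul _) (hMI.add (hI.const_mul _)) ?_
      refine (ae_restrict_iff' (measurableSet_square p H)).2 (ae_of_all _ fun x hx => ?_)
      refine (gradSq_le Φ u hθ hθ1 x).trans ?_
      have h3 := hrQ x hx
      have h4 : ‖u x‖ ^ 2 / sqnorm x ≤ ‖u x‖ ^ 2 / r ^ 2 := by gcongr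
      have h5 : Φ ^ 2 / θ * (‖u x‖ ^ 2 / sqnorm x) ≤ Φ ^ 2 / θ * (‖u x‖ ^ 2 / r ^ 2) := by gcongr
      have h6 : Φ ^ 2 / θ * (‖u x‖ ^ 2 / r ^ 2) = Φ ^ 2 / θ / r ^ 2 * ‖u x‖ ^ 2 := by ring
      beta_reduce
      linarith
    set I := ∫ x in square p H, ‖u x‖ ^ 2
    set J := ∫ x in square p H, V x * ‖u x‖ ^ 2
    set G := ∫ x in square p H, gradSq u x
    set E := ∫ x in square p H, magDensity Φ u x
    have hI0 : 0 ≤ I := integral_nonneg fun x => by positivity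
    rw [h1] at h
    have h3 := mul_le_mul_of_nonneg_right hlam2 hI0
    have h4 : (1 - θ) * (lam * (a * J)) ≤ E := by
      have := mul_le_mul_of_nonneg_left h hθ1'.le
      linarith
    have h5 := mul_le_mul_of_nonneg_left h4 hθ1'.le
    have h6 : (1 - θ) * ((1 - θ) * (lam * (a * J))) = lam * J := by
      rw [ha]; field_simp
    linarith

theorem codimLE_dyadic_outer {c : ℝ} (hc : 0 < c) :
    ∃ A : ℝ, 0 ≤ A ∧ ∀ (V : ℝ × ℝ → ℝ), Measurable V → (∃ B : ℝ, ∀ᵐ x, |V x| ≤ B) →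
      ∀ (i : ℤ × annIdx) (W lam : ℝ), 0 ≤ W → 0 < lam →
      (∀ᵐ x ∂volume.restrict (dyadicSquare i), V x ≤ W) → ∃ K : ℕ,
      (K : ℝ) ≤ lam * (A * ((2 ^ i.1 : ℝ) ^ 2 * W)) ∧
      CodimLE (fun u => lam * ∫ x in dyadicSquare i, V x * ‖u x‖ ^ 2 ≤
        c * ∫ x in dyadicSquare i, (gradSq u x + ‖u x‖ ^ 2 / sqnorm x)) K := by
  obtain ⟨C, hC0, hC⟩ := card_modeSet_le one_pos
  refine ⟨(1 + 8 * C) / c, by positivity, fun V hVm ⟨B, hB⟩ i W lam hW hlam hVW => ?_⟩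
  have hh := two_zpow_pos i.1
  set h : ℝ := 2 ^ i.1 with hhdef
  have hVle : ∀ u, IsTestFun u → lam * ∫ x in dyadicSquare i, V x * ‖u x‖ ^ 2 ≤
      lam * (W * ∫ x in dyadicSquare i, ‖u x‖ ^ 2) := by
    intro u hu
    have huc := hu.contDiff_one.continuous
    have hI : IntegrableOn (fun x => ‖u x‖ ^ 2) (dyadicSquare i) :=
      Continuous.integrableOn_square (by fun_prop) _ _
    refine mul_le_mul_of_nonneg_left ?_ hlam.le
    rw [← integral_const_mul]
    refine integral_mono_ae (integrableOn_weight_mul hVm (ae_restrict_of_ae hB) hI)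
      (hI.const_mul _) ?_
    filter_upwards [hVW] with x hx
    gcongr
  have hsplit : ∀ u, IsTestFun u →
      ∫ x in dyadicSquare i, (gradSq u x + ‖u x‖ ^ 2 / sqnorm x) =
        (∫ x in dyadicSquare i, gradSq u x) + ∫ x in dyadicSquare i, ‖u x‖ ^ 2 / sqnorm x :=
    fun u hu => integral_add hu.integrable_gradSq.integrableOn hu.integrable_sq_div.integrableOn
  have hG0 : ∀ u, 0 ≤ ∫ x in dyadicSquare i, gradSq u x := fun u =>
    integral_nonneg fun x => gradSq_nonneg u x
  have hS0 : ∀ u : ℝ × ℝ → ℂ, 0 ≤ ∫ x in dyadicSquare i, ‖u x‖ ^ 2 / sqnorm x := fun u =>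
    integral_nonneg fun x => div_nonneg (by positivity) (sqnorm_nonneg x)
  rcases le_or_gt (8 * (lam * W * h ^ 2)) c with hle | hgt
  · refine ⟨0, by push_cast; positivity, CodimLE.of_forall (fun u hu => ?_) 0⟩
    refine (hVle u hu).trans ?_
    rw [hsplit u hu]
    have huc := hu.contDiff_one.continuous
    have h1 : ∫ x in dyadicSquare i, ‖u x‖ ^ 2 ≤
        8 * h ^ 2 * ∫ x in dyadicSquare i, ‖u x‖ ^ 2 / sqnorm x := by
      rw [← integral_const_mul]
      refine integral_mono_ae (Continuous.integrableOn_square (by fun_prop) _ _)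
        (hu.integrable_sq_div.integrableOn.const_mul _) ?_
      refine (ae_restrict_iff' (measurableSet_dyadicSquare i)).2 (ae_of_all _ fun x hx => ?_)
      have h2 := sqnorm_le_of_mem hx
      have h3 : 0 < sqnorm x := lt_of_lt_of_le (by positivity) (le_sqnorm_of_mem hx)
      simp only
      rw [mul_div_assoc', le_div_iff₀ h3, mul_comm]
      gcongr
    have h2 := mul_le_mul_of_nonneg_left h1 (mul_nonneg hlam.le hW)
    have h3 := mul_le_mul_of_nonneg_right hle (hS0 u)
    have h4 := mul_nonneg hc.le (hG0 u)
    linarith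
  · refine ⟨_, ?_, (codimLE_square_gap (dyadicCorner i) hh (μ := lam * W / c)
      (by positivity)).mono (fun u hu hu2 => ?_) le_rfl⟩
    · refine (hC _).trans ?_
      have h0 : 0 ≤ lam * W / c * h ^ 2 := by positivity
      rw [max_eq_left h0]
      have h1 : (1 + 1) * (lam * W / c * h ^ 2) / (4 * Real.pi) ≤ lam * W / c * h ^ 2 := by
        rw [div_le_iff₀ (by positivity)]
        nlinarith [Real.pi_gt_three]
      have h2 : C ≤ 8 * C * (lam * W / c * h ^ 2) := by
        have : 1 ≤ 8 * (lam * W / c * h ^ 2) := by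
          rw [div_mul_eq_mul_div, mul_div_assoc', le_div_iff₀ hc]
          linarith
        nlinarith
      have h3 : lam * ((1 + 8 * C) / c * (h ^ 2 * W)) =
          lam * W / c * h ^ 2 + 8 * C * (lam * W / c * h ^ 2) := by
        field_simp
      linarith
    · refine (hVle u hu).trans ?_
      rw [hsplit u hu, dyadicSquare_eq, ← hhdef]
      have h1 := mul_le_mul_of_nonneg_left hu2 hc.le
      have h2 : c * (lam * W / c * ∫ x in square (dyadicCorner i) h, ‖u x‖ ^ 2) =
          lam * (W * ∫ x in square (dyadicCorner i) h, ‖u x‖ ^ 2) := by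
        field_simp
      have h3 := mul_nonneg hc.le (hS0 u)
      rw [dyadicSquare_eq, ← hhdef] at h3
      linarith

theorem exists_magEnergy_lower {Φ : ℝ} (hΦ : ∀ k : ℤ, Φ ≠ k) :
    ∃ c : ℝ, 0 < c ∧ ∀ u, IsTestFun u →
      c * ∫ x, (gradSq u x + ‖u x‖ ^ 2 / sqnorm x) ≤ magEnergy Φ u := by
  obtain ⟨δ, hδ, hδΦ⟩ := exists_dist_int_pos hΦ
  refine ⟨(2 + (4 * Φ ^ 2 + 1) / δ ^ 2)⁻¹, by positivity, fun u hu => ?_⟩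
  rw [inv_mul_le_iff₀ (by positivity),
    integral_add hu.integrable_gradSq hu.integrable_sq_div]
  have h1 := hardy hδ.le hδΦ hu
  have h2 : (1 - 1 / 2) * (∫ x, gradSq u x) ≤
      magEnergy Φ u + Φ ^ 2 / (1 / 2) * ∫ x, ‖u x‖ ^ 2 / sqnorm x := by
    have e : magEnergy Φ u = ∫ x, magDensity Φ u x := rfl
    rw [e, ← integral_const_mul, ← integral_const_mul,
      ← integral_add (hu.integrable_magDensity Φ) (hu.integrable_sq_div.const_mul _)]
    exact integral_mono (hu.integrable_gradSq.const_mul _)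
      ((hu.integrable_magDensity Φ).add (hu.integrable_sq_div.const_mul _))
      fun x => gradSq_le Φ u (by norm_num) (by norm_num) x
  set S := ∫ x, ‖u x‖ ^ 2 / sqnorm x
  have h3 : S ≤ magEnergy Φ u / δ ^ 2 := by
    rw [le_div_iff₀ (by positivity)]; linarith
  have h4 : (4 * Φ ^ 2 + 1) * S ≤ (4 * Φ ^ 2 + 1) * (magEnergy Φ u / δ ^ 2) := by gcongr
  have h5 : (2 + (4 * Φ ^ 2 + 1) / δ ^ 2) * magEnergy Φ u =
      2 * magEnergy Φ u + (4 * Φ ^ 2 + 1) * (magEnergy Φ u / δ ^ 2) := by ring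
  linarith

theorem exists_finset_dyadic_split {f : ℤ × annIdx → ℝ} (hf : Summable f) {η : ℝ} (hη : 0 < η) :
    ∃ F : Finset (ℤ × annIdx), ∀ ε : ℝ, 0 ≤ ε → ∀ g : ℤ × annIdx → ℝ, (∀ i, 0 ≤ g i) →
      Summable g → ∃ k : ℤ × annIdx → ℝ, Summable k ∧ (∀ i ∈ F, k i = g i + ε) ∧
        (∀ i ∉ F, k i = f i) ∧ ∑' i, k i ≤ (∑' i, g i) + F.card * ε + η := by
  classical
  obtain ⟨F, hF⟩ := ((tendsto_tsum_compl_atTop_zero f).eventually (gt_mem_nhds hη)).exists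
  refine ⟨F, fun ε hε g hg hgs => ?_⟩
  have h1 : HasSum (fun i => if i ∈ F then g i + ε else 0) (∑ i ∈ F, (g i + ε)) := by
    have := hasSum_sum_of_ne_finset_zero (L := .unconditional _) (s := F)
      (f := fun i => if i ∈ F then g i + ε else 0)
      fun i hi => if_neg hi
    rwa [Finset.sum_congr rfl fun i hi => if_pos hi] at this
  have h2 : Summable ({i | i ∉ F}.indicator f) := hf.indicator _
  refine ⟨fun i => (if i ∈ F then g i + ε else 0) + {i | i ∉ F}.indicator f i,
    h1.summable.add h2, fun i hi => ?_, fun i hi => ?_, ?_⟩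
  · simp [hi]
  · simp [hi]
  · rw [h1.summable.tsum_add h2, h1.tsum_eq, Finset.sum_add_distrib, Finset.sum_const,
      nsmul_eq_mul, ← tsum_subtype]
    have h3 := hgs.sum_le_tsum F fun i _ => hg i
    have h4 : ∑' i : {i | i ∉ F}, f i < η := hF
    linarith

theorem codimLE_upper {Φ : ℝ} (hΦ : ∀ k : ℤ, Φ ≠ k) {V : ℝ × ℝ → ℝ} (hVm : Measurable V) {B : ℝ}
    (hB0 : 0 ≤ B) (hB : ∀ᵐ x, |V x| ≤ B) {W : ℤ → ℝ} (hW : ∀ n, 0 ≤ W n)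
    (hWs : Summable (fun n => (2 ^ n : ℝ) ^ 2 * W n))
    (hVW : ∀ᵐ x, ∀ i, x ∈ dyadicSquare i → V x ≤ W i.1) {a : ℝ}
    (ha : (∫ x, max (V x) 0) / (4 * Real.pi) < a) :
    ∃ L : ℝ, ∀ lam : ℝ, L ≤ lam → ∃ K : ℕ, (K : ℝ) ≤ lam * a ∧
      CodimLE (fun u => ∫ x, lam * V x * ‖u x‖ ^ 2 ≤ magEnergy Φ u) K := by
  have hVp := integrable_posPart hVm hW hWs hVW
  have hsum := hasSum_integral_dyadicSquare hVp
  set I := ∫ x, max (V x) 0 with hI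
  obtain ⟨θ, hθ, hθ0, hθ1⟩ : ∃ θ : ℝ, ((1 - θ) ^ 2)⁻¹ * I / (4 * Real.pi) < a ∧ 0 < θ ∧ θ < 1 := by
    have hcont : ContinuousAt (fun θ : ℝ => ((1 - θ) ^ 2)⁻¹ * I / (4 * Real.pi)) 0 :=
      ((ContinuousAt.inv₀ (by fun_prop) (by norm_num)).mul continuousAt_const).div_const _
    have h1 := hcont.eventually_lt (g := fun _ => a) continuousAt_const (by simpa using ha)
    exact ((h1.filter_mono nhdsWithin_le_nhds).and
      (Ioo_mem_nhdsGT (one_pos : (0 : ℝ) < 1))).exists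
  obtain ⟨c, hc, hcE⟩ := exists_magEnergy_lower hΦ
  obtain ⟨A, hA, hout⟩ := codimLE_dyadic_outer (mul_pos hθ0 hc)
  set γ := a - ((1 - θ) ^ 2)⁻¹ * I / (4 * Real.pi) with hγ
  have hγ0 : 0 < γ := by linarith
  obtain ⟨F, hF⟩ := exists_finset_dyadic_split ((summable_dyadic hWs).mul_left A) (half_pos hγ0)
  set ε := γ / 2 / (F.card + 1) with hε
  have hε0 : 0 < ε := by positivity
  have hFε : F.card * ε ≤ γ / 2 := by
    rw [hε, mul_div_assoc', div_le_iff₀ (by positivity)]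
    nlinarith
  have hgsum : HasSum (fun i => ((1 - θ) ^ 2)⁻¹ * (∫ x in dyadicSquare i, max (V x) 0) /
      (4 * Real.pi)) (((1 - θ) ^ 2)⁻¹ * I / (4 * Real.pi)) := (hsum.mul_left _).div_const _
  have hg0 : ∀ i, 0 ≤ ((1 - θ) ^ 2)⁻¹ * (∫ x in dyadicSquare i, max (V x) 0) /
      (4 * Real.pi) := fun i => by
    have : 0 ≤ ∫ x in dyadicSquare i, max (V x) 0 := integral_nonneg fun x => le_max_right _ _
    positivity
  obtain ⟨k, hk, hkF, hkF', hktot⟩ := hF ε hε0.le _ hg0 hgsum.summable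
  have hk0 : ∀ i, 0 ≤ k i := fun i => by
    by_cases hi : i ∈ F
    · rw [hkF i hi]; exact add_nonneg (hg0 i) hε0.le
    · rw [hkF' i hi]; exact mul_nonneg hA (mul_nonneg (by positivity) (hW _))
  have hmid : ∀ i : ℤ × annIdx, ∃ L : ℝ, ∀ lam : ℝ, L ≤ lam → ∃ K : ℕ,
      (K : ℝ) ≤ lam * (((1 - θ) ^ 2)⁻¹ * (∫ x in dyadicSquare i, max (V x) 0) /
        (4 * Real.pi) + ε) ∧
      CodimLE (fun u => lam * ∫ x in dyadicSquare i, V x * ‖u x‖ ^ 2 ≤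
        (1 - θ) * ∫ x in dyadicSquare i, magDensity Φ u x) K := fun i =>
    codimLE_square_mag hVm hB0 hB Φ (dyadicCorner i) (two_zpow_pos i.1) (two_zpow_pos i.1)
      (fun x hx => le_sqnorm_of_mem hx) hθ0 hθ1 hε0
  choose Λ hΛ using hmid
  obtain ⟨L, hL⟩ := (F.image Λ).exists_le
  refine ⟨max L 1, fun lam hlam => ?_⟩
  have hlam0 : 0 < lam := one_pos.trans_le ((le_max_right _ _).trans hlam)
  have hm0 : ∀ (u : ℝ × ℝ → ℂ) (i : ℤ × annIdx), 0 ≤ ∫ x in dyadicSquare i, magDensity Φ u x :=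
    fun u i => integral_nonneg fun x => magDensity_nonneg Φ u x
  have hs0 : ∀ (u : ℝ × ℝ → ℂ) (i : ℤ × annIdx),
      0 ≤ ∫ x in dyadicSquare i, (gradSq u x + ‖u x‖ ^ 2 / sqnorm x) :=
    fun u i => integral_nonneg fun x =>
      add_nonneg (gradSq_nonneg u x) (div_nonneg (by positivity) (sqnorm_nonneg x))
  have hcell : ∀ i, ∃ K : ℕ, (K : ℝ) ≤ lam * k i ∧
      CodimLE (fun u => lam * ∫ x in dyadicSquare i, V x * ‖u x‖ ^ 2 ≤
        (1 - θ) * (∫ x in dyadicSquare i, magDensity Φ u x) +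
          θ * c * ∫ x in dyadicSquare i, (gradSq u x + ‖u x‖ ^ 2 / sqnorm x)) K := by
    intro i
    by_cases hi : i ∈ F
    · obtain ⟨K, hK, hKc⟩ := hΛ i lam ((hL _ (Finset.mem_image_of_mem _ hi)).trans
        ((le_max_left _ _).trans hlam))
      refine ⟨K, by rwa [hkF i hi], hKc.mono (fun u _ h => h.trans ?_) le_rfl⟩
      exact le_add_of_nonneg_right (mul_nonneg (by positivity) (hs0 u i))
    · obtain ⟨K, hK, hKc⟩ := hout V hVm ⟨B, hB⟩ i (W i.1) lam (hW _) hlam0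
        ((ae_restrict_iff' (measurableSet_dyadicSquare i)).2 (by
          filter_upwards [hVW] with x hx using hx i))
      refine ⟨K, by rwa [hkF' i hi], hKc.mono (fun u _ h => h.trans ?_) le_rfl⟩
      exact le_add_of_nonneg_left (mul_nonneg (by linarith) (hm0 u i))
  obtain ⟨K, hK, hKc⟩ := CodimLE.countable (hk.mul_left lam)
    (fun i => mul_nonneg hlam0.le (hk0 i)) hcell
  refine ⟨K, hK.trans ?_, hKc.mono (fun u hu h => ?_) le_rfl⟩
  · rw [tsum_mul_left, hgsum.tsum_eq] at *
    gcongr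
    linarith
  · have huc := hu.1.continuous
    have hUI : Integrable fun x => ‖u x‖ ^ 2 := by
      refine Continuous.integrable_of_hasCompactSupport (by fun_prop) ?_
      exact HasCompactSupport.intro hu.2.1 fun x hx => by
        simp [image_eq_zero_of_notMem_tsupport hx]
    have hVI : Integrable fun x => V x * ‖u x‖ ^ 2 := hUI.bdd_mul hVm.aestronglyMeasurable hB
    have h1 := (hasSum_integral_dyadicSquare hVI).mul_left lam
    have h2 := ((hasSum_integral_dyadicSquare (hu.integrable_magDensity Φ)).mul_left (1 - θ)).add
      ((hasSum_integral_dyadicSquare (hu.integrable_gradSq.add hu.integrable_sq_div)).mul_left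
        (θ * c))
    have h3 := hasSum_le h h1 h2
    have h4 := mul_le_mul_of_nonneg_left (hcE u hu) hθ0.le
    have e : magEnergy Φ u = ∫ x, magDensity Φ u x := rfl
    simp only [mul_assoc, integral_const_mul]
    simp only [Pi.add_apply] at h3
    rw [← e] at h3
    linarith

/-- A smooth step equal to `0` on `(-∞, 1]` and to `1` on `[2, ∞)`. -/
noncomputable def smoothStep (t : ℝ) : ℝ := Real.smoothTransition (t - 1)

theorem contDiff_smoothStep : ContDiff ℝ (⊤ : ℕ∞) smoothStep :=
  Real.smoothTransition.contDiff.comp (contDiff_id.sub contDiff_const)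

theorem smoothStep_of_le {t : ℝ} (ht : t ≤ 1) : smoothStep t = 0 :=
  Real.smoothTransition.zero_of_nonpos (by linarith)

theorem smoothStep_of_ge {t : ℝ} (ht : 2 ≤ t) : smoothStep t = 1 :=
  Real.smoothTransition.one_of_one_le (by linarith)

theorem abs_smoothStep_le (t : ℝ) : |smoothStep t| ≤ 1 := by
  rw [smoothStep, abs_of_nonneg (Real.smoothTransition.nonneg _)]
  exact Real.smoothTransition.le_one _

theorem hasDerivAt_smoothStep (t : ℝ) : HasDerivAt smoothStep (deriv smoothStep t) t :=
  (contDiff_smoothStep.differentiable (by simp)).differentiableAt.hasDerivAt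

theorem continuous_deriv_smoothStep : Continuous (deriv smoothStep) :=
  contDiff_smoothStep.continuous_deriv (by simp)

theorem deriv_smoothStep_of_lt {t : ℝ} (ht : t < 1) : deriv smoothStep t = 0 := by
  have : smoothStep =ᶠ[nhds t] fun _ => 0 := by
    filter_upwards [gt_mem_nhds ht] with s hs using smoothStep_of_le (le_of_lt hs)
  rw [this.deriv_eq, deriv_const]

theorem deriv_smoothStep_of_gt {t : ℝ} (ht : 2 < t) : deriv smoothStep t = 0 := by
  have : smoothStep =ᶠ[nhds t] fun _ => 1 := by
    filter_upwards [lt_mem_nhds ht] with s hs using smoothStep_of_ge (le_of_lt hs)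
  rw [this.deriv_eq, deriv_const]

theorem exists_deriv_smoothStep_bound : ∃ C : ℝ, 0 ≤ C ∧ ∀ t, |deriv smoothStep t| * |t| ≤ C := by
  have hc : Continuous fun t => deriv smoothStep t * t :=
    continuous_deriv_smoothStep.mul continuous_id
  obtain ⟨C, hC⟩ := hc.bounded_above_of_compact_support
    (HasCompactSupport.intro (isCompact_Icc (a := (1 : ℝ)) (b := 2)) fun t ht => by
      rw [Set.mem_Icc, not_and_or, not_le, not_le] at ht
      rcases ht with h | h
      · rw [deriv_smoothStep_of_lt h, zero_mul]
      · rw [deriv_smoothStep_of_gt h, zero_mul])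
  refine ⟨C, (norm_nonneg _).trans (hC 0), fun t => ?_⟩
  simpa [abs_mul] using hC t

/-- A cutoff function compactly supported in `(0, 1)`. -/
noncomputable def cutoff (n : ℕ) (x : ℝ) : ℝ := smoothStep (n * x) * smoothStep (n * (1 - x))

/-- The sine mode with a cutoff near the end points of the unit interval. -/
noncomputable def cutSin (n k : ℕ) (x : ℝ) : ℝ := cutoff n x * Real.sin (Real.pi * k * x)

/-- The derivative of `cutSin`. -/
noncomputable def cutSinDeriv (n k : ℕ) (x : ℝ) : ℝ :=
  (deriv smoothStep (n * x) * n * smoothStep (n * (1 - x)) -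
    smoothStep (n * x) * (deriv smoothStep (n * (1 - x)) * n)) * Real.sin (Real.pi * k * x) +
  cutoff n x * (Real.cos (Real.pi * k * x) * (Real.pi * k))

theorem contDiff_cutSin (n k : ℕ) : ContDiff ℝ (⊤ : ℕ∞) (cutSin n k) := by
  have h1 : ContDiff ℝ (⊤ : ℕ∞) fun x : ℝ => smoothStep (n * x) :=
    contDiff_smoothStep.comp (contDiff_const.mul contDiff_id)
  have h2 : ContDiff ℝ (⊤ : ℕ∞) fun x : ℝ => smoothStep (n * (1 - x)) :=
    contDiff_smoothStep.comp (contDiff_const.mul (contDiff_const.sub contDiff_id))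
  have h3 : ContDiff ℝ (⊤ : ℕ∞) fun x : ℝ => Real.sin (Real.pi * k * x) :=
    Real.contDiff_sin.comp (contDiff_const.mul contDiff_id)
  exact (h1.mul h2).mul h3

theorem hasDerivAt_cutSin (n k : ℕ) (x : ℝ) : HasDerivAt (cutSin n k) (cutSinDeriv n k x) x := by
  have h1 : HasDerivAt (fun x : ℝ => smoothStep (n * x)) (deriv smoothStep (n * x) * n) x := by
    have := (hasDerivAt_smoothStep (n * x)).comp x ((hasDerivAt_id x).const_mul (n : ℝ))
    simpa [Function.comp_def] using this
  have h2 : HasDerivAt (fun x : ℝ => smoothStep (n * (1 - x)))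
      (-(deriv smoothStep (n * (1 - x)) * n)) x := by
    have := (hasDerivAt_smoothStep (n * (1 - x))).comp x
      (((hasDerivAt_id x).const_sub 1).const_mul (n : ℝ))
    simpa [Function.comp_def] using this
  have h3 : HasDerivAt (fun x : ℝ => Real.sin (Real.pi * k * x))
      (Real.cos (Real.pi * k * x) * (Real.pi * k)) x := by
    have := ((hasDerivAt_id x).const_mul (Real.pi * k)).sin
    simpa using this
  refine ((h1.mul h2).mul h3).congr_deriv ?_
  simp only [cutSinDeriv, cutoff, Pi.mul_apply]
  ring

theorem continuous_cutSinDeriv (n k : ℕ) : Continuous (cutSinDeriv n k) := by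
  have h : deriv (cutSin n k) = cutSinDeriv n k := funext fun x => (hasDerivAt_cutSin n k x).deriv
  rw [← h]
  exact (contDiff_cutSin n k).continuous_deriv (by simp)

theorem abs_cutoff_le (n : ℕ) (x : ℝ) : |cutoff n x| ≤ 1 := by
  rw [cutoff, abs_mul]
  exact mul_le_one₀ (abs_smoothStep_le _) (abs_nonneg _) (abs_smoothStep_le _)

theorem abs_cutSin_le (n k : ℕ) (x : ℝ) : |cutSin n k x| ≤ 1 := by
  rw [cutSin, abs_mul]
  exact mul_le_one₀ (abs_cutoff_le n x) (abs_nonneg _) (Real.abs_sin_le_one _)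

theorem exists_cutSinDeriv_bound (k : ℕ) : ∃ C : ℝ, ∀ n x, |cutSinDeriv n k x| ≤ C := by
  obtain ⟨C, hC0, hC⟩ := exists_deriv_smoothStep_bound
  refine ⟨Real.pi * k * C + Real.pi * k * C + Real.pi * k, fun n x => ?_⟩
  have hk : 0 ≤ Real.pi * k := by positivity
  have hs1 : |Real.sin (Real.pi * k * x)| ≤ Real.pi * k * |x| := by
    refine Real.abs_sin_le_abs.trans ?_
    rw [abs_mul, abs_of_nonneg hk]
  have hs2 : |Real.sin (Real.pi * k * x)| ≤ Real.pi * k * |1 - x| := by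
    have : |Real.sin (Real.pi * k * x)| = |Real.sin (Real.pi * k * (1 - x))| := by
      have e : Real.pi * k * (1 - x) = k * Real.pi - Real.pi * k * x := by ring
      rw [e, Real.sin_sub, Real.sin_nat_mul_pi, zero_mul, zero_sub, abs_neg, abs_mul,
        Real.abs_cos_eq_sqrt_one_sub_sin_sq, Real.sin_nat_mul_pi]
      simp
    rw [this]
    refine Real.abs_sin_le_abs.trans ?_
    rw [abs_mul, abs_of_nonneg hk]
  have key : ∀ t y s σ : ℝ, |σ| ≤ Real.pi * k * |y| → t = n * y → |s| ≤ 1 →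
      |deriv smoothStep t * n * s * σ| ≤ Real.pi * k * C := by
    intro t y s σ hσ ht hs
    have h1 := hC t
    rw [ht, abs_mul, Nat.abs_cast] at h1
    rw [abs_mul, abs_mul, abs_mul, Nat.abs_cast, ht]
    calc |deriv smoothStep (n * y)| * n * |s| * |σ|
        ≤ |deriv smoothStep (n * y)| * n * 1 * (Real.pi * k * |y|) := by gcongr
      _ = Real.pi * k * (|deriv smoothStep (n * y)| * (n * |y|)) := by ring
      _ ≤ Real.pi * k * C := by gcongr
  have h1 := key (n * x) x (smoothStep (n * (1 - x))) _ hs1 rfl (abs_smoothStep_le _)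
  have h2 := key (n * (1 - x)) (1 - x) (smoothStep (n * x)) _ hs2 rfl (abs_smoothStep_le _)
  have h3 : |cutoff n x * (Real.cos (Real.pi * k * x) * (Real.pi * k))| ≤ Real.pi * k := by
    rw [abs_mul, abs_mul, abs_of_nonneg hk]
    calc _ ≤ 1 * (1 * (Real.pi * k)) := by
          gcongr
          · exact abs_cutoff_le n x
          · exact Real.abs_cos_le_one _
      _ = _ := by ring
  rw [cutSinDeriv, show ∀ a b c s : ℝ, (a - b) * s + c = a * s - b * s + c from
    fun a b c s => by ring]
  refine (abs_add_le _ _).trans (add_le_add ((abs_sub _ _).trans (add_le_add h1 ?_)) h3)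
  refine le_trans (le_of_eq ?_) h2
  congr 1
  ring

theorem eventually_two_lt_mul {y : ℝ} (hy : 0 < y) : ∀ᶠ n : ℕ in Filter.atTop, 2 < (n : ℝ) * y :=
  (tendsto_natCast_atTop_atTop.atTop_mul_const hy).eventually_gt_atTop 2

theorem eventually_cutoff_eq {x : ℝ} (hx : 0 < x) (hx1 : x < 1) :
    ∀ᶠ n : ℕ in Filter.atTop, ∀ k, cutSin n k x = Real.sin (Real.pi * k * x) ∧
      cutSinDeriv n k x = Real.cos (Real.pi * k * x) * (Real.pi * k) := by
  filter_upwards [eventually_two_lt_mul hx, eventually_two_lt_mul (sub_pos.2 hx1)] with n h1 h2 k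
  simp [cutSin, cutSinDeriv, cutoff, smoothStep_of_ge h1.le, smoothStep_of_ge h2.le,
    deriv_smoothStep_of_gt h1, deriv_smoothStep_of_gt h2]

theorem integral_cos_int (m : ℤ) :
    ∫ x in (0 : ℝ)..1, Real.cos (Real.pi * m * x) = if m = 0 then 1 else 0 := by
  split_ifs with h
  · simp [h]
  · have hm : Real.pi * m ≠ 0 := mul_ne_zero Real.pi_ne_zero (by exact_mod_cast h)
    rw [intervalIntegral.integral_comp_mul_left (fun x => Real.cos x) hm, integral_cos]
    simp [mul_comm Real.pi, Real.sin_int_mul_pi]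

theorem integral_sin_mul_sin {k l : ℕ} (hk : 0 < k) :
    ∫ x in (0 : ℝ)..1, Real.sin (Real.pi * k * x) * Real.sin (Real.pi * l * x) =
      if k = l then 1 / 2 else 0 := by
  have e : ∀ x : ℝ, Real.sin (Real.pi * k * x) * Real.sin (Real.pi * l * x) =
      1 / 2 * Real.cos (Real.pi * ((k - l : ℤ) : ℝ) * x) -
        1 / 2 * Real.cos (Real.pi * ((k + l : ℤ) : ℝ) * x) := by
    intro x
    have e1 : Real.pi * ((k - l : ℤ) : ℝ) * x = Real.pi * k * x - Real.pi * l * x := by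
      push_cast; ring
    have e2 : Real.pi * ((k + l : ℤ) : ℝ) * x = Real.pi * k * x + Real.pi * l * x := by
      push_cast; ring
    rw [e1, e2, Real.cos_sub, Real.cos_add]
    ring
  simp only [e]
  rw [intervalIntegral.integral_sub (Continuous.intervalIntegrable (by fun_prop) _ _)
    (Continuous.intervalIntegrable (by fun_prop) _ _), intervalIntegral.integral_const_mul,
    intervalIntegral.integral_const_mul, integral_cos_int, integral_cos_int,
    if_neg (by omega : ¬((k : ℤ) + l = 0))]
  by_cases h : k = l
  · simp [h]
  · rw [if_neg (by omega), if_neg h]; simp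

theorem integral_cos_mul_cos {k l : ℕ} (hk : 0 < k) :
    ∫ x in (0 : ℝ)..1, Real.cos (Real.pi * k * x) * (Real.pi * k) *
      (Real.cos (Real.pi * l * x) * (Real.pi * l)) =
        if k = l then (Real.pi * k) ^ 2 / 2 else 0 := by
  have e : ∀ x : ℝ, Real.cos (Real.pi * k * x) * (Real.pi * k) *
      (Real.cos (Real.pi * l * x) * (Real.pi * l)) =
      (Real.pi * k) * (Real.pi * l) / 2 * Real.cos (Real.pi * ((k - l : ℤ) : ℝ) * x) +
        (Real.pi * k) * (Real.pi * l) / 2 * Real.cos (Real.pi * ((k + l : ℤ) : ℝ) * x) := by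
    intro x
    have e1 : Real.pi * ((k - l : ℤ) : ℝ) * x = Real.pi * k * x - Real.pi * l * x := by
      push_cast; ring
    have e2 : Real.pi * ((k + l : ℤ) : ℝ) * x = Real.pi * k * x + Real.pi * l * x := by
      push_cast; ring
    rw [e1, e2, Real.cos_sub, Real.cos_add]
    ring
  simp only [e]
  rw [intervalIntegral.integral_add (Continuous.intervalIntegrable (by fun_prop) _ _)
    (Continuous.intervalIntegrable (by fun_prop) _ _), intervalIntegral.integral_const_mul,
    intervalIntegral.integral_const_mul, integral_cos_int, integral_cos_int,
    if_neg (by omega : ¬((k : ℤ) + l = 0))]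
  by_cases h : k = l
  · simp [h]; ring
  · rw [if_neg (by omega), if_neg h]; simp

theorem tendsto_integral_cutSin {k l : ℕ} (hk : 0 < k) :
    Filter.Tendsto (fun n => ∫ x in Set.Ioc (0 : ℝ) 1, cutSin n k x * cutSin n l x) Filter.atTop
      (nhds (if k = l then 1 / 2 else 0)) := by
  rw [← integral_sin_mul_sin hk, intervalIntegral.integral_of_le zero_le_one,
    integral_Ioc_eq_integral_Ioo]
  simp only [integral_Ioc_eq_integral_Ioo]
  refine tendsto_integral_of_dominated_convergence (fun _ => 1) (fun n => ?_)
    (integrableOn_const (by simp)) (fun n => ae_of_all _ fun x => ?_) ?_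
  · exact ((contDiff_cutSin n k).continuous.mul
      (contDiff_cutSin n l).continuous).aestronglyMeasurable
  · rw [Real.norm_eq_abs, abs_mul]
    exact mul_le_one₀ (abs_cutSin_le n k x) (abs_nonneg _) (abs_cutSin_le n l x)
  · refine (ae_restrict_iff' measurableSet_Ioo).2 (ae_of_all _ fun x hx => ?_)
    refine tendsto_const_nhds.congr' ?_
    filter_upwards [eventually_cutoff_eq hx.1 hx.2] with n hn
    rw [(hn k).1, (hn l).1]

theorem tendsto_integral_cutSinDeriv {k l : ℕ} (hk : 0 < k) :
    Filter.Tendsto (fun n => ∫ x in Set.Ioc (0 : ℝ) 1, cutSinDeriv n k x * cutSinDeriv n l x)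
      Filter.atTop (nhds (if k = l then (Real.pi * k) ^ 2 / 2 else 0)) := by
  rw [← integral_cos_mul_cos hk, intervalIntegral.integral_of_le zero_le_one,
    integral_Ioc_eq_integral_Ioo]
  simp only [integral_Ioc_eq_integral_Ioo]
  obtain ⟨C, hC⟩ := exists_cutSinDeriv_bound k
  obtain ⟨C', hC'⟩ := exists_cutSinDeriv_bound l
  refine tendsto_integral_of_dominated_convergence (fun _ => C * C') (fun n => ?_)
    (integrableOn_const (by simp)) (fun n => ae_of_all _ fun x => ?_) ?_
  · exact ((continuous_cutSinDeriv n k).mul (continuous_cutSinDeriv n l)).aestronglyMeasurable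
  · rw [Real.norm_eq_abs, abs_mul]
    exact mul_le_mul (hC n x) (hC' n x) (abs_nonneg _) ((abs_nonneg _).trans (hC n x))
  · refine (ae_restrict_iff' measurableSet_Ioo).2 (ae_of_all _ fun x hx => ?_)
    refine tendsto_const_nhds.congr' ?_
    filter_upwards [eventually_cutoff_eq hx.1 hx.2] with n hn
    rw [(hn k).2, (hn l).2]

theorem cutSin_eq_zero {n : ℕ} (hn : 0 < n) (k : ℕ) {x : ℝ}
    (hx : x ∉ Set.Icc (1 / (n : ℝ)) (1 - 1 / n)) : cutSin n k x = 0 := by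
  have hn' : (0 : ℝ) < n := by exact_mod_cast hn
  rw [Set.mem_Icc, not_and_or, not_le, not_le] at hx
  rcases hx with h | h
  · rw [lt_div_iff₀' hn'] at h
    simp [cutSin, cutoff, smoothStep_of_le h.le]
  · have h : 1 - x < 1 / n := by linarith
    rw [lt_div_iff₀' hn'] at h
    simp [cutSin, cutoff, smoothStep_of_le h.le]

theorem norm_sq_sum_mul_ofReal {ι : Type*} (F : Finset ι) (a : ι → ℂ) (t : ι → ℝ) :
    ‖∑ i ∈ F, a i * (t i : ℂ)‖ ^ 2 = ∑ i ∈ F, ∑ j ∈ F,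
      t i * t j * ((a i).re * (a j).re + (a i).im * (a j).im) := by
  rw [Complex.sq_norm, Complex.normSq_apply, Complex.re_sum, Complex.im_sum, Finset.sum_mul_sum,
    Finset.sum_mul_sum, ← Finset.sum_add_distrib]
  refine Finset.sum_congr rfl fun i _ => ?_
  rw [← Finset.sum_add_distrib]
  refine Finset.sum_congr rfl fun j _ => ?_
  simp only [Complex.mul_re, Complex.mul_im, Complex.ofReal_re, Complex.ofReal_im]
  ring

theorem eventually_le_quadForm {ι : Type*} [DecidableEq ι] (F : Finset ι) (M : ℕ → ι → ι → ℝ)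
    (m : ι → ℝ) {κ : ℝ} (hm : ∀ i ∈ F, κ < m i)
    (hM : ∀ i ∈ F, ∀ j ∈ F, Filter.Tendsto (fun n => M n i j) Filter.atTop
      (nhds (if i = j then m i else 0))) :
    ∀ᶠ n in Filter.atTop, ∀ α : ι → ℝ,
      κ * ∑ i ∈ F, α i ^ 2 ≤ ∑ i ∈ F, ∑ j ∈ F, M n i j * (α i * α j) := by
  obtain ⟨ε, hε, hε0⟩ : ∃ ε : ℝ, (∀ i ∈ F, ε * F.card ≤ m i - κ) ∧ 0 < ε := by
    have h : ∀ᶠ ε : ℝ in nhdsWithin 0 (Set.Ioi 0), ∀ i ∈ F, ε * F.card ≤ m i - κ := by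
      rw [Filter.eventually_all_finset]
      intro i hi
      have ht : Filter.Tendsto (fun ε : ℝ => ε * F.card) (nhds 0) (nhds 0) := by
        have : Continuous fun ε : ℝ => ε * F.card := by fun_prop
        simpa using this.tendsto 0
      exact (ht.mono_left nhdsWithin_le_nhds).eventually_le_const (sub_pos.2 (hm i hi))
    exact (h.and self_mem_nhdsWithin).exists
  have h : ∀ᶠ n in Filter.atTop, ∀ i ∈ F, ∀ j ∈ F, |M n i j - if i = j then m i else 0| < ε := by
    rw [Filter.eventually_all_finset]
    intro i hi
    rw [Filter.eventually_all_finset]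
    intro j hj
    exact Metric.tendsto_nhds.1 (hM i hi j hj) ε hε0
  filter_upwards [h] with n hn α
  have h1 : ∀ i ∈ F, ∀ j ∈ F, (if i = j then m i else 0) * (α i * α j) -
      ε / 2 * (α i ^ 2 + α j ^ 2) ≤ M n i j * (α i * α j) := by
    intro i hi j hj
    obtain ⟨h2, h3⟩ := abs_lt.1 (hn i hi j hj)
    nlinarith [mul_nonneg (by linarith : 0 ≤ ε + (M n i j - if i = j then m i else 0))
      (sq_nonneg (α i + α j)), mul_nonneg
      (by linarith : 0 ≤ ε - (M n i j - if i = j then m i else 0)) (sq_nonneg (α i - α j))]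
  have h2 : ∑ i ∈ F, ∑ j ∈ F, ((if i = j then m i else 0) * (α i * α j) -
      ε / 2 * (α i ^ 2 + α j ^ 2)) = ∑ i ∈ F, (m i - ε * F.card) * α i ^ 2 := by
    have e : ∀ i ∈ F, ∑ j ∈ F, ((if i = j then m i else 0) * (α i * α j) -
        ε / 2 * (α i ^ 2 + α j ^ 2)) =
        m i * α i ^ 2 - ε / 2 * (F.card * α i ^ 2 + ∑ j ∈ F, α j ^ 2) := by
      intro i hi
      rw [Finset.sum_sub_distrib, ← Finset.mul_sum, Finset.sum_add_distrib, Finset.sum_const,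
        nsmul_eq_mul]
      simp only [ite_mul, zero_mul]
      rw [Finset.sum_ite_eq, if_pos hi]
      ring
    rw [Finset.sum_congr rfl e, Finset.sum_sub_distrib, ← Finset.mul_sum, Finset.sum_add_distrib,
      Finset.sum_const, nsmul_eq_mul, ← Finset.mul_sum]
    simp only [sub_mul]
    rw [Finset.sum_sub_distrib, ← Finset.mul_sum]
    ring
  calc κ * ∑ i ∈ F, α i ^ 2 ≤ ∑ i ∈ F, (m i - ε * F.card) * α i ^ 2 := by
        rw [Finset.mul_sum]
        exact Finset.sum_le_sum fun i hi =>
          mul_le_mul_of_nonneg_right (by linarith [hε i hi]) (sq_nonneg _)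
    _ ≤ _ := by
        rw [← h2]
        exact Finset.sum_le_sum fun i hi => Finset.sum_le_sum fun j hj => h1 i hi j hj

theorem eventually_le_quadForm_complex {ι : Type*} [DecidableEq ι] (F : Finset ι)
    (M : ℕ → ι → ι → ℝ) (m : ι → ℝ) {κ : ℝ} (hm : ∀ i ∈ F, κ < m i)
    (hM : ∀ i ∈ F, ∀ j ∈ F, Filter.Tendsto (fun n => M n i j) Filter.atTop
      (nhds (if i = j then m i else 0))) :
    ∀ᶠ n in Filter.atTop, ∀ a : ι → ℂ, κ * ∑ i ∈ F, ‖a i‖ ^ 2 ≤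
      ∑ i ∈ F, ∑ j ∈ F, M n i j * ((a i).re * (a j).re + (a i).im * (a j).im) := by
  filter_upwards [eventually_le_quadForm F M m hm hM] with n hn a
  have h := add_le_add (hn fun i => (a i).re) (hn fun i => (a i).im)
  rw [← mul_add, ← Finset.sum_add_distrib, ← Finset.sum_add_distrib] at h
  simp only [← Finset.sum_add_distrib, ← mul_add] at h
  simpa only [Complex.sq_norm, Complex.normSq_apply, ← sq] using h

/-- A linear combination of products of cut-off sine modes. -/
noncomputable def trial (n : ℕ) (F : Finset (ℕ × ℕ)) (a : ℕ × ℕ → ℂ) (x : ℝ × ℝ) : ℂ :=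
  ∑ k ∈ F, a k * ((cutSin n k.1 x.1 * cutSin n k.2 x.2 : ℝ) : ℂ)

theorem contDiff_trial (n : ℕ) (F : Finset (ℕ × ℕ)) (a : ℕ × ℕ → ℂ) :
    ContDiff ℝ (⊤ : ℕ∞) (trial n F a) := by
  refine ContDiff.sum fun k _ => contDiff_const.mul (Complex.ofRealCLM.contDiff.comp ?_)
  exact ((contDiff_cutSin n k.1).comp contDiff_fst).mul ((contDiff_cutSin n k.2).comp contDiff_snd)

theorem trial_eq_zero {n : ℕ} (hn : 0 < n) (F : Finset (ℕ × ℕ)) (a : ℕ × ℕ → ℂ) {x : ℝ × ℝ}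
    (hx : x ∉ Set.Icc (1 / (n : ℝ)) (1 - 1 / n) ×ˢ Set.Icc (1 / (n : ℝ)) (1 - 1 / n)) :
    trial n F a x = 0 := by
  refine Finset.sum_eq_zero fun k _ => ?_
  rw [Set.mem_prod, not_and_or] at hx
  rcases hx with h | h
  · simp [cutSin_eq_zero hn k.1 h]
  · simp [cutSin_eq_zero hn k.2 h]

theorem fderiv_trial (n : ℕ) (F : Finset (ℕ × ℕ)) (a : ℕ × ℕ → ℂ) (x v : ℝ × ℝ) :
    fderiv ℝ (trial n F a) x v = ∑ k ∈ F, a k *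
      ((cutSinDeriv n k.1 x.1 * v.1 * cutSin n k.2 x.2 +
        cutSin n k.1 x.1 * (cutSinDeriv n k.2 x.2 * v.2) : ℝ) : ℂ) := by
  have h : HasFDerivAt (trial n F a) (∑ k ∈ F, a k • Complex.ofRealCLM.comp
      (cutSin n k.1 x.1 • cutSinDeriv n k.2 x.2 • ContinuousLinearMap.snd ℝ ℝ ℝ +
        cutSin n k.2 x.2 • cutSinDeriv n k.1 x.1 • ContinuousLinearMap.fst ℝ ℝ ℝ)) x := by
    refine HasFDerivAt.fun_sum fun k _ => HasFDerivAt.const_mul ?_ (a k)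
    refine Complex.ofRealCLM.hasFDerivAt.comp x ?_
    exact ((hasDerivAt_cutSin n k.1 x.1).comp_hasFDerivAt x hasFDerivAt_fst).mul
      ((hasDerivAt_cutSin n k.2 x.2).comp_hasFDerivAt x hasFDerivAt_snd)
  rw [h.fderiv]
  simp only [sum_apply]
  refine Finset.sum_congr rfl fun k _ => ?_
  simp
  ring

/-- The overlap integrals of the cut-off sine modes. -/
noncomputable def overlap (n k l : ℕ) : ℝ := ∫ x in Set.Ioc (0 : ℝ) 1, cutSin n k x * cutSin n l x

/-- The overlap integrals of the derivatives of the cut-off sine modes. -/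
noncomputable def overlapDeriv (n k l : ℕ) : ℝ :=
  ∫ x in Set.Ioc (0 : ℝ) 1, cutSinDeriv n k x * cutSinDeriv n l x

theorem tendsto_overlap {k l : ℕ} (hk : 0 < k) : Filter.Tendsto (fun n => overlap n k l)
    Filter.atTop (nhds (if k = l then 1 / 2 else 0)) :=
  tendsto_integral_cutSin hk

theorem tendsto_overlapDeriv {k l : ℕ} (hk : 0 < k) : Filter.Tendsto (fun n => overlapDeriv n k l)
    Filter.atTop (nhds (if k = l then (Real.pi * k) ^ 2 / 2 else 0)) :=
  tendsto_integral_cutSinDeriv hk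

theorem setIntegral_unitSq_mul (f g : ℝ → ℝ) :
    ∫ z in unitSq, f z.1 * g z.2 =
      (∫ x in Set.Ioc (0 : ℝ) 1, f x) * ∫ y in Set.Ioc (0 : ℝ) 1, g y :=
  setIntegral_prod_mul f g _ _

theorem continuous_cutSin (n k : ℕ) : Continuous (cutSin n k) := (contDiff_cutSin n k).continuous

theorem integral_norm_sq_trial (n : ℕ) (F : Finset (ℕ × ℕ)) (a : ℕ × ℕ → ℂ) :
    ∫ x in unitSq, ‖trial n F a x‖ ^ 2 = ∑ i ∈ F, ∑ j ∈ F,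
      overlap n i.1 j.1 * overlap n i.2 j.2 * ((a i).re * (a j).re + (a i).im * (a j).im) := by
  have hc := fun k => continuous_cutSin n k
  simp only [trial, norm_sq_sum_mul_ofReal]
  rw [integral_finsetSum _ fun i _ => integrableOn_unitSq (by fun_prop)]
  refine Finset.sum_congr rfl fun i _ => ?_
  rw [integral_finsetSum _ fun j _ => integrableOn_unitSq (by fun_prop)]
  refine Finset.sum_congr rfl fun j _ => ?_
  rw [integral_mul_const, overlap, overlap, ← setIntegral_unitSq_mul]
  congr 2
  ext z
  ring

theorem integral_gradSq_trial (n : ℕ) (F : Finset (ℕ × ℕ)) (a : ℕ × ℕ → ℂ) :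
    ∫ x in unitSq, gradSq (trial n F a) x = ∑ i ∈ F, ∑ j ∈ F,
      (overlapDeriv n i.1 j.1 * overlap n i.2 j.2 + overlap n i.1 j.1 * overlapDeriv n i.2 j.2) *
        ((a i).re * (a j).re + (a i).im * (a j).im) := by
  have hc := fun k => continuous_cutSin n k
  have hd := fun k => continuous_cutSinDeriv n k
  simp only [gradSq, fderiv_trial, mul_one, mul_zero, add_zero, zero_mul, zero_add,
    norm_sq_sum_mul_ofReal, ← Finset.sum_add_distrib, ← add_mul]
  rw [integral_finsetSum _ fun i _ => integrableOn_unitSq (by fun_prop)]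
  refine Finset.sum_congr rfl fun i _ => ?_
  rw [integral_finsetSum _ fun j _ => integrableOn_unitSq (by fun_prop)]
  refine Finset.sum_congr rfl fun j _ => ?_
  rw [integral_mul_const, overlap, overlap, overlapDeriv, overlapDeriv, ← setIntegral_unitSq_mul,
    ← setIntegral_unitSq_mul, ← integral_add (integrableOn_unitSq (by fun_prop))
      (integrableOn_unitSq (by fun_prop))]
  congr 2
  ext z
  ring

/-- Uniform bounds for the linear combinations of a finite family of cut-off sine modes. -/
structure IsTrialFamily (n : ℕ) (F : Finset (ℕ × ℕ)) (R C : ℝ) : Prop where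
  n_pos : 0 < n
  R_pos : 0 < R
  C_nonneg : 0 ≤ C
  grad_le : ∀ a, ∫ x in unitSq, gradSq (trial n F a) x ≤ R * ∫ x in unitSq, ‖trial n F a x‖ ^ 2
  sup_le : ∀ a x, ‖trial n F a x‖ ^ 2 ≤ C * ∫ x in unitSq, ‖trial n F a x‖ ^ 2
  coeff_le : ∀ a, ∑ k ∈ F, ‖a k‖ ^ 2 ≤ 5 * ∫ x in unitSq, ‖trial n F a x‖ ^ 2

theorem exists_trialFamily {δ : ℝ} (hδ : 0 < δ) :
    ∃ (F : Finset (ℕ × ℕ)) (R C : ℝ) (n : ℕ), IsTrialFamily n F R C ∧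
      (1 - δ) * R / (4 * Real.pi) ≤ F.card := by
  obtain ⟨ν, hν, hcard⟩ := exists_card_posModes (half_pos hδ)
  set F := (modeSet ν).filter fun k => 0 < k.1 ∧ 0 < k.2 with hF
  set R := (1 + δ / 2) * ν with hR
  have hR0 : 0 < R := by positivity
  have hνR : ν < R := by rw [hR]; nlinarith
  have hG : ∀ i ∈ F, ∀ j ∈ F, Filter.Tendsto (fun n => overlap n i.1 j.1 * overlap n i.2 j.2)
      Filter.atTop (nhds (if i = j then 1 / 4 else 0)) := by
    intro i hi j _
    have hi' := (Finset.mem_filter.1 hi).2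
    convert (tendsto_overlap (l := j.1) hi'.1).mul
      (tendsto_overlap (l := j.2) hi'.2) using 2
    simp only [Prod.ext_iff]
    by_cases h1 : i.1 = j.1 <;> by_cases h2 : i.2 = j.2 <;> simp only [h1, h2] <;> norm_num
  have hD : ∀ i ∈ F, ∀ j ∈ F, Filter.Tendsto (fun n => R * (overlap n i.1 j.1 * overlap n i.2 j.2) -
      (overlapDeriv n i.1 j.1 * overlap n i.2 j.2 + overlap n i.1 j.1 * overlapDeriv n i.2 j.2))
      Filter.atTop (nhds (if i = j then
        (R - ((Real.pi * i.1) ^ 2 + (Real.pi * i.2) ^ 2)) / 4 else 0)) := by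
    intro i hi j hj
    have hi' := (Finset.mem_filter.1 hi).2
    convert ((hG i hi j hj).const_mul R).sub (((tendsto_overlapDeriv (l := j.1) hi'.1).mul
      (tendsto_overlap (l := j.2) hi'.2)).add ((tendsto_overlap (l := j.1) hi'.1).mul
      (tendsto_overlapDeriv (l := j.2) hi'.2))) using 2
    simp only [Prod.ext_iff]
    by_cases h1 : i.1 = j.1 <;> by_cases h2 : i.2 = j.2 <;>
      simp only [h1, h2, and_self, and_true, and_false, if_true, if_false] <;> ring
  have e1 := eventually_le_quadForm_complex F _ (fun _ => 1 / 4) (κ := 1 / 5)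
    (fun i _ => by norm_num) hG
  have e2 := eventually_le_quadForm_complex F _ _ (κ := 0) (fun i hi => by
    have := mem_modeSet.1 (Finset.mem_filter.1 hi).1
    linarith) hD
  obtain ⟨n, ⟨h1, h2⟩, hn⟩ := ((e1.and e2).and (Filter.eventually_gt_atTop 0)).exists
  have h3 : ∀ a, ∑ k ∈ F, ‖a k‖ ^ 2 ≤ 5 * ∫ x in unitSq, ‖trial n F a x‖ ^ 2 := by
    intro a
    rw [integral_norm_sq_trial]
    linarith [h1 a]
  refine ⟨F, R, 5 * F.card, n, ⟨hn, hR0, by positivity, fun a => ?_, fun a x => ?_, h3⟩, ?_⟩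
  · rw [integral_norm_sq_trial, integral_gradSq_trial, Finset.mul_sum, ← sub_nonneg,
      ← Finset.sum_sub_distrib]
    have := h2 a
    rw [zero_mul] at this
    refine this.trans (le_of_eq (Finset.sum_congr rfl fun i _ => ?_))
    rw [Finset.mul_sum, ← Finset.sum_sub_distrib]
    refine Finset.sum_congr rfl fun j _ => ?_
    ring
  · calc ‖trial n F a x‖ ^ 2 ≤ (∑ k ∈ F, ‖a k‖) ^ 2 := by
          gcongr
          refine norm_sum_le_of_le _ fun k _ => ?_
          rw [norm_mul, Complex.norm_real, norm_mul]
          exact mul_le_of_le_one_right (norm_nonneg _) (mul_le_one₀ (abs_cutSin_le _ _ _)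
            (norm_nonneg _) (abs_cutSin_le _ _ _))
      _ ≤ F.card * ∑ k ∈ F, ‖a k‖ ^ 2 := sq_sum_le_card_mul_sum_sq
      _ ≤ F.card * (5 * ∫ x in unitSq, ‖trial n F a x‖ ^ 2) := by gcongr; exact h3 a
      _ = _ := by ring
  · refine le_trans ?_ hcard
    refine div_le_div_of_nonneg_right ?_ (by positivity)
    rw [hR]
    nlinarith [mul_pos hν (mul_pos hδ hδ)]

/-- There is a `d`-dimensional space of test functions supported in `A` on which the form of
`D_Φ² - W` is negative. -/
def NegOn (Φ : ℝ) (W : ℝ × ℝ → ℝ) (A : Set (ℝ × ℝ)) (d : ℕ) : Prop :=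
  ∃ (ι : Type) (_ : Fintype ι) (T : (ι → ℂ) →ₗ[ℂ] (ℝ × ℝ → ℂ)), Fintype.card ι = d ∧
    (∀ a, IsTestFun (T a) ∧ tsupport (T a) ⊆ A) ∧
    ∀ a, a ≠ 0 → magEnergy Φ (T a) < ∫ x, W x * ‖T a x‖ ^ 2

theorem magEnergy_zero (Φ : ℝ) : magEnergy Φ 0 = 0 := by
  simp [magEnergy]

theorem NegOn.le_negEigCount {Φ : ℝ} {W : ℝ × ℝ → ℝ} {A : Set (ℝ × ℝ)} {d : ℕ}
    (h : NegOn Φ W A d) : (d : ℝ≥0∞) ≤ negEigCount Φ W := by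
  obtain ⟨ι, _, T, rfl, hT, hneg⟩ := h
  have hinj : Function.Injective T := by
    rw [← LinearMap.ker_eq_bot, LinearMap.ker_eq_bot']
    intro a ha
    by_contra h0
    have := hneg a h0
    simp [ha, magEnergy_zero] at this
  have hrank : Module.finrank ℂ (LinearMap.range T) = Fintype.card ι := by
    rw [LinearMap.finrank_range_of_inj hinj, Module.finrank_fintype_fun_eq_card]
  rw [← hrank]
  refine le_iSup₂_of_le (LinearMap.range T) ⟨inferInstance, ?_, ?_⟩ le_rfl
  · rintro _ ⟨a, rfl⟩
    exact (hT a).1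
  · rintro _ ⟨a, rfl⟩ h0
    exact hneg a fun h => h0 (by rw [h, map_zero])

theorem NegOn.mono {Φ : ℝ} {W : ℝ × ℝ → ℝ} {A B : Set (ℝ × ℝ)} {d : ℕ} (h : NegOn Φ W A d)
    (hAB : A ⊆ B) : NegOn Φ W B d := by
  obtain ⟨ι, hι, T, hd, hT, hneg⟩ := h
  exact ⟨ι, hι, T, hd, fun a => ⟨(hT a).1, (hT a).2.trans hAB⟩, hneg⟩

theorem isTestFun_zero : IsTestFun 0 := testSub.zero_mem

theorem negOn_zero (Φ : ℝ) (W : ℝ × ℝ → ℝ) (A : Set (ℝ × ℝ)) : NegOn Φ W A 0 :=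
  ⟨Empty, inferInstance, 0, rfl, fun _ => ⟨isTestFun_zero, by simp [tsupport]⟩,
    fun a ha => (ha (Subsingleton.elim _ _)).elim⟩

theorem magDensity_zero_of_notMem {Φ : ℝ} {u : ℝ × ℝ → ℂ} {x : ℝ × ℝ} (hx : x ∉ tsupport u) :
    magDensity Φ u x = 0 := by
  rw [notMem_tsupport_iff_eventuallyEq] at hx
  simp [magDensity, hx.fderiv_eq, hx.eq_of_nhds]

theorem magDensity_congr {Φ : ℝ} {u v : ℝ × ℝ → ℂ} {x : ℝ × ℝ} (h : u =ᶠ[nhds x] v) :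
    magDensity Φ u x = magDensity Φ v x := by
  simp only [magDensity, h.fderiv_eq, h.eq_of_nhds]

theorem magDensity_add {Φ : ℝ} {u v : ℝ × ℝ → ℂ} (h : Disjoint (tsupport u) (tsupport v))
    (x : ℝ × ℝ) : magDensity Φ (u + v) x = magDensity Φ u x + magDensity Φ v x := by
  by_cases hx : x ∈ tsupport u
  · have hv := Set.disjoint_left.1 h hx
    rw [magDensity_zero_of_notMem hv, add_zero]
    refine magDensity_congr ?_
    filter_upwards [notMem_tsupport_iff_eventuallyEq.1 hv] with y hy
    simp [hy]
  · rw [magDensity_zero_of_notMem hx, zero_add]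
    refine magDensity_congr ?_
    filter_upwards [notMem_tsupport_iff_eventuallyEq.1 hx] with y hy
    simp [hy]

theorem norm_sq_add_of_disjoint {u v : ℝ × ℝ → ℂ} (h : Disjoint (tsupport u) (tsupport v))
    (x : ℝ × ℝ) : ‖(u + v) x‖ ^ 2 = ‖u x‖ ^ 2 + ‖v x‖ ^ 2 := by
  by_cases hx : x ∈ tsupport u
  · simp [image_eq_zero_of_notMem_tsupport (Set.disjoint_left.1 h hx)]
  · simp [image_eq_zero_of_notMem_tsupport hx]

theorem IsTestFun.integrable_norm_sq {u : ℝ × ℝ → ℂ} (hu : IsTestFun u) :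
    Integrable fun x => ‖u x‖ ^ 2 :=
  (hu.1.continuous.norm.pow 2).integrable_of_hasCompactSupport
    (HasCompactSupport.intro hu.2.1 fun x hx => by simp [image_eq_zero_of_notMem_tsupport hx])

theorem IsTestFun.integrable_mul_norm_sq {u : ℝ × ℝ → ℂ} (hu : IsTestFun u) {W : ℝ × ℝ → ℝ}
    (hWm : Measurable W) {B : ℝ} (hB : ∀ᵐ x, |W x| ≤ B) : Integrable fun x => W x * ‖u x‖ ^ 2 :=
  hu.integrable_norm_sq.bdd_mul hWm.aestronglyMeasurable hB

theorem NegOn.union {Φ : ℝ} {W : ℝ × ℝ → ℝ} (hWm : Measurable W) {B : ℝ}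
    (hB : ∀ᵐ x, |W x| ≤ B) {A₁ A₂ : Set (ℝ × ℝ)} (hA : Disjoint A₁ A₂) {d₁ d₂ : ℕ}
    (h₁ : NegOn Φ W A₁ d₁) (h₂ : NegOn Φ W A₂ d₂) : NegOn Φ W (A₁ ∪ A₂) (d₁ + d₂) := by
  obtain ⟨ι₁, _, T₁, rfl, hT₁, hneg₁⟩ := h₁
  obtain ⟨ι₂, _, T₂, rfl, hT₂, hneg₂⟩ := h₂
  refine ⟨ι₁ ⊕ ι₂, inferInstance, T₁.comp (LinearMap.funLeft ℂ ℂ Sum.inl) +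
    T₂.comp (LinearMap.funLeft ℂ ℂ Sum.inr), Fintype.card_sum, fun a => ?_, fun a ha => ?_⟩
  · obtain ⟨t1, s1⟩ := hT₁ (LinearMap.funLeft ℂ ℂ Sum.inl a)
    obtain ⟨t2, s2⟩ := hT₂ (LinearMap.funLeft ℂ ℂ Sum.inr a)
    exact ⟨testSub.add_mem t1 t2, (tsupport_add _ _).trans (Set.union_subset_union s1 s2)⟩
  · set u := T₁ (LinearMap.funLeft ℂ ℂ Sum.inl a) with hu
    set v := T₂ (LinearMap.funLeft ℂ ℂ Sum.inr a) with hv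
    obtain ⟨t1, s1⟩ : IsTestFun u ∧ tsupport u ⊆ A₁ := hT₁ _
    obtain ⟨t2, s2⟩ : IsTestFun v ∧ tsupport v ⊆ A₂ := hT₂ _
    have hd : Disjoint (tsupport u) (tsupport v) := hA.mono s1 s2
    have e1 : magEnergy Φ (u + v) = magEnergy Φ u + magEnergy Φ v := by
      change ∫ x, magDensity Φ (u + v) x = _
      simp only [magDensity_add hd]
      exact integral_add (t1.integrable_magDensity Φ) (t2.integrable_magDensity Φ)
    have e2 : ∫ x, W x * ‖(u + v) x‖ ^ 2 =
        (∫ x, W x * ‖u x‖ ^ 2) + ∫ x, W x * ‖v x‖ ^ 2 := by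
      simp only [norm_sq_add_of_disjoint hd, mul_add]
      exact integral_add (t1.integrable_mul_norm_sq hWm hB) (t2.integrable_mul_norm_sq hWm hB)
    change magEnergy Φ (u + v) < ∫ x, W x * ‖(u + v) x‖ ^ 2
    rw [e1, e2]
    have w1 : magEnergy Φ u ≤ ∫ x, W x * ‖u x‖ ^ 2 := by
      by_cases h : LinearMap.funLeft ℂ ℂ Sum.inl a = (0 : ι₁ → ℂ)
      · rw [hu, h]; simp [magEnergy_zero]
      · exact (hneg₁ _ h).le
    have w2 : magEnergy Φ v ≤ ∫ x, W x * ‖v x‖ ^ 2 := by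
      by_cases h : LinearMap.funLeft ℂ ℂ Sum.inr a = (0 : ι₂ → ℂ)
      · rw [hv, h]; simp [magEnergy_zero]
      · exact (hneg₂ _ h).le
    by_cases h : LinearMap.funLeft ℂ ℂ Sum.inl a = (0 : ι₁ → ℂ)
    · refine add_lt_add_of_le_of_lt w1 (hneg₂ _ fun h' => ha ?_)
      ext (i | i)
      · exact congrFun h i
      · exact congrFun h' i
    · exact add_lt_add_of_lt_of_le (hneg₁ _ h) w2

theorem NegOn.biUnion {Φ : ℝ} {W : ℝ × ℝ → ℝ} (hWm : Measurable W) {B : ℝ}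
    (hB : ∀ᵐ x, |W x| ≤ B) {ι : Type*} (s : Finset ι) {A : ι → Set (ℝ × ℝ)}
    (hA : Pairwise (Function.onFun Disjoint A)) {d : ι → ℕ} (h : ∀ i ∈ s, NegOn Φ W (A i) (d i)) :
    NegOn Φ W (⋃ i ∈ s, A i) (∑ i ∈ s, d i) := by
  classical
  induction s using Finset.induction_on with
  | empty => exact negOn_zero _ _ _
  | insert i s his ih =>
    rw [Finset.set_biUnion_insert, Finset.sum_insert his]
    refine NegOn.union hWm hB ?_ (h i (Finset.mem_insert_self _ _))
      (ih fun j hj => h j (Finset.mem_insert_of_mem hj))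
    exact Set.disjoint_iUnion₂_right.2 fun j hj => hA fun hij => his (hij ▸ hj)

/-- The linear map sending coefficients to rescaled trial functions on a square. -/
noncomputable def cellMap (n : ℕ) (F : Finset (ℕ × ℕ)) (p : ℝ × ℝ) (h : ℝ) :
    (F → ℂ) →ₗ[ℂ] (ℝ × ℝ → ℂ) where
  toFun a x := trial n F (Function.extend Subtype.val a 0) (h⁻¹ • (x - p))
  map_add' a b := by
    ext x
    have : (0 : ℕ × ℕ → ℂ) = 0 + 0 := by simp
    rw [this, Function.extend_add]
    simp [trial, add_mul, Finset.sum_add_distrib]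
  map_smul' c a := by
    ext x
    have : (0 : ℕ × ℕ → ℂ) = c • 0 := by simp
    rw [this, Function.extend_smul]
    simp [trial, mul_assoc, Finset.mul_sum]

theorem cellMap_apply (n : ℕ) (F : Finset (ℕ × ℕ)) (p : ℝ × ℝ) (h : ℝ) (a : F → ℂ) (x : ℝ × ℝ) :
    cellMap n F p h a x = trial n F (Function.extend Subtype.val a 0) (h⁻¹ • (x - p)) := rfl

theorem cellMap_add_smul (n : ℕ) (F : Finset (ℕ × ℕ)) (p : ℝ × ℝ) {h : ℝ} (hh : 0 < h) (a : F → ℂ)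
    (z : ℝ × ℝ) :
    cellMap n F p h a (p + h • z) = trial n F (Function.extend Subtype.val a 0) z := by
  rw [cellMap_apply, add_sub_cancel_left, smul_smul, inv_mul_cancel₀ hh.ne', one_smul]

theorem contDiff_cellMap (n : ℕ) (F : Finset (ℕ × ℕ)) (p : ℝ × ℝ) (h : ℝ) (a : F → ℂ) :
    ContDiff ℝ (⊤ : ℕ∞) (cellMap n F p h a) := by
  have : ContDiff ℝ (⊤ : ℕ∞) fun x : ℝ × ℝ => h⁻¹ • (x - p) :=
    (contDiff_id.sub contDiff_const).const_smul h⁻¹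
  exact (contDiff_trial n F _).comp this

theorem tsupport_cellMap {n : ℕ} (hn : 0 < n) (F : Finset (ℕ × ℕ)) (p : ℝ × ℝ) {h : ℝ} (hh : 0 < h)
    (a : F → ℂ) : IsCompact (tsupport (cellMap n F p h a)) ∧
      tsupport (cellMap n F p h a) ⊆ square p h := by
  set K : Set (ℝ × ℝ) := Set.Icc (1 / (n : ℝ)) (1 - 1 / n) ×ˢ Set.Icc (1 / (n : ℝ)) (1 - 1 / n)
    with hK
  have hKc : IsCompact ((fun z : ℝ × ℝ => p + h • z) '' K) :=
    (isCompact_Icc.prod isCompact_Icc).image (by fun_prop)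
  have hsub : tsupport (cellMap n F p h a) ⊆ (fun z : ℝ × ℝ => p + h • z) '' K := by
    refine closure_minimal (fun x hx => ?_) hKc.isClosed
    refine ⟨h⁻¹ • (x - p), ?_, ?_⟩
    · by_contra hxK
      exact hx (trial_eq_zero hn F _ hxK)
    · simp [smul_smul, mul_inv_cancel₀ hh.ne']
  refine ⟨hKc.of_isClosed_subset (isClosed_tsupport _) hsub, hsub.trans ?_⟩
  have hn' : 0 < 1 / (n : ℝ) := by positivity
  rintro _ ⟨z, ⟨h1, h2⟩, rfl⟩
  refine ⟨⟨?_, ?_⟩, ⟨?_, ?_⟩⟩ <;> simp only [Prod.fst_add, Prod.snd_add, Prod.smul_fst,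
    Prod.smul_snd, smul_eq_mul]
  · nlinarith [h1.1]
  · nlinarith [h1.2]
  · nlinarith [h2.1]
  · nlinarith [h2.2]

theorem isTestFun_cellMap {n : ℕ} (hn : 0 < n) (F : Finset (ℕ × ℕ)) (p : ℝ × ℝ) {h : ℝ}
    (hh : 0 < h) (h0 : (0 : ℝ × ℝ) ∉ square p h) (a : F → ℂ) : IsTestFun (cellMap n F p h a) := by
  obtain ⟨h1, h2⟩ := tsupport_cellMap hn F p hh a
  exact ⟨contDiff_cellMap n F p h a, h1,
    notMem_tsupport_iff_eventuallyEq.1 fun h => h0 (h2 h)⟩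

theorem IsTrialFamily.negOn_square {n : ℕ} {F : Finset (ℕ × ℕ)} {R C : ℝ}
    (ht : IsTrialFamily n F R C) (Φ : ℝ) {W : ℝ × ℝ → ℝ} (hWm : Measurable W) {B : ℝ}
    (hB : ∀ᵐ x, |W x| ≤ B) {θ : ℝ} (hθ : 0 < θ) {p : ℝ × ℝ} {h : ℝ} (hh : 0 < h) {m : ℝ}
    (hm0 : 0 < m) (hm : ∀ x ∈ square p h, m ≤ sqnorm x) {c : ℝ}
    (hc : (1 + θ) * R + (1 + 1 / θ) * Φ ^ 2 / m * h ^ 2 + C * (∫ x in square p h, |W x - c|) <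
      c * h ^ 2) : NegOn Φ W (square p h) F.card := by
  have h0 : (0 : ℝ × ℝ) ∉ square p h := fun h0 => by
    have := hm 0 h0
    simp [sqnorm] at this
    linarith
  have hs := measurableSet_square p h
  refine ⟨F, inferInstance, cellMap n F p h, by simp, fun a =>
    ⟨isTestFun_cellMap ht.n_pos F p hh h0 a, (tsupport_cellMap ht.n_pos F p hh a).2⟩,
    fun a ha => ?_⟩
  set u := cellMap n F p h a with hu
  set v := trial n F (Function.extend Subtype.val a 0) with hv
  set J := ∫ x in unitSq, ‖v x‖ ^ 2 with hJ
  have huT : IsTestFun u := isTestFun_cellMap ht.n_pos F p hh h0 a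
  have hsupp : ∀ x, x ∉ square p h → x ∉ tsupport u := fun x hx hx' =>
    hx ((tsupport_cellMap ht.n_pos F p hh a).2 hx')
  have huv : (fun z => u (p + h • z)) = v := funext fun z => cellMap_add_smul n F p hh a z
  have hJ0 : 0 < J := by
    have h1 := ht.coeff_le (Function.extend Subtype.val a 0)
    obtain ⟨k, hk⟩ := Function.ne_iff.1 ha
    have h2 : ‖a k‖ ^ 2 ≤ ∑ i ∈ F, ‖Function.extend Subtype.val a 0 i‖ ^ 2 := by
      have := Finset.single_le_sum
        (f := fun i => ‖(Function.extend Subtype.val a 0 : ℕ × ℕ → ℂ) i‖ ^ 2)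
        (fun i _ => sq_nonneg _) k.2
      simpa only [Subtype.val_injective.extend_apply] using this
    have h3 : 0 < ‖a k‖ ^ 2 := by
      have : 0 < ‖a k‖ := norm_pos_iff.2 hk
      positivity
    linarith
  have i1 : ∫ x in square p h, ‖u x‖ ^ 2 = h ^ 2 * J := by
    rw [setIntegral_square _ _ hh, hJ, ← huv]
  have i2 : ∫ x in square p h, gradSq u x ≤ R * J := by
    rw [setIntegral_square _ _ hh, ← integral_const_mul]
    simp only [← gradSq_comp_add_smul huT.contDiff_one, huv]
    exact ht.grad_le _
  have i3 : magEnergy Φ u ≤ (1 + θ) * (R * J) + (1 + 1 / θ) * Φ ^ 2 / m * (h ^ 2 * J) := by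
    have e : magEnergy Φ u = ∫ x in square p h, magDensity Φ u x :=
      (setIntegral_eq_integral_of_forall_compl_eq_zero fun x hx =>
        magDensity_zero_of_notMem (hsupp x hx)).symm
    rw [e, ← i1]
    refine le_trans ?_ (add_le_add_left (mul_le_mul_of_nonneg_left i2 (by positivity)) _)
    rw [← integral_const_mul, ← integral_const_mul, ← integral_add
      (huT.integrable_gradSq.integrableOn.const_mul _)
      (huT.integrable_norm_sq.integrableOn.const_mul _)]
    refine setIntegral_mono_on (huT.integrable_magDensity Φ).integrableOn
      ((huT.integrable_gradSq.integrableOn.const_mul _).add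
      (huT.integrable_norm_sq.integrableOn.const_mul _)) hs fun x hx => ?_
    refine (magDensity_le Φ u hθ x).trans (add_le_add_right ?_ _)
    rw [div_mul_eq_mul_div, mul_div_assoc]
    gcongr
    exact hm x hx
  have i4 : c * (h ^ 2 * J) - C * J * (∫ x in square p h, |W x - c|) ≤
      ∫ x, W x * ‖u x‖ ^ 2 := by
    have e : ∫ x, W x * ‖u x‖ ^ 2 = ∫ x in square p h, W x * ‖u x‖ ^ 2 :=
      (setIntegral_eq_integral_of_forall_compl_eq_zero fun x hx => by
        simp [image_eq_zero_of_notMem_tsupport (hsupp x hx)]).symm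
    have hWi : IntegrableOn (fun x => |W x - c|) (square p h) :=
      ((integrableOn_square_of_bounded hWm hB p h).sub
        (integrableOn_const (volume_square_lt_top p h).ne)).abs
    rw [e, ← i1, ← integral_const_mul, ← integral_const_mul, ← integral_sub
      (huT.integrable_norm_sq.integrableOn.const_mul _) (hWi.const_mul _)]
    refine setIntegral_mono_on ((huT.integrable_norm_sq.integrableOn.const_mul _).sub
      (hWi.const_mul _)) (huT.integrable_mul_norm_sq hWm hB).integrableOn hs fun x hx => ?_
    have h1 : ‖u x‖ ^ 2 ≤ C * J := ht.sup_le _ _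
    nlinarith [mul_le_mul_of_nonneg_right h1 (abs_nonneg (W x - c)),
      mul_le_mul_of_nonneg_right (neg_abs_le (W x - c)) (sq_nonneg ‖u x‖)]
  refine i3.trans_lt (lt_of_lt_of_le ?_ i4)
  have := mul_lt_mul_of_pos_right hc hJ0
  linarith

theorem sq_sub_le_floor_sq {H h : ℝ} (hH : 0 < H) (hh : 0 < h) :
    H ^ 2 - 2 * H * h ≤ (⌊H / h⌋₊ : ℝ) ^ 2 * h ^ 2 := by
  have h1 : H < (⌊H / h⌋₊ + 1) * h := (div_lt_iff₀ hh).1 (Nat.lt_floor_add_one _)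
  have h2 : 0 ≤ (⌊H / h⌋₊ : ℝ) * h := by positivity
  rcases le_total H h with h3 | h3
  · nlinarith [sq_nonneg ((⌊H / h⌋₊ : ℝ) * h)]
  · nlinarith

theorem IsTrialFamily.negOn_coarse {n : ℕ} {F : Finset (ℕ × ℕ)} {R C : ℝ}
    (ht : IsTrialFamily n F R C) (Φ : ℝ) {V : ℝ × ℝ → ℝ} (hVm : Measurable V) {B : ℝ}
    (hB : ∀ᵐ x, |V x| ≤ B) {θ : ℝ} (hθ : 0 < θ) {p : ℝ × ℝ} {H : ℝ} (hH : 0 < H) {m : ℝ}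
    (hm0 : 0 < m) (hm : ∀ x ∈ square p H, m ≤ sqnorm x) {c τ : ℝ} (hτ : 0 < τ)
    (hcτ : 3 * τ < c) {ε : ℝ} (hε : 0 < ε) :
    ∃ L : ℝ, ∀ lam : ℝ, L ≤ lam → ∃ d : ℕ,
      lam * (F.card / ((1 + θ) * R)) * (c - 3 * τ) *
        (H ^ 2 - ε - C * (∫ x in square p H, |V x - c|) / τ) ≤ d ∧
      NegOn Φ (fun x => lam * V x) (square p H) d := by
  classical
  have hR := ht.R_pos
  have hC := ht.C_nonneg
  have hcτ' : 0 < c - 3 * τ := by linarith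
  set A := (1 + θ) * R / (c - 3 * τ) with hA
  have hA0 : 0 < A := by positivity
  set K := (1 + 1 / θ) * Φ ^ 2 / m with hK
  have hK0 : 0 ≤ K := by positivity
  set ω := ∫ x in square p H, |V x - c| with hω
  refine ⟨max (K / τ) (A * (2 * H / ε) ^ 2), fun lam hlam => ?_⟩
  have hl1 : K ≤ lam * τ := (div_le_iff₀ hτ).1 ((le_max_left _ _).trans hlam)
  have hl2 : A * (2 * H / ε) ^ 2 ≤ lam := (le_max_right _ _).trans hlam
  have hl0 : 0 < lam := lt_of_lt_of_le (by positivity) hl2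
  set h := Real.sqrt (A / lam) with hh_def
  have hh : 0 < h := Real.sqrt_pos.2 (by positivity)
  have hhsq : h ^ 2 = A / lam := Real.sq_sqrt (by positivity)
  have hlh : lam * h ^ 2 * (c - 3 * τ) = (1 + θ) * R := by
    rw [hhsq, hA]; field_simp
  have hHh : 2 * H * h ≤ ε := by
    refine (pow_le_pow_iff_left₀ (by positivity) hε.le two_ne_zero).1 ?_
    rw [mul_pow, hhsq, mul_div_assoc', div_le_iff₀ hl0]
    have : A * (2 * H / ε) ^ 2 * ε ^ 2 = (2 * H) ^ 2 * A := by field_simp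
    nlinarith [mul_le_mul_of_nonneg_right hl2 (sq_nonneg ε)]
  set M := ⌊H / h⌋₊ with hM
  have hhM : h * M ≤ H := by
    have := (le_div_iff₀ hh).1 (Nat.floor_le (a := H / h) (by positivity))
    linarith
  set s := Finset.range M ×ˢ Finset.range M with hs
  have hVi : ∀ q r, IntegrableOn (fun x => |V x - c|) (square q r) := fun q r =>
    ((integrableOn_square_of_bounded hVm hB q r).sub
      (integrableOn_const (volume_square_lt_top q r).ne)).abs
  have hsum : ∑ k ∈ s, ∫ x in gridSquare p h k, |V x - c| ≤ ω := by
    rw [hs, ← setIntegral_gridSquare p hh M (hVi _ _)]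
    refine setIntegral_mono_set (hVi _ _) (ae_of_all _ fun x => abs_nonneg _)
      (LE.le.eventuallyLE ?_)
    exact Set.prod_mono (Set.Ioc_subset_Ioc_right (by linarith))
      (Set.Ioc_subset_Ioc_right (by linarith))
  set good := s.filter fun k => C * (∫ x in gridSquare p h k, |V x - c|) < τ * h ^ 2 with hgood
  set bad := s.filter fun k => ¬C * (∫ x in gridSquare p h k, |V x - c|) < τ * h ^ 2 with hbad
  have hcard : (good.card : ℝ) + bad.card = (M : ℝ) ^ 2 := by
    have := Finset.card_filter_add_card_filter_not (s := s)
      fun k => C * (∫ x in gridSquare p h k, |V x - c|) < τ * h ^ 2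
    rw [hs, Finset.card_product, Finset.card_range] at this
    rw [sq]
    exact_mod_cast this
  have hbadcard : bad.card * (τ * h ^ 2) ≤ C * ω := by
    rw [← nsmul_eq_mul]
    calc bad.card • (τ * h ^ 2) ≤ ∑ k ∈ bad, C * ∫ x in gridSquare p h k, |V x - c| :=
          Finset.card_nsmul_le_sum _ _ _ fun k hk => not_lt.1 (Finset.mem_filter.1 hk).2
      _ ≤ ∑ k ∈ s, C * ∫ x in gridSquare p h k, |V x - c| :=
          Finset.sum_le_sum_of_subset_of_nonneg (Finset.filter_subset _ _) fun k _ _ =>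
            mul_nonneg hC (integral_nonneg fun x => abs_nonneg _)
      _ ≤ C * ω := by
          rw [← Finset.mul_sum]
          exact mul_le_mul_of_nonneg_left hsum hC
  have hWm : Measurable fun x => lam * V x := hVm.const_mul _
  have hWB : ∀ᵐ x, |lam * V x| ≤ lam * B := hB.mono fun x hx => by
    rw [abs_mul, abs_of_pos hl0]
    gcongr
  have hneg : ∀ k ∈ good, NegOn Φ (fun x => lam * V x) (gridSquare p h k) F.card := by
    intro k hk
    obtain ⟨hks, hkg⟩ := Finset.mem_filter.1 hk
    refine ht.negOn_square Φ hWm hWB hθ hh hm0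
      (fun x hx => hm x (gridSquare_subset p hh.le hhM hks hx)) (c := lam * c) ?_
    have e : ∀ x, |lam * V x - lam * c| = lam * |V x - c| := fun x => by
      rw [← mul_sub, abs_mul, abs_of_pos hl0]
    simp only [e]
    rw [integral_const_mul]
    change C * (∫ x in square (p.1 + h * k.1, p.2 + h * k.2) h, |V x - c|) < τ * h ^ 2 at hkg
    have h1 := mul_lt_mul_of_pos_left hkg hl0
    have h2 := mul_le_mul_of_nonneg_right hl1 (sq_nonneg h)
    have h3 : 0 < lam * τ * h ^ 2 := by positivity
    rw [← hlh]
    linarith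
  refine ⟨∑ k ∈ good, F.card, ?_, (NegOn.biUnion hWm hWB good (gridSquare_disjoint p hh)
    hneg).mono (Set.iUnion₂_subset fun k hk =>
      gridSquare_subset p hh.le hhM (Finset.mem_filter.1 hk).1)⟩
  rw [Finset.sum_const, smul_eq_mul]
  push_cast
  have e : lam * (F.card / ((1 + θ) * R)) * (c - 3 * τ) = F.card / h ^ 2 := by
    rw [← hlh]; field_simp
  rw [e, div_mul_eq_mul_div, div_le_iff₀ (by positivity)]
  have hb : bad.card * h ^ 2 ≤ C * ω / τ := by
    rw [le_div_iff₀ hτ]; linarith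
  have hfl := sq_sub_le_floor_sq hH hh
  have : H ^ 2 - ε - C * ω / τ ≤ good.card * h ^ 2 := by
    have : (good.card : ℝ) * h ^ 2 = (M : ℝ) ^ 2 * h ^ 2 - bad.card * h ^ 2 := by
      rw [← hcard]; ring
    rw [this]
    linarith
  calc (F.card : ℝ) * (H ^ 2 - ε - C * ω / τ) ≤ F.card * (good.card * h ^ 2) := by gcongr
    _ = _ := by ring

theorem setIntegral_posPart_le_step {V : ℝ × ℝ → ℝ} (hVm : Measurable V) {B : ℝ}
    (hB : ∀ᵐ x, |V x| ≤ B) (p : ℝ × ℝ) {s : ℝ} (hs : 0 < s) (M : ℕ) (c : ℕ × ℕ → ℝ) :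
    ∫ x in square p (s * M), max (V x) 0 ≤ ∑ k ∈ Finset.range M ×ˢ Finset.range M,
      (s ^ 2 * max (c k) 0 + ∫ x in gridSquare p s k, |V x - c k|) := by
  have hV : ∀ q r, IntegrableOn V (square q r) := integrableOn_square_of_bounded hVm hB
  rw [setIntegral_gridSquare p hs M (hV _ _).pos_part]
  refine Finset.sum_le_sum fun k _ => ?_
  have hi : IntegrableOn (fun x => |V x - c k|) (gridSquare p s k) :=
    ((hV _ _).sub (integrableOn_const (volume_square_lt_top _ _).ne)).abs
  have hc : IntegrableOn (fun _ : ℝ × ℝ => max (c k) 0) (gridSquare p s k) :=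
    integrableOn_const (volume_square_lt_top _ _).ne
  have e : s ^ 2 * max (c k) 0 = ∫ _ in gridSquare p s k, max (c k) 0 := by
    rw [setIntegral_const, smul_eq_mul, gridSquare, measureReal_def, volume_real_square _ hs.le]
  rw [e, ← integral_add hc hi]
  refine setIntegral_mono_on (hV _ _).pos_part (hc.add hi) (measurableSet_gridSquare _ _ _)
    fun x _ => max_le ?_ (add_nonneg (le_max_right _ _) (abs_nonneg _))
  linarith [le_max_left (c k) 0, le_abs_self (V x - c k)]

theorem IsTrialFamily.negOn_weyl {n : ℕ} {F : Finset (ℕ × ℕ)} {R C : ℝ}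
    (ht : IsTrialFamily n F R C) (Φ : ℝ) {V : ℝ × ℝ → ℝ} (hVm : Measurable V) {B : ℝ}
    (hB0 : 0 ≤ B) (hB : ∀ᵐ x, |V x| ≤ B) {θ : ℝ} (hθ : 0 < θ) {p : ℝ × ℝ} {H : ℝ} (hH : 0 < H)
    {m : ℝ} (hm0 : 0 < m) (hm : ∀ x ∈ square p H, m ≤ sqnorm x) {ε : ℝ} (hε : 0 < ε) :
    ∀ᶠ lam : ℝ in Filter.atTop, ∃ d : ℕ,
      lam * (F.card / ((1 + θ) * R)) * ((∫ x in square p H, max (V x) 0) - ε) ≤ d ∧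
      NegOn Φ (fun x => lam * V x) (square p H) d := by
  have hR := ht.R_pos
  have hC := ht.C_nonneg
  set τ := ε / (12 * H ^ 2) with hτ
  have hτ0 : 0 < τ := by positivity
  set η := ε / 4 / (1 + B * C / τ) with hη
  have hη0 : 0 < η := by positivity
  obtain ⟨M, hM, c, hcB, hcη⟩ := exists_step_approx hVm hB0 hB p hH hη0
  have hM' : (0 : ℝ) < M := by exact_mod_cast hM
  set s := H / M with hs
  have hs0 : 0 < s := by positivity
  have hsM : s * M = H := by rw [hs]; field_simp
  set S := Finset.range M ×ˢ Finset.range M with hS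
  have hScard : (S.card : ℝ) = (M : ℝ) ^ 2 := by
    rw [hS, Finset.card_product, Finset.card_range]; push_cast; ring
  set ε₁ := ε / 4 / (M ^ 2 * (B + 1)) with hε₁
  have hε₁0 : 0 < ε₁ := by positivity
  set ω := fun k => ∫ x in gridSquare p s k, |V x - c k| with hω
  have hω0 : ∀ k, 0 ≤ ω k := fun k => integral_nonneg fun x => abs_nonneg _
  have hcell : ∀ k ∈ S, ∀ᶠ lam : ℝ in Filter.atTop, ∃ d : ℕ,
      lam * (F.card / ((1 + θ) * R)) * (max (c k - 3 * τ) 0 * (s ^ 2 - ε₁ - C * ω k / τ)) ≤ d ∧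
      NegOn Φ (fun x => lam * V x) (gridSquare p s k) d := by
    intro k hk
    rcases lt_or_ge (3 * τ) (c k) with h | h
    · obtain ⟨L, hL⟩ := ht.negOn_coarse Φ hVm hB hθ hs0 hm0
        (fun x hx => hm x (gridSquare_subset p hs0.le hsM.le hk hx)) hτ0 h hε₁0
      filter_upwards [Filter.eventually_ge_atTop L] with lam hlam
      obtain ⟨d, hd, hneg⟩ := hL lam hlam
      refine ⟨d, ?_, hneg⟩
      rw [max_eq_left (by linarith), ← mul_assoc]
      exact hd
    · refine Filter.Eventually.of_forall fun lam => ⟨0, ?_, negOn_zero _ _ _⟩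
      rw [max_eq_right (by linarith)]
      simp
  filter_upwards [(Filter.eventually_all_finset S).2 hcell, Filter.eventually_gt_atTop 0]
    with lam hlam hlam0
  choose! d hd hneg using hlam
  have hWB : ∀ᵐ x, |lam * V x| ≤ lam * B := hB.mono fun x hx => by
    rw [abs_mul, abs_of_pos hlam0]
    gcongr
  refine ⟨∑ k ∈ S, d k, ?_, (NegOn.biUnion (hVm.const_mul lam) hWB S (gridSquare_disjoint p hs0)
    hneg).mono (Set.iUnion₂_subset fun k hk => gridSquare_subset p hs0.le hsM.le hk)⟩
  push_cast
  refine le_trans ?_ (Finset.sum_le_sum hd)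
  rw [← Finset.mul_sum]
  refine mul_le_mul_of_nonneg_left ?_ (by positivity)
  have h1 := setIntegral_posPart_le_step hVm hB p hs0 M c
  rw [hsM] at h1
  have h2 : ∀ k ∈ S,
      (s ^ 2 * max (c k) 0 + ω k) - (3 * τ * s ^ 2 + B * ε₁ + (1 + B * C / τ) * ω k) ≤
      max (c k - 3 * τ) 0 * (s ^ 2 - ε₁ - C * ω k / τ) := by
    intro k _
    have a1 : max (c k - 3 * τ) 0 ≤ B :=
      max_le (by linarith [le_abs_self (c k), hcB k]) hB0
    have a2 : max (c k) 0 - 3 * τ ≤ max (c k - 3 * τ) 0 := by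
      rcases le_total (c k) 0 with h | h
      · rw [max_eq_right h]; linarith [le_max_right (c k - 3 * τ) 0]
      · rw [max_eq_left h]; exact le_max_left _ _
    have a3 : 0 ≤ C * ω k / τ := div_nonneg (mul_nonneg hC (hω0 k)) hτ0.le
    have a4 := mul_le_mul_of_nonneg_right a2 (sq_nonneg s)
    have a5 := mul_le_mul_of_nonneg_right a1 hε₁0.le
    have a6 := mul_le_mul_of_nonneg_right a1 a3
    have a7 : B * C / τ * ω k = B * (C * ω k / τ) := by ring
    linarith
  refine le_trans ?_ (Finset.sum_le_sum h2)
  rw [Finset.sum_sub_distrib]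
  refine sub_le_sub h1 ?_
  rw [Finset.sum_add_distrib, Finset.sum_const, nsmul_eq_mul, hScard, ← Finset.mul_sum]
  have b1 : (M : ℝ) ^ 2 * (3 * τ * s ^ 2 + B * ε₁) ≤ ε / 4 + ε / 4 := by
    have : (M : ℝ) ^ 2 * (3 * τ * s ^ 2) = ε / 4 := by
      rw [hs, hτ]; field_simp; norm_num
    have h3 : (M : ℝ) ^ 2 * (B * ε₁) = ε / 4 * (B / (B + 1)) := by
      rw [hε₁]; field_simp
    have h4 : B / (B + 1) ≤ 1 := (div_le_one (by positivity)).2 (by linarith)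
    rw [mul_add, this, h3]
    nlinarith
  have b2 : (1 + B * C / τ) * ∑ k ∈ S, ω k ≤ ε / 4 := by
    have : (1 + B * C / τ) * η = ε / 4 := by
      rw [hη]; field_simp
    rw [← this]
    exact mul_le_mul_of_nonneg_left hcη (by positivity)
  linarith

theorem eventually_negEigCount_ge (Φ : ℝ) {V : ℝ × ℝ → ℝ} (hVm : Measurable V) {B : ℝ}
    (hB0 : 0 ≤ B) (hB : ∀ᵐ x, |V x| ≤ B) (hVp : Integrable fun x => max (V x) 0) {a : ℝ}
    (ha0 : 0 ≤ a) (ha : a < (∫ x, max (V x) 0) / (4 * Real.pi)) :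
    ∃ b, a < b ∧ ∀ᶠ lam : ℝ in Filter.atTop,
      ENNReal.ofReal (lam * b) ≤ negEigCount Φ fun x => lam * V x := by
  set I := ∫ x, max (V x) 0 with hI
  obtain ⟨δ, hδ, hδ0, hδ1⟩ : ∃ δ : ℝ, a < (1 - δ) / ((1 + δ) * (4 * Real.pi)) * (I - δ) ∧
      0 < δ ∧ δ < 1 := by
    have hcont : ContinuousAt (fun δ : ℝ => (1 - δ) / ((1 + δ) * (4 * Real.pi)) * (I - δ)) 0 :=
      (ContinuousAt.div (by fun_prop) (by fun_prop) (by simp [Real.pi_ne_zero])).mul (by fun_prop)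
    have h1 := hcont.eventually (lt_mem_nhds (a := a) (by simpa [div_eq_inv_mul] using ha))
    exact ((h1.filter_mono nhdsWithin_le_nhds).and
      (Ioo_mem_nhdsGT (one_pos : (0 : ℝ) < 1))).exists
  obtain ⟨F, R, C, n, ht, hcard⟩ := exists_trialFamily hδ0
  have hR := ht.R_pos
  set b := (1 - δ) / ((1 + δ) * (4 * Real.pi)) * (I - δ) with hb
  have hg : (1 - δ) / ((1 + δ) * (4 * Real.pi)) ≤ F.card / ((1 + δ) * R) := by
    rw [div_le_div_iff₀ (by positivity) (by positivity)]
    rw [div_le_iff₀ (by positivity)] at hcard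
    nlinarith
  have hIδ : 0 ≤ I - δ := by
    by_contra h
    have : (1 - δ) / ((1 + δ) * (4 * Real.pi)) * (I - δ) ≤ 0 :=
      mul_nonpos_of_nonneg_of_nonpos (div_nonneg (by linarith) (by positivity)) (not_le.1 h).le
    linarith
  obtain ⟨S, hS⟩ : ∃ S : Finset (ℤ × annIdx), I - δ / 2 <
      ∑ i ∈ S, ∫ x in dyadicSquare i, max (V x) 0 :=
    ((hasSum_integral_dyadicSquare hVp).eventually (lt_mem_nhds (by linarith))).exists
  have hsq : ∀ i ∈ S, ∀ᶠ lam : ℝ in Filter.atTop, ∃ d : ℕ,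
      lam * (F.card / ((1 + δ) * R)) *
        ((∫ x in dyadicSquare i, max (V x) 0) - δ / 2 / (S.card + 1)) ≤ d ∧
      NegOn Φ (fun x => lam * V x) (dyadicSquare i) d := fun i _ =>
    ht.negOn_weyl Φ hVm hB0 hB hδ0 (two_zpow_pos i.1)
      (pow_pos (two_zpow_pos i.1) 2) (fun x hx => le_sqnorm_of_mem hx) (by positivity)
  refine ⟨b, hδ, ?_⟩
  filter_upwards [(Filter.eventually_all_finset S).2 hsq, Filter.eventually_gt_atTop 0]
    with lam hlam hlam0
  choose! d hd hneg using hlam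
  have hWB : ∀ᵐ x, |lam * V x| ≤ lam * B := hB.mono fun x hx => by
    rw [abs_mul, abs_of_pos hlam0]
    gcongr
  refine le_trans ?_ (NegOn.biUnion (hVm.const_mul lam) hWB S dyadicSquare_disjoint
    hneg).le_negEigCount
  rw [← ENNReal.ofReal_natCast]
  refine ENNReal.ofReal_le_ofReal ?_
  push_cast
  refine le_trans ?_ (Finset.sum_le_sum hd)
  rw [← Finset.mul_sum, Finset.sum_sub_distrib, Finset.sum_const, nsmul_eq_mul, mul_assoc]
  refine mul_le_mul_of_nonneg_left ?_ hlam0.le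
  have h1 : S.card * (δ / 2 / (S.card + 1)) ≤ δ / 2 := by
    rw [mul_div_assoc', div_le_iff₀ (by positivity)]
    nlinarith
  rw [hb]
  exact mul_le_mul hg (by linarith) hIδ (by positivity)

theorem strong_coupling_asymptotics_AB_short_range
    (Φ : ℝ) (hΦ : ∀ k : ℤ, Φ ≠ k) (p : ℝ) (hp0 : 0 < p) (hp1 : p < 1)
    (V : ℝ × ℝ → ℝ) (hVmeas : Measurable V)
    (hVbdd : ∃ B : ℝ, ∀ᵐ x : ℝ × ℝ, |V x| ≤ B)
    (hVasymp : Filter.Tendsto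
      (fun x : ℝ × ℝ => sqnorm x * Real.log (Real.sqrt (sqnorm x)) ^ (1 / p) * V x)
      (Filter.cocompact (ℝ × ℝ)) (nhds 1)) :
    Filter.Tendsto
      (fun lam : ℝ => ENNReal.ofReal lam⁻¹ * negEigCount Φ (fun x => lam * V x))
      Filter.atTop
      (nhds (ENNReal.ofReal
        ((1 / (4 * Real.pi)) * ∫ x : ℝ × ℝ, max (V x) 0))) := by
  obtain ⟨W, hW, hWs, hVW⟩ := exists_dyadic_bound hp0 hp1 hVbdd hVasymp
  have hVp := integrable_posPart hVmeas hW hWs hVW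
  obtain ⟨B, hB0, hB⟩ : ∃ B : ℝ, 0 ≤ B ∧ ∀ᵐ x : ℝ × ℝ, |V x| ≤ B := by
    obtain ⟨B, hB⟩ := hVbdd
    exact ⟨max B 0, le_max_right _ _, hB.mono fun x hx => hx.trans (le_max_left _ _)⟩
  rw [one_div, inv_mul_eq_div]
  refine tendsto_order.2 ⟨fun c hc => ?_, fun c hc => ?_⟩
  · have hctop : c ≠ ⊤ := (hc.trans ENNReal.ofReal_lt_top).ne
    obtain ⟨b, hb, hev⟩ := eventually_negEigCount_ge Φ hVmeas hB0 hB hVp ENNReal.toReal_nonneg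
      ((ENNReal.lt_ofReal_iff_toReal_lt hctop).1 hc)
    filter_upwards [hev, Filter.eventually_gt_atTop 0] with lam hlam hpos
    calc c < ENNReal.ofReal b := (ENNReal.lt_ofReal_iff_toReal_lt hctop).2 hb
      _ = ENNReal.ofReal lam⁻¹ * ENNReal.ofReal (lam * b) := by
        rw [← ENNReal.ofReal_mul (by positivity), inv_mul_cancel_left₀ hpos.ne']
      _ ≤ _ := mul_le_mul_right hlam _
  · obtain ⟨a, -, ha, hac⟩ := ENNReal.lt_iff_exists_real_btwn.1 hc
    obtain ⟨L, hL⟩ := codimLE_upper hΦ hVmeas hB0 hB hW hWs hVW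
      ((ENNReal.ofReal_lt_ofReal_iff_of_nonneg
        (div_nonneg (integral_nonneg fun x => le_max_right _ _) (by positivity))).1 ha)
    filter_upwards [Filter.eventually_ge_atTop L, Filter.eventually_gt_atTop 0] with lam hlam hpos
    obtain ⟨K, hK, hcod⟩ := hL lam hlam
    calc _ ≤ ENNReal.ofReal lam⁻¹ * ENNReal.ofReal (lam * a) := by
          refine mul_le_mul_right ((negEigCount_le hcod).trans ?_) _
          rw [← ENNReal.ofReal_natCast]
          exact ENNReal.ofReal_le_ofReal hK
      _ = ENNReal.ofReal a := by
        rw [← ENNReal.ofReal_mul (by positivity), inv_mul_cancel_left₀ hpos.ne']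
      _ < c := hac
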